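/- There exists a constant C such that for every n, every properly edge-colored complete graph on n vertices contains a Hamiltonian cycle in which at least n - C(log n)^2 distinct colors appear. -/

import Mathlib

/-- An edge-coloring of a graph is a *proper edge-coloring* if the edges incident to any
single vertex receive pairwise distinct colors, i.e. distinct edges sharing a vertex get
distinct colors. -/
def IsProperEdgeColoring {V : Type*} (G : SimpleGraph V) (c : Sym2 V → ℕ) : Prop :=
  ∀ ⦃e₁ e₂ : Sym2 V⦄, e₁ ∈ G.edgeSet → e₂ ∈ G.edgeSet → e₁ ≠ e₂ →
    (∃ v, v ∈ e₁ ∧ v ∈ e₂) → c e₁ ≠ c e₂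

namespace HC
open scoped Classical

/-- directed linear forest -/
structure DF (n : ℕ) where
  pred : Fin n → Option (Fin n)
  inj : ∀ x y p, pred x = some p → pred y = some p → x = y
  phi : Fin n → ℤ
  lt : ∀ x p, pred x = some p → phi p < phi x

namespace DF
variable {n : ℕ}

theorem wf (f : Fin n → ℤ) : WellFounded (fun a b => f a < f b) := by
  have : IsTrans (Fin n) (fun a b => f a < f b) := ⟨fun a b c h1 h2 => lt_trans h1 h2⟩
  have : Std.Irrefl (fun a b : Fin n => f a < f b) := ⟨fun a h => lt_irrefl _ h⟩
  exact Finite.wellFounded_of_trans_of_irrefl _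

theorem exists_root (T : DF n) : ∃ rt : Fin n → Fin n, 
    (∀ x, T.pred x = none → rt x = x) ∧ (∀ x p, T.pred x = some p → rt x = rt p) := by
  let F : (x : Fin n) → ((y : Fin n) → T.phi y < T.phi x → Fin n) → Fin n := fun x ih =>
    if h : ∃ p, T.pred x = some p then ih h.choose (T.lt _ _ h.choose_spec) else x
  refine ⟨(wf T.phi).fix F, ?_, ?_⟩
  · intro x hx
    rw [WellFounded.fix_eq]
    simp [F, hx]
  · intro x p hx
    rw [WellFounded.fix_eq]
    have h : ∃ p, T.pred x = some p := ⟨p, hx⟩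
    have h2 : h.choose = p := by
      have := h.choose_spec
      exact (Option.some.inj (hx.symm.trans this)).symm
    have h3 : ∀ q, q = h.choose → (wf T.phi).fix F h.choose = (wf T.phi).fix F q := by
      rintro q rfl; rfl
    rw [← h3 p h2.symm]
    simp only [F, dif_pos h]

noncomputable def root (T : DF n) : Fin n → Fin n := T.exists_root.choose

theorem root_start (T : DF n) {x} (h : T.pred x = none) : T.root x = x :=
  T.exists_root.choose_spec.1 x h
theorem root_pred (T : DF n) {x p} (h : T.pred x = some p) : T.root x = T.root p :=
  T.exists_root.choose_spec.2 x p h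

theorem ind (T : DF n) {P : Fin n → Prop} (h0 : ∀ x, T.pred x = none → P x)
    (h1 : ∀ x p, T.pred x = some p → P p → P x) (x : Fin n) : P x := by
  refine (wf T.phi).induction (C := P) x ?_
  intro x ih
  cases hx : T.pred x with
  | none => exact h0 x hx
  | some p => exact h1 x p hx (ih p (T.lt _ _ hx))

theorem pred_root (T : DF n) (x) : T.pred (T.root x) = none := by
  induction x using T.ind with
  | h0 x h => rw [T.root_start h]; exact h
  | h1 x p h ih => rw [T.root_pred h]; exact ih

/-- successor -/
noncomputable def succ (T : DF n) (p : Fin n) : Option (Fin n) :=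
  if h : ∃ x, T.pred x = some p then some h.choose else none

theorem succ_eq (T : DF n) {p x} : T.succ p = some x ↔ T.pred x = some p := by
  unfold succ
  constructor
  · intro h
    split_ifs at h with h1
    · have := h1.choose_spec
      rw [Option.some.inj h] at this
      exact this
  · intro h
    have h1 : ∃ x, T.pred x = some p := ⟨x, h⟩
    rw [dif_pos h1]
    exact congrArg some (T.inj _ _ _ h1.choose_spec h)

/-- colour of the edge entering `x` -/
def a (T : DF n) (col : Fin n → Fin n → ℕ) (x : Fin n) : Option ℕ := (T.pred x).map (fun p => col p x)

theorem a_eq (T : DF n) {col : Fin n → Fin n → ℕ} {x κ} : T.a col x = some κ ↔ ∃ p, T.pred x = some p ∧ col p x = κ := by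
  simp [a, Option.map_eq_some_iff]
theorem a_none (T : DF n) {col : Fin n → Fin n → ℕ} {x} : T.a col x = none ↔ T.pred x = none := by
  simp [a]

/-- owner of a slot: `(x,true)` the in-slot, `(x,false)` the out-slot -/
noncomputable def own (T : DF n) (col : Fin n → Fin n → ℕ) (x : Fin n) (s : Bool) : Option ℕ :=
  if s then T.a col x else (T.succ x).bind (T.a col)

@[simp] theorem own_true (T : DF n) {col : Fin n → Fin n → ℕ} {x} : T.own col x true = T.a col x := rfl
theorem own_false (T : DF n) {col : Fin n → Fin n → ℕ} {p κ} :
    T.own col p false = some κ ↔ ∃ x, T.pred x = some p ∧ col p x = κ := by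
  simp only [own, Bool.false_eq_true, if_false, Option.bind_eq_some_iff, succ_eq]
  constructor
  · rintro ⟨x, hx, h⟩
    obtain ⟨p', hp, h⟩ := T.a_eq.1 h
    rw [hx] at hp; cases hp
    exact ⟨x, hx, h⟩
  · rintro ⟨x, hx, h⟩
    exact ⟨x, hx, T.a_eq.2 ⟨p, hx, h⟩⟩
theorem own_false_none (T : DF n) {col : Fin n → Fin n → ℕ} {p} :
    T.own col p false = none ↔ ∀ x, T.pred x ≠ some p := by
  constructor
  · intro h x hx
    have := (T.own_false (col := col)).2 ⟨x, hx, rfl⟩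
    rw [h] at this; cases this
  · intro h
    cases h1 : T.own col p false with
    | none => rfl
    | some κ => obtain ⟨x, hx, _⟩ := T.own_false.1 h1; exact absurd hx (h x)

/-- rainbow -/
def Rb (T : DF n) (col : Fin n → Fin n → ℕ) : Prop :=
  ∀ x y κ, T.a col x = some κ → T.a col y = some κ → x = y

noncomputable def starts (T : DF n) : Finset (Fin n) := Finset.univ.filter (fun x => T.pred x = none)
noncomputable def cols (T : DF n) (col : Fin n → Fin n → ℕ) : Finset ℕ :=
  (Finset.univ.filter (fun x => T.pred x ≠ none)).image (fun x => (T.a col x).getD 0)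

theorem mem_starts (T : DF n) {x} : x ∈ T.starts ↔ T.pred x = none := by simp [starts]
theorem mem_cols (T : DF n) {col : Fin n → Fin n → ℕ} {κ} : κ ∈ T.cols col ↔ ∃ x, T.a col x = some κ := by
  simp only [cols, Finset.mem_image, Finset.mem_filter, Finset.mem_univ, true_and]
  constructor
  · rintro ⟨x, hx, h⟩
    obtain ⟨p, hp⟩ := Option.ne_none_iff_exists'.1 hx
    refine ⟨x, ?_⟩
    rw [← h]; simp [a, hp]
  · rintro ⟨x, h⟩
    refine ⟨x, ?_, by simp [h]⟩
    rw [Ne, ← T.a_none (col := col), h]; simp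

theorem card_cols (T : DF n) {col : Fin n → Fin n → ℕ} (h : T.Rb col) : (T.cols col).card + T.starts.card = n := by
  have h1 : (T.cols col).card = (Finset.univ.filter (fun x => T.pred x ≠ none)).card := by
    apply Finset.card_image_of_injOn
    intro x hx y hy hxy
    simp only [Finset.coe_filter, Finset.mem_univ, true_and, Set.mem_ofPred_eq] at hx hy
    obtain ⟨p, hp⟩ := Option.ne_none_iff_exists'.1 hx
    obtain ⟨q, hq⟩ := Option.ne_none_iff_exists'.1 hy
    refine h x y (col p x) (by simp [a, hp]) ?_
    simp [a, hp, hq] at hxy ⊢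
    exact hxy.symm
  rw [h1, starts]
  have := Finset.card_filter_add_card_filter_not (s := (Finset.univ : Finset (Fin n))) (fun x => T.pred x = none)
  simp only [Finset.card_univ, Fintype.card_fin] at this
  simp only [ne_eq]
  omega

end DF

/-- modification -/
structure Valid {n : ℕ} (col : Fin n → Fin n → ℕ) (T : DF n) (cut : Finset ℕ)
    (J : Finset (Fin n × Fin n × Bool)) : Prop where
  cutsub : cut ⊆ T.cols col
  free_r : ∀ r v s, (r, v, s) ∈ J → ∀ κ, T.a col r = some κ → κ ∈ cut
  free_v : ∀ r v s, (r, v, s) ∈ J → ∀ κ, T.own col v s = some κ → κ ∈ cut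
  inj_r : ∀ r v s v' s', (r, v, s) ∈ J → (r, v', s') ∈ J → v = v' ∧ s = s'
  inj_v : ∀ r r' v s, (r, v, s) ∈ J → (r', v, s) ∈ J → r = r'
  ne : ∀ r v r' v' s', (r, v, true) ∈ J → (r', v', s') ∈ J → v ≠ r'
  rank : ∃ ρ : Fin n → ℕ, ∀ r p, (r, p, false) ∈ J → ρ (T.root p) < ρ (T.root r)
  col_inj : ∀ r v s r' v' s', (r, v, s) ∈ J → (r', v', s') ∈ J → col r v = col r' v' → r = r'
  col_new : ∀ r v s, (r, v, s) ∈ J → col r v ∈ T.cols col → col r v ∈ cut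

end HC

namespace HC
open scoped Classical
variable {n : ℕ}

theorem step1 {col : Fin n → Fin n → ℕ} {T : DF n} {cut J} (hv : Valid col T cut J) :
    ∃ G : DF n, (∀ x p, (x, p, false) ∈ J → G.pred x = some p) ∧
      (∀ x p, T.pred x = some p → col p x ∉ cut → G.pred x = some p) ∧
      (∀ x p, G.pred x = some p → (x, p, false) ∈ J ∨ (T.pred x = some p ∧ col p x ∉ cut)) := by
  obtain ⟨ρ, hρ⟩ := hv.rank
  obtain ⟨M, hM⟩ : ∃ M : ℤ, ∀ x y, T.phi x - T.phi y < M := by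
    obtain ⟨M, hM⟩ := (Set.finite_range (fun z : Fin n × Fin n => T.phi z.1 - T.phi z.2)).bddAbove
    refine ⟨M + 1, fun x y => ?_⟩
    have := hM ⟨(x, y), rfl⟩
    simp only at this
    omega
  let pr : Fin n → Option (Fin n) := fun x =>
    if h : ∃ p, (x, p, false) ∈ J then some h.choose else
      if ∃ κ ∈ cut, T.a col x = some κ then none else T.pred x
  have g1 : ∀ x p, (x, p, false) ∈ J → pr x = some p := by
    intro x p h
    have h1 : ∃ p, (x, p, false) ∈ J := ⟨p, h⟩
    simp only [pr, dif_pos h1]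
    exact congrArg some (hv.inj_r _ _ _ _ _ h1.choose_spec h).1
  have g2 : ∀ x p, T.pred x = some p → col p x ∉ cut → pr x = some p := by
    intro x p h hc
    have ha : T.a col x = some (col p x) := T.a_eq.2 ⟨p, h, rfl⟩
    have h1 : ¬ ∃ p, (x, p, false) ∈ J := by
      rintro ⟨q, hq⟩
      exact hc (hv.free_r _ _ _ hq _ ha)
    have h2 : ¬ ∃ κ ∈ cut, T.a col x = some κ := by
      rintro ⟨κ, hκ, h'⟩
      rw [ha] at h'; cases h'; exact hc hκ
    simp only [pr, dif_neg h1, if_neg h2, h]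
  have g3 : ∀ x p, pr x = some p → (x, p, false) ∈ J ∨ (T.pred x = some p ∧ col p x ∉ cut) := by
    intro x p h
    by_cases h1 : ∃ p, (x, p, false) ∈ J
    · left
      obtain ⟨q, hq⟩ := h1
      rw [g1 _ _ hq] at h; cases h; exact hq
    · right
      simp only [pr, dif_neg h1] at h
      split_ifs at h with h2
      refine ⟨h, fun hc => h2 ⟨_, hc, T.a_eq.2 ⟨p, h, rfl⟩⟩⟩
  refine ⟨⟨pr, ?_, fun x => ρ (T.root x) * M + T.phi x, ?_⟩, g1, g2, g3⟩
  · intro x y p hx hy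
    have key : ∀ x y, (x, p, false) ∈ J → T.pred y = some p → col p y ∉ cut → False := by
      intro x y h1 h2 h3
      exact h3 (hv.free_v _ _ _ h1 _ (T.own_false.2 ⟨y, h2, rfl⟩))
    rcases g3 x p hx with h1 | ⟨h1, h1'⟩ <;> rcases g3 y p hy with h2 | ⟨h2, h2'⟩
    · exact hv.inj_v _ _ _ _ h1 h2
    · exact (key _ _ h1 h2 h2').elim
    · exact (key _ _ h2 h1 h1').elim
    · exact T.inj _ _ _ h1 h2
  · intro x p hx
    rcases g3 x p hx with h1 | ⟨h1, h1'⟩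
    · have h2 := hρ _ _ h1
      have h3 := hM p x
      have h4 := hM p p
      have h5 : (ρ (T.root p) : ℤ) + 1 ≤ ρ (T.root x) := by exact_mod_cast h2
      nlinarith
    · have := T.lt _ _ h1
      rw [T.root_pred h1]
      linarith

theorem step2 (G : DF n) (μ : Fin n → Option (Fin n)) (hs : ∀ b b', μ b = some b' → μ b' = some b)
    (hn : ∀ b b', μ b = some b' → b ≠ b' ∧ G.pred b = none) :
    ∃ T' : DF n,
      (∀ x p, T'.pred x = some p → G.pred x = some p ∨ G.pred p = some x ∨ μ x = some p) ∧
      (∀ x p, G.pred x = some p → T'.pred x = some p ∨ T'.pred p = some x) ∧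
      (∀ x p, μ x = some p → T'.pred x = some p ∨ T'.pred p = some x) ∧
      (∀ b, G.pred b = none → μ b = none → T'.pred b = none ∧
        ∀ x, T'.root x = b → G.root x = b ∧ T'.pred x = G.pred x) := by
  let fl : Fin n → Prop := fun x => ∃ b', μ (G.root x) = some b' ∧ G.root x < b'
  let pr : Fin n → Option (Fin n) := fun x =>
    if fl x then G.succ x else if G.pred x = none then μ x else G.pred x
  have flp : ∀ x p, G.pred x = some p → (fl x ↔ fl p) := by
    intro x p h; simp only [fl, G.root_pred h]
  have flm : ∀ x p, μ x = some p → (fl x ↔ ¬ fl p) := by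
    intro x p h
    have h1 := hs _ _ h
    have h2 := hn _ _ h
    have h3 := hn _ _ h1
    simp only [fl, G.root_start h2.2, G.root_start h3.2, h, h1, Option.some.injEq, exists_eq_left', not_lt]
    exact ⟨fun h => h.le, fun h => lt_of_le_of_ne h h2.1⟩
  have c1 : ∀ x p, fl x → (pr x = some p ↔ G.pred p = some x) := by
    intro x p h; simp only [pr, if_pos h, G.succ_eq]
  have c2 : ∀ x p, ¬ fl x → (pr x = some p ↔ G.pred x = some p ∨ μ x = some p) := by
    intro x p h; simp only [pr, if_neg h]
    split_ifs with h1
    · simp [h1]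
    · constructor
      · exact Or.inl
      · rintro (h2 | h2)
        · exact h2
        · exact absurd (hn _ _ h2).2 h1
  obtain ⟨M, hM⟩ : ∃ M : ℤ, ∀ x, 0 < G.phi x + M := by
    obtain ⟨M, hM⟩ := (Set.finite_range (fun z : Fin n => - G.phi z)).bddAbove
    refine ⟨M + 1, fun x => ?_⟩
    have := hM ⟨x, rfl⟩
    simp only at this
    omega
  let T' : DF n := ⟨pr, ?_, fun x => if fl x then - (G.phi x + M) else G.phi x + M, ?_⟩
  rotate_left
  · have mixed : ∀ x y p, fl x → ¬ fl y → G.pred p = some x → (G.pred y = some p ∨ μ y = some p) → False := by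
      intro x y p fx fy h1 h2
      rcases h2 with h2 | h2
      · exact fy ((flp _ _ h2).2 ((flp _ _ h1).2 fx))
      · have := (hn _ _ (hs _ _ h2)).2
        rw [this] at h1; cases h1
    have mixed2 : ∀ x y p, ¬ fl x → ¬ fl y → G.pred x = some p → μ y = some p → False := by
      intro x y p fx fy h1 h2
      have h3 : fl p := by
        by_contra h; exact fy ((flm _ _ h2).2 h)
      exact fx ((flp _ _ h1).2 h3)
    intro x y p hx hy
    by_cases fx : fl x <;> by_cases fy : fl y
    · rw [c1 _ _ fx] at hx; rw [c1 _ _ fy] at hy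
      rw [hx] at hy; exact Option.some.inj hy
    · rw [c1 _ _ fx] at hx; rw [c2 _ _ fy] at hy
      exact (mixed _ _ _ fx fy hx hy).elim
    · rw [c1 _ _ fy] at hy; rw [c2 _ _ fx] at hx
      exact (mixed _ _ _ fy fx hy hx).elim
    · rw [c2 _ _ fx] at hx; rw [c2 _ _ fy] at hy
      rcases hx with hx | hx <;> rcases hy with hy | hy
      · exact G.inj _ _ _ hx hy
      · exact (mixed2 _ _ _ fx fy hx hy).elim
      · exact (mixed2 _ _ _ fy fx hy hx).elim
      · have := hs _ _ hx
        rw [hs _ _ hy] at this; exact (Option.some.inj this).symm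
  · intro x p hx
    by_cases fx : fl x
    · rw [c1 _ _ fx] at hx
      have fp : fl p := (flp _ _ hx).2 fx
      simp only [if_pos fx, if_pos fp]
      have := G.lt _ _ hx
      linarith
    · rw [c2 _ _ fx] at hx
      rcases hx with hx | hx
      · have fp : ¬ fl p := fun h => fx ((flp _ _ hx).2 h)
        simp only [if_neg fx, if_neg fp]
        have := G.lt _ _ hx
        linarith
      · have fp : fl p := by
          by_contra h; exact fx ((flm _ _ hx).2 h)
        simp only [if_neg fx, if_pos fp]
        linarith [hM x, hM p]
  refine ⟨T', ?_, ?_, ?_, ?_⟩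
  · intro x p hx
    change pr x = some p at hx
    by_cases fx : fl x
    · rw [c1 _ _ fx] at hx; exact Or.inr (Or.inl hx)
    · rw [c2 _ _ fx] at hx; rcases hx with hx | hx
      · exact Or.inl hx
      · exact Or.inr (Or.inr hx)
  · intro x p hx
    change pr x = some p ∨ pr p = some x
    by_cases fx : fl x
    · exact Or.inr ((c1 _ _ ((flp _ _ hx).1 fx)).2 hx)
    · exact Or.inl ((c2 _ _ fx).2 (Or.inl hx))
  · intro x p hx
    change pr x = some p ∨ pr p = some x
    by_cases fx : fl x
    · exact Or.inr ((c2 _ _ ((flm _ _ hx).1 fx)).2 (Or.inr (hs _ _ hx)))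
    · exact Or.inl ((c2 _ _ fx).2 (Or.inr hx))
  · intro b hb hμ
    have nf : ∀ x, G.root x = b → ¬ fl x := by
      rintro x hx ⟨b', h1, _⟩
      rw [hx, hμ] at h1; cases h1
    have hb' : pr b = none := by
      simp only [pr, if_neg (nf b (G.root_start hb)), hb, hμ, if_true]
    have key : ∀ x, T'.root x = b → G.root x = b := by
      intro x
      induction x using T'.ind with
      | h0 x h => 
        intro h1; rw [T'.root_start h] at h1; subst h1; exact G.root_start hb
      | h1 x p h ih =>
        intro h1; rw [T'.root_pred h] at h1
        have h2 := ih h1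
        change pr x = some p at h
        by_cases fx : fl x
        · rw [c1 _ _ fx] at h
          rw [← h2, G.root_pred h]
        · rw [c2 _ _ fx] at h
          rcases h with h | h
          · rw [G.root_pred h, h2]
          · have h3 := hs _ _ h
            rw [G.root_start (hn _ _ h3).2] at h2
            rw [h2, hμ] at h3; cases h3
    refine ⟨hb', fun x hx => ⟨key x hx, ?_⟩⟩
    have h1 := nf x (key x hx)
    change pr x = _
    simp only [pr, if_neg h1]
    split_ifs with h2
    · have := key x hx
      rw [G.root_start h2] at this
      rw [this, hμ, hb]
    · rfl

structure Mod (col : Fin n → Fin n → ℕ) (T : DF n) (cut : Finset ℕ)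
    (J : Finset (Fin n × Fin n × Bool)) (T' : DF n) : Prop where
  rb : T'.Rb col
  cols : T'.cols col = (T.cols col \ cut) ∪ J.image (fun j => col j.1 j.2.1)
  keep : ∀ x p, T.pred x = some p → col p x ∉ cut → T'.pred x = some p ∨ T'.pred p = some x
  join : ∀ r v s, (r, v, s) ∈ J → T'.pred r = some v ∨ T'.pred v = some r
  start : ∀ b, (∀ κ, T.a col b = some κ → κ ∈ cut) → (∀ v s, (b, v, s) ∉ J) → (∀ r, (r, b, true) ∉ J) →
    T'.pred b = none
  arm : ∀ b, T.pred b = none → (∀ v s, (b, v, s) ∉ J) → (∀ r, (r, b, true) ∉ J) →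
    (∀ r p, (r, p, false) ∈ J → T.root p ≠ b) → ∀ x, T'.root x = b → T.root x = b ∧ T'.pred x = T.pred x
      ∧ ∀ κ, T.a col x = some κ → κ ∉ cut
  arm2 : ∀ b, (∀ κ, T.a col b = some κ → κ ∈ cut) → (∀ v s, (b, v, s) ∉ J) → (∀ r, (r, b, true) ∉ J) →
    ∀ x p, T'.root x = b → T.pred x = some p → col p x ∉ cut → T'.pred x = some p

theorem card_mod {col : Fin n → Fin n → ℕ} {T : DF n} {cut J} (hv : Valid col T cut J) :
    ((T.cols col \ cut) ∪ J.image (fun j => col j.1 j.2.1)).card + cut.card = (T.cols col).card + J.card := by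
  have h1 : Disjoint (T.cols col \ cut) (J.image (fun j => col j.1 j.2.1)) := by
    rw [Finset.disjoint_left]
    intro κ h1 h2
    simp only [Finset.mem_image, Prod.exists] at h2
    obtain ⟨r, v, s, h2, rfl⟩ := h2
    rw [Finset.mem_sdiff] at h1
    exact h1.2 (hv.col_new _ _ _ h2 h1.1)
  rw [Finset.card_union_of_disjoint h1, Finset.card_image_of_injOn]
  · have := Finset.card_sdiff_add_card_eq_card hv.cutsub
    omega
  · rintro ⟨r, v, s⟩ h ⟨r', v', s'⟩ h' he
    have := hv.col_inj _ _ _ _ _ _ h h' he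
    subst this
    obtain ⟨rfl, rfl⟩ := hv.inj_r _ _ _ _ _ h h'
    rfl

theorem main_mod {col : Fin n → Fin n → ℕ} (hsym : ∀ u v, col u v = col v u) {T : DF n} (hT : T.Rb col)
    {cut J} (hv : Valid col T cut J) : ∃ T' : DF n, Mod col T cut J T' := by
  obtain ⟨G, g1, g2, g3⟩ := step1 hv
  -- matching
  let R : Fin n → Fin n → Prop := fun b b' => (b, b', true) ∈ J ∨ (b', b, true) ∈ J
  have Rs : ∀ b b', R b b' → R b' b := fun b b' h => h.symm
  have Ru : ∀ b b' b'', R b b' → R b b'' → b' = b'' := by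
    rintro b b' b'' (h | h) (h' | h')
    · exact (hv.inj_r _ _ _ _ _ h h').1
    · exact (hv.ne _ _ _ _ _ h' h rfl).elim
    · exact (hv.ne _ _ _ _ _ h h' rfl).elim
    · exact hv.inj_v _ _ _ _ h h'
  let μ : Fin n → Option (Fin n) := fun b => if h : ∃ b', R b b' then some h.choose else none
  have hμ : ∀ b b', μ b = some b' ↔ R b b' := by
    intro b b'
    simp only [μ]
    constructor
    · intro h
      split_ifs at h with h1
      have := h1.choose_spec
      rwa [Option.some.inj h] at this
    · intro h
      have h1 : ∃ b', R b b' := ⟨b', h⟩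
      rw [dif_pos h1]
      exact congrArg some (Ru _ _ _ h1.choose_spec h)
  have Gnone : ∀ b, (∀ κ, T.a col b = some κ → κ ∈ cut) → (∀ v, (b, v, false) ∉ J) → G.pred b = none := by
    intro b h1 h2
    cases h : G.pred b with
    | none => rfl
    | some p =>
      rcases g3 _ _ h with h3 | ⟨h3, h4⟩
      · exact (h2 _ h3).elim
      · exact (h4 (h1 _ (T.a_eq.2 ⟨p, h3, rfl⟩))).elim
  have hR : ∀ b b', R b b' → b ≠ b' ∧ G.pred b = none := by
    rintro b b' (h | h)
    · refine ⟨fun h' => hv.ne _ _ _ _ _ h h h'.symm, Gnone b (hv.free_r _ _ _ h) ?_⟩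
      intro v h2
      have := (hv.inj_r _ _ _ _ _ h h2).2
      cases this
    · refine ⟨fun h' => hv.ne _ _ _ _ _ h h h', Gnone b (hv.free_v _ _ _ h) ?_⟩
      intro v h2
      exact hv.ne _ _ _ _ _ h h2 rfl
  obtain ⟨T', t1, t2, t3, t4⟩ := step2 G μ (fun b b' h => (hμ _ _).2 (Rs _ _ ((hμ _ _).1 h)))
    (fun b b' h => hR _ _ ((hμ _ _).1 h))
  have keep : ∀ x p, T.pred x = some p → col p x ∉ cut → T'.pred x = some p ∨ T'.pred p = some x :=
    fun x p h h' => t2 _ _ (g2 _ _ h h')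
  have join : ∀ r v s, (r, v, s) ∈ J → T'.pred r = some v ∨ T'.pred v = some r := by
    intro r v s h
    cases s
    · exact t2 _ _ (g1 _ _ h)
    · exact t3 _ _ ((hμ _ _).2 (Or.inl h))
  -- edges of the new forest
  have edge : ∀ x p, T'.pred x = some p → 
      (∃ y q, T.pred y = some q ∧ col q y ∉ cut ∧ col q y = col p x ∧ ((x = y ∧ p = q) ∨ (x = q ∧ p = y))) ∨
      (∃ r v s, (r, v, s) ∈ J ∧ col r v = col p x ∧ ((x = r ∧ p = v) ∨ (x = v ∧ p = r))) := by
    intro x p h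
    rcases t1 _ _ h with h | h | h
    · rcases g3 _ _ h with h | ⟨h, h'⟩
      · exact Or.inr ⟨_, _, _, h, hsym _ _, Or.inl ⟨rfl, rfl⟩⟩
      · exact Or.inl ⟨_, _, h, h', rfl, Or.inl ⟨rfl, rfl⟩⟩
    · rcases g3 _ _ h with h | ⟨h, h'⟩
      · exact Or.inr ⟨_, _, _, h, rfl, Or.inr ⟨rfl, rfl⟩⟩
      · exact Or.inl ⟨_, _, h, h', hsym _ _, Or.inr ⟨rfl, rfl⟩⟩
    · rcases (hμ _ _).1 h with h | h
      · exact Or.inr ⟨_, _, _, h, hsym _ _, Or.inl ⟨rfl, rfl⟩⟩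
      · exact Or.inr ⟨_, _, _, h, rfl, Or.inr ⟨rfl, rfl⟩⟩
  refine ⟨T', ?_, ?_, keep, join, ?_, ?_, ?_⟩
  · intro x y κ hx hy
    obtain ⟨p, hp, hpc⟩ := T'.a_eq.1 hx
    obtain ⟨q, hq, hqc⟩ := T'.a_eq.1 hy
    have hfin : ((x = y ∧ p = q) ∨ (x = q ∧ p = y)) → x = y := by
      rintro (h | ⟨rfl, rfl⟩)
      · exact h.1
      · have := T'.lt _ _ hp
        have := T'.lt _ _ hq
        omega
    apply hfin
    rcases edge _ _ hp with ⟨y1, q1, e1, e2, e3, e4⟩ | ⟨r1, v1, s1, e1, e2, e4⟩ <;>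
    rcases edge _ _ hq with ⟨y2, q2, d1, d2, d3, d4⟩ | ⟨r2, v2, s2, d1, d2, d4⟩
    · have : y1 = y2 := hT _ _ κ (T.a_eq.2 ⟨_, e1, by omega⟩) (T.a_eq.2 ⟨_, d1, by omega⟩)
      subst this
      rw [e1] at d1; cases d1
      grind
    · exfalso
      have h1 : col r2 v2 = col q1 y1 := by omega
      apply e2
      rw [← h1]
      apply hv.col_new _ _ _ d1
      rw [h1]
      exact T.mem_cols.2 ⟨_, T.a_eq.2 ⟨_, e1, rfl⟩⟩
    · exfalso
      have h1 : col r1 v1 = col q2 y2 := by omega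
      apply d2
      rw [← h1]
      apply hv.col_new _ _ _ e1
      rw [h1]
      exact T.mem_cols.2 ⟨_, T.a_eq.2 ⟨_, d1, rfl⟩⟩
    · have := hv.col_inj _ _ _ _ _ _ e1 d1 (by omega)
      subst this
      obtain ⟨rfl, rfl⟩ := hv.inj_r _ _ _ _ _ e1 d1
      grind
  · ext κ
    rw [Finset.mem_union, Finset.mem_sdiff, Finset.mem_image, T'.mem_cols, T.mem_cols]
    constructor
    · rintro ⟨x, hx⟩
      obtain ⟨p, hp, hpc⟩ := T'.a_eq.1 hx
      rcases edge _ _ hp with ⟨y1, q1, e1, e2, e3, e4⟩ | ⟨r1, v1, s1, e1, e2, e4⟩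
      · left
        exact ⟨⟨y1, T.a_eq.2 ⟨_, e1, by omega⟩⟩, by rwa [← hpc, ← e3]⟩
      · right
        exact ⟨_, e1, by simp only; omega⟩
    · rintro (⟨⟨x, hx⟩, h⟩ | ⟨⟨r, v, s⟩, h, h'⟩)
      · obtain ⟨p, hp, hpc⟩ := T.a_eq.1 hx
        rcases keep _ _ hp (by rwa [hpc]) with h1 | h1
        · exact ⟨_, T'.a_eq.2 ⟨_, h1, hpc⟩⟩
        · exact ⟨_, T'.a_eq.2 ⟨_, h1, by rw [hsym]; exact hpc⟩⟩
      · rcases join _ _ _ h with h1 | h1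
        · exact ⟨_, T'.a_eq.2 ⟨_, h1, by rw [hsym]; exact h'⟩⟩
        · exact ⟨_, T'.a_eq.2 ⟨_, h1, h'⟩⟩
  · intro b h1 h2 h3
    refine (t4 b (Gnone b h1 fun v => h2 v _) ?_).1
    cases h : μ b with
    | none => rfl
    | some b' =>
      rcases (hμ _ _).1 h with h | h
      · exact (h2 _ _ h).elim
      · exact (h3 _ h).elim
  · intro b h0 h2 h3 h4 x hx
    have hGb := Gnone b (fun κ hκ => by rw [T.a_none.2 h0] at hκ; cases hκ) fun v => h2 v _
    have hμb : μ b = none := by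
      cases h : μ b with
      | none => rfl
      | some b' =>
        rcases (hμ _ _).1 h with h | h
        · exact (h2 _ _ h).elim
        · exact (h3 _ h).elim
    obtain ⟨h5, h6⟩ := (t4 b hGb hμb).2 x hx
    have key : ∀ x, G.root x = b → T.root x = b ∧ G.pred x = T.pred x ∧ ∀ κ, T.a col x = some κ → κ ∉ cut := by
      intro x
      induction x using G.ind with
      | h0 x h =>
        intro h1
        rw [G.root_start h] at h1; subst h1
        exact ⟨T.root_start h0, by rw [h, h0], fun κ hκ => by rw [T.a_none.2 h0] at hκ; cases hκ⟩
      | h1 x p h ih =>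
        intro h1
        rw [G.root_pred h] at h1
        have h7 := ih h1
        rcases g3 _ _ h with h8 | ⟨h8, h9⟩
        · exact (h4 _ _ h8 h7.1).elim
        · refine ⟨by rw [T.root_pred h8, h7.1], by rw [h, h8], ?_⟩
          intro κ hκ
          obtain ⟨p', hp, rfl⟩ := T.a_eq.1 hκ
          rw [h8] at hp; cases hp
          exact h9
    have h7 := key x h5
    exact ⟨h7.1, by rw [h6, h7.2.1], h7.2.2⟩
  · intro b h1 h2 h3 x p hx hp hc
    have hμb : μ b = none := by
      cases h : μ b with
      | none => rfl
      | some b' =>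
        rcases (hμ _ _).1 h with h | h
        · exact (h2 _ _ h).elim
        · exact (h3 _ h).elim
    rw [((t4 b (Gnone b h1 fun v => h2 v _) hμb).2 x hx).2]
    exact g2 _ _ hp hc

end HC

namespace HC
open scoped Classical
variable {n : ℕ}

/-- extend a forest to one with at most one start, keeping all the edges -/
theorem single_start (T : DF n) : ∃ T' : DF n, T'.starts.card ≤ 1 ∧
    ∀ x p, T.pred x = some p → T'.pred x = some p ∨ T'.pred p = some x := by
  induction hk : T.starts.card using Nat.strong_induction_on generalizing T with
  | _ k ih =>
  by_cases hk1 : k ≤ 1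
  · exact ⟨T, by omega, fun x p h => Or.inl h⟩
  · obtain ⟨b1, hb1, b2, hb2, hne⟩ := Finset.one_lt_card.1 (by omega : 1 < T.starts.card)
    rw [T.mem_starts] at hb1 hb2
    let col : Fin n → Fin n → ℕ := fun u v => Encodable.encode ((min u v : Fin n), (max u v : Fin n))
    have cinj : ∀ u v u' v', col u v = col u' v' → (u = u' ∧ v = v') ∨ (u = v' ∧ v = u') := by
      intro u v u' v' h
      have h1 := Encodable.encode_injective h
      simp only [Prod.mk.injEq] at h1
      rcases le_total u v with a1 | a1 <;> rcases le_total u' v' with a2 | a2 <;>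
        simp [a1, a2] at h1 <;> tauto
    have csym : ∀ u v, col u v = col v u := by
      intro u v; simp only [col, min_comm, max_comm]
    have hrb : T.Rb col := by
      intro x y κ hx hy
      obtain ⟨p, hp, h1⟩ := T.a_eq.1 hx
      obtain ⟨q, hq, h2⟩ := T.a_eq.1 hy
      rcases cinj p x q y (by omega) with h | ⟨rfl, rfl⟩
      · exact h.2
      · have := T.lt _ _ hp
        have := T.lt _ _ hq
        omega
    have hv : Valid col T ∅ {(b1, b2, true)} := by
      constructor
      · simp
      · simp only [Finset.mem_singleton]; rintro r v s h κ hκ; cases h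
        rw [T.a_none.2 hb1] at hκ; cases hκ
      · simp only [Finset.mem_singleton]; rintro r v s h κ hκ; cases h
        rw [T.own_true, T.a_none.2 hb2] at hκ; cases hκ
      · simp only [Finset.mem_singleton]; rintro r v s v' s' h h'; cases h; cases h'; simp
      · simp only [Finset.mem_singleton]; rintro r v s v' h h'; cases h; cases h'; simp
      · simp only [Finset.mem_singleton]; rintro r v r' v' s' h h'; cases h; cases h'; exact hne.symm
      · exact ⟨fun _ => 0, by simp⟩
      · simp only [Finset.mem_singleton]; rintro r v s r' v' s' h h' _; cases h; cases h'; rfl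
      · simp only [Finset.mem_singleton]; rintro r v s h h'; cases h
        exfalso
        obtain ⟨x, hx⟩ := T.mem_cols.1 h'
        obtain ⟨p, hp, h1⟩ := T.a_eq.1 hx
        rcases cinj _ _ _ _ h1 with ⟨rfl, rfl⟩ | ⟨rfl, rfl⟩
        · rw [hb2] at hp; cases hp
        · rw [hb1] at hp; cases hp
    obtain ⟨T1, hm⟩ := main_mod csym hrb hv
    have c1 := card_mod hv
    rw [← hm.cols] at c1
    have c2 := T.card_cols hrb
    have c3 := T1.card_cols hm.rb
    simp at c1
    obtain ⟨T2, h1, h2⟩ := ih _ (by omega) T1 rfl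
    refine ⟨T2, h1, fun x p h => ?_⟩
    rcases hm.keep _ _ h (by simp) with h3 | h3
    · exact h2 _ _ h3
    · exact (h2 _ _ h3).symm

theorem ham_of_single (T : DF (n + 3)) (h : T.starts.card ≤ 1) :
    ∃ (v : Fin (n + 3)) (w : (⊤ : SimpleGraph (Fin (n + 3))).Walk v v),
      w.IsHamiltonianCycle ∧ ∀ x p, T.pred x = some p → s(x, p) ∈ w.edges := by
  obtain ⟨d, d0, d1⟩ : ∃ d : Fin (n + 3) → ℕ, (∀ x, T.pred x = none → d x = 0) ∧
      (∀ x p, T.pred x = some p → d x = d p + 1) := by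
    let F : (x : Fin (n + 3)) → ((y : Fin (n + 3)) → T.phi y < T.phi x → ℕ) → ℕ := fun x ih =>
      if h : ∃ p, T.pred x = some p then ih h.choose (T.lt _ _ h.choose_spec) + 1 else 0
    refine ⟨(DF.wf T.phi).fix F, ?_, ?_⟩
    · intro x hx
      rw [WellFounded.fix_eq]
      simp [F, hx]
    · intro x p hx
      rw [WellFounded.fix_eq]
      have h : ∃ p, T.pred x = some p := ⟨p, hx⟩
      have h2 : h.choose = p := by
        have := h.choose_spec
        exact (Option.some.inj (hx.symm.trans this)).symm
      have h3 : ∀ q, q = h.choose → (DF.wf T.phi).fix F h.choose = (DF.wf T.phi).fix F q := by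
        rintro q rfl; rfl
      rw [← h3 p h2.symm]
      simp only [F, dif_pos h]
  have dinj : Function.Injective d := by
    intro x
    induction x using T.ind with
    | h0 x hx =>
      intro y hy
      rw [d0 x hx] at hy
      cases hy' : T.pred y with
      | none => exact Finset.card_le_one.1 h _ (T.mem_starts.2 hx) _ (T.mem_starts.2 hy')
      | some q => rw [d1 y q hy'] at hy; omega
    | h1 x p hx ih =>
      intro y hy
      rw [d1 x p hx] at hy
      cases hy' : T.pred y with
      | none => rw [d0 y hy'] at hy; omega
      | some q =>
        rw [d1 y q hy'] at hy
        have := ih (by omega : d p = d q)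
        subst this
        exact T.inj _ _ _ hx hy'
  have dlt : ∀ x, d x < n + 3 := by
    have hdown : ∀ x, ∀ i ≤ d x, ∃ y, d y = i := by
      intro x
      induction x using T.ind with
      | h0 x hx => intro i hi; rw [d0 x hx] at hi; exact ⟨x, by rw [d0 x hx]; omega⟩
      | h1 x p hx ih =>
        intro i hi
        by_cases hi' : i = d x
        · exact ⟨x, hi'.symm⟩
        · rw [d1 x p hx] at hi hi'
          exact ih i (by omega)
    intro x
    have h1 : Finset.range (d x + 1) ⊆ Finset.univ.image d := by
      intro i hi
      obtain ⟨y, hy⟩ := hdown x i (by simpa [Nat.lt_succ_iff] using hi)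
      exact Finset.mem_image.2 ⟨y, Finset.mem_univ _, hy⟩
    have h2 := Finset.card_le_card h1
    have h3 := Finset.card_image_le (s := (Finset.univ : Finset (Fin (n + 3)))) (f := d)
    simp at h2 h3
    omega
  let e : Fin (n + 3) → Fin (n + 3) := fun x => ⟨d x, dlt x⟩
  have einj : Function.Injective e := fun x y h => dinj (by simpa [e] using h)
  have ebij : Function.Bijective e := Finite.injective_iff_bijective.1 einj
  let eq := Equiv.ofBijective e ebij
  let f : SimpleGraph.cycleGraph (n + 3) →g (⊤ : SimpleGraph (Fin (n + 3))) :=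
    ⟨eq.symm, fun {a b} hab => by
      rw [SimpleGraph.top_adj]; exact fun h => hab.ne (eq.symm.injective h)⟩
  refine ⟨_, (SimpleGraph.cycleGraph.cycle n).map f, ?_, ?_⟩
  · apply SimpleGraph.Walk.IsHamiltonianCycle.map
    · exact eq.symm.bijective
    · rw [SimpleGraph.Walk.isHamiltonianCycle_iff_isCycle_and_length_eq]
      exact ⟨SimpleGraph.cycleGraph.isCycle_cycle, by simp⟩
  · intro x p hx
    rw [SimpleGraph.Walk.edges_map, List.mem_map]
    refine ⟨s(e x, e p), ?_, ?_⟩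
    · rw [SimpleGraph.Walk.mk_mem_edges_iff_exists]
      have h1 := d1 x p hx
      have h2 := dlt x
      refine ⟨n + 3 - d x, by simp; omega, ?_⟩
      rw [SimpleGraph.cycleGraph.getVert_cycle (by omega), SimpleGraph.cycleGraph.getVert_cycle (by omega)]
      have e1 : (n + 3 - (n + 3 - d x)) % (n + 3) = d x := by
        rw [Nat.sub_sub_self h2.le, Nat.mod_eq_of_lt h2]
      have e2 : (n + 3 - (n + 3 - d x + 1)) % (n + 3) = d p := by
        rw [show n + 3 - (n + 3 - d x + 1) = d p by omega, Nat.mod_eq_of_lt (by omega)]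
      simp only [e1, e2, e]
    · have : ∀ y, f (e y) = y := fun y => eq.symm_apply_apply y
      simp [Sym2.map_mk, this]

theorem ham (T : DF n) (hn : 3 ≤ n) :
    ∃ (v : Fin n) (w : (⊤ : SimpleGraph (Fin n)).Walk v v),
      w.IsHamiltonianCycle ∧ ∀ x p, T.pred x = some p → s(x, p) ∈ w.edges := by
  obtain ⟨m, rfl⟩ : ∃ m, n = m + 3 := ⟨n - 3, by omega⟩
  obtain ⟨T', h1, h2⟩ := single_start T
  obtain ⟨v, w, h3, h4⟩ := ham_of_single T' h1
  refine ⟨v, w, h3, fun x p h => ?_⟩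
  rcases h2 _ _ h with h5 | h5
  · exact h4 _ _ h5
  · rw [Sym2.eq_swap]; exact h4 _ _ h5

end HC

namespace HC
open scoped Classical
variable {n : ℕ}

structure Lst (n : ℕ) where
  letters : Finset (Fin n)
  bases : Finset (Fin n)
  Y : Finset ℕ
  W : ℕ → Finset (Fin n × Fin n × Option ℕ)

/-- local conditions on one list -/
structure LOK (col : Fin n → Fin n → ℕ) (T : DF n) (L : Lst n) : Prop where
  letters_start : ∀ b ∈ L.letters, T.pred b = none
  bases_start : ∀ b ∈ L.bases, T.pred b = none
  bases_card : L.bases.card = 2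
  Ysub : L.Y ⊆ T.cols col
  grow : 2 * 5 ^ L.letters.card ≤ 4 ^ L.letters.card * (2 + L.Y.card)
  w_let : ∀ y ∈ L.Y, ∀ b d s, (b, d, s) ∈ L.W y → b ∈ L.letters
  w_fst : ∀ y ∈ L.Y, ∀ b d s d' s', (b, d, s) ∈ L.W y → (b, d', s') ∈ L.W y → d = d' ∧ s = s'
  w_src : ∀ y ∈ L.Y, ∀ b d s b' d', (b, d, s) ∈ L.W y → (b', d', s) ∈ L.W y → b = b'
  w_col : ∀ y ∈ L.Y, ∀ b d s b' d' s', (b, d, s) ∈ L.W y → (b', d', s') ∈ L.W y → col b d = col b' d' → b = b'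
  w_K : ∀ y ∈ L.Y, ∀ b d s, (b, d, s) ∈ L.W y → col b d ∈ L.Y
  w_y : ∀ y ∈ L.Y, ∃ b d s, (b, d, s) ∈ L.W y ∧ col b d = y
  w_some : ∀ y ∈ L.Y, ∀ b d κ, (b, d, some κ) ∈ L.W y → 
    (∃ b' d' s', (b', d', s') ∈ L.W y ∧ col b' d' = κ) ∧ κ ≠ y ∧ (T.a col d = some κ ∨ T.own col d false = some κ)
  w_none : ∀ y ∈ L.Y, ∀ b d, (b, d, none) ∈ L.W y → d ∈ L.bases

/-- configuration, lists `t ≤ ℓ < h` -/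
structure Cfg (col : Fin n → Fin n → ℕ) (h B : ℕ) (T : DF n) (t : ℕ) (L : ℕ → Lst n) (rk : Fin n → ℕ) : Prop where
  ok : ∀ ℓ, t ≤ ℓ → ℓ < h → LOK col T (L ℓ)
  lb : ∀ ℓ ℓ', t ≤ ℓ → ℓ < h → t ≤ ℓ' → ℓ' < h → ∀ b, b ∈ (L ℓ).letters → b ∉ (L ℓ').bases
  ll : ∀ ℓ ℓ', t ≤ ℓ → ℓ < h → t ≤ ℓ' → ℓ' < h → ∀ b, b ∈ (L ℓ).letters → b ∈ (L ℓ').letters → ℓ = ℓ'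
  bb : ∀ ℓ ℓ', t ≤ ℓ → ℓ < h → t ≤ ℓ' → ℓ' < h → ∀ b, b ∈ (L ℓ).bases → b ∈ (L ℓ').bases → ℓ = ℓ'
  yy : ∀ ℓ ℓ', t ≤ ℓ → ℓ < h → t ≤ ℓ' → ℓ' < h → ∀ b, b ∈ (L ℓ).Y → b ∈ (L ℓ').Y → ℓ = ℓ'
  rk_lo : ∀ ℓ, t ≤ ℓ → ℓ < h → ∀ b ∈ (L ℓ).letters, (ℓ + 2) * B ≤ rk b + (L ℓ).letters.card
  rk_hi : ∀ ℓ, t ≤ ℓ → ℓ < h → ∀ b ∈ (L ℓ).letters, rk b < (ℓ + 2) * B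
  L4 : ∀ ℓ ℓ', t ≤ ℓ → ℓ < h → t ≤ ℓ' → ℓ' < h → ∀ y ∈ (L ℓ).Y, ∀ b d κ, (b, d, some κ) ∈ (L ℓ).W y →
    T.own col d false = some κ → T.root d ∈ (L ℓ').letters → rk (T.root d) < rk b

/-- maximal rainbow forest -/
structure Mx (col : Fin n → Fin n → ℕ) (T : DF n) : Prop where
  rb : T.Rb col
  mx : ∀ T' : DF n, T'.Rb col → (T'.cols col).card ≤ (T.cols col).card

noncomputable def jn (col : Fin n → Fin n → ℕ) (T : DF n) (j : Fin n × Fin n × Option ℕ) : Fin n × Fin n × Bool :=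
  (j.1, j.2.1, decide (j.2.2 = T.a col j.2.1))

/-- the joins of the selected words -/
noncomputable def Wd (col : Fin n → Fin n → ℕ) (h : ℕ) (T : DF n) (L : ℕ → Lst n) (σ : ℕ → Option ℕ) :
    Finset (Fin n × Fin n × Bool) :=
  (Finset.range h).biUnion fun ℓ => match σ ℓ with
    | none => ∅
    | some y => ((L ℓ).W y).image (jn col T)

noncomputable def Kd (col : Fin n → Fin n → ℕ) (h : ℕ) (T : DF n) (L : ℕ → Lst n) (σ : ℕ → Option ℕ) : Finset ℕ :=
  (Wd col h T L σ).image fun j => col j.1 j.2.1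

theorem mem_Wd {col : Fin n → Fin n → ℕ} {h : ℕ} {T : DF n} {L : ℕ → Lst n} {σ : ℕ → Option ℕ} {b d s} :
    (b, d, s) ∈ Wd col h T L σ ↔ ∃ ℓ < h, ∃ y, σ ℓ = some y ∧ ∃ src, (b, d, src) ∈ (L ℓ).W y ∧
      s = decide (src = T.a col d) := by
  simp only [Wd, Finset.mem_biUnion, Finset.mem_range]
  constructor
  · rintro ⟨ℓ, hℓ, hh⟩
    refine ⟨ℓ, hℓ, ?_⟩
    cases hσ : σ ℓ with
    | none => simp [hσ] at hh
    | some y =>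
      simp only [hσ, Finset.mem_image, Prod.exists, jn, Prod.mk.injEq] at hh
      obtain ⟨b', d', src, h1, rfl, rfl, rfl⟩ := hh
      exact ⟨y, rfl, src, h1, rfl⟩
  · rintro ⟨ℓ, hℓ, y, hσ, src, h1, rfl⟩
    refine ⟨ℓ, hℓ, ?_⟩
    simp only [hσ, Finset.mem_image, Prod.exists, jn, Prod.mk.injEq]
    exact ⟨b, d, src, h1, rfl, rfl, rfl⟩

theorem mem_Kd {col : Fin n → Fin n → ℕ} {h : ℕ} {T : DF n} {L : ℕ → Lst n} {σ : ℕ → Option ℕ} {κ} :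
    κ ∈ Kd col h T L σ ↔ ∃ ℓ < h, ∃ y, σ ℓ = some y ∧ ∃ b d src, (b, d, src) ∈ (L ℓ).W y ∧ col b d = κ := by
  simp only [Kd, Finset.mem_image, Prod.exists, mem_Wd]
  constructor
  · rintro ⟨b, d, s, ⟨ℓ, hℓ, y, hσ, src, h1, rfl⟩, h2⟩
    exact ⟨ℓ, hℓ, y, hσ, b, d, src, h1, h2⟩
  · rintro ⟨ℓ, hℓ, y, hσ, b, d, src, h1, h2⟩
    exact ⟨b, d, _, ⟨ℓ, hℓ, y, hσ, src, h1, rfl⟩, h2⟩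

theorem LOK.own_src {col : Fin n → Fin n → ℕ} {T : DF n} {L : Lst n} (hL : LOK col T L) {y} (hy : y ∈ L.Y)
    {b d src} (hj : (b, d, src) ∈ L.W y) : T.own col d (decide (src = T.a col d)) = src := by
  by_cases h : src = T.a col d
  · simp [h]
  · cases src with
    | none =>
      exact (h (T.a_none.2 (hL.bases_start _ (hL.w_none y hy _ _ hj))).symm).elim
    | some κ =>
      rcases (hL.w_some y hy _ _ _ hj).2.2 with h1 | h1
      · exact (h h1.symm).elim
      · simp only [h, decide_false, h1]

structure Loose (col : Fin n → Fin n → ℕ) (h : ℕ) (T : DF n) (L : ℕ → Lst n) (σ : ℕ → Option ℕ)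
    (J : Finset (Fin n × Fin n × Bool)) (C : Finset ℕ) : Prop where
  Csub : C ⊆ T.cols col
  CK : ∀ κ ∈ C, κ ∉ Kd col h T L σ
  r_some : ∀ r v s, (r, v, s) ∈ J → ∀ κ, T.a col r = some κ → ∃ ℓ < h, σ ℓ = some κ
  r_none : ∀ r v s, (r, v, s) ∈ J → T.a col r = none → ∀ ℓ < h, σ ℓ ≠ none → r ∉ (L ℓ).letters ∧ r ∉ (L ℓ).bases
  v_some : ∀ r v s, (r, v, s) ∈ J → ∀ κ, T.own col v s = some κ → κ ∈ C ∨ ∃ ℓ < h, σ ℓ = some κ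
  v_none : ∀ r v, (r, v, true) ∈ J → T.a col v = none → ∀ ℓ < h, σ ℓ ≠ none → v ∉ (L ℓ).letters ∧ v ∉ (L ℓ).bases
  inj_r : ∀ r v s v' s', (r, v, s) ∈ J → (r, v', s') ∈ J → v = v' ∧ s = s'
  inj_v : ∀ r r' v s, (r, v, s) ∈ J → (r', v, s) ∈ J → r = r'
  ne : ∀ r v r' v' s', (r, v, true) ∈ J → (r', v', s') ∈ J → v ≠ r'
  col_inj : ∀ r v s r' v' s', (r, v, s) ∈ J → (r', v', s') ∈ J → col r v = col r' v' → r = r'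
  col_C : ∀ r v s, (r, v, s) ∈ J → col r v ∈ C ∨ col r v ∉ T.cols col

section
variable {col : Fin n → Fin n → ℕ} {h B : ℕ} {T : DF n} {L : ℕ → Lst n} {rk : Fin n → ℕ} {σ : ℕ → Option ℕ}
  {J : Finset (Fin n × Fin n × Bool)} {C : Finset ℕ}

theorem loose_wj (hc : Cfg col h B T 0 L rk) (hσ : ∀ ℓ < h, ∀ y, σ ℓ = some y → y ∈ (L ℓ).Y)
    (hl : Loose col h T L σ J C) {b d s v s'} (h1 : (b, d, s) ∈ Wd col h T L σ) (h2 : (b, v, s') ∈ J) : False := by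
  obtain ⟨ℓ, hℓ, y, hy, src, hw, rfl⟩ := mem_Wd.1 h1
  have hL := hc.ok ℓ (Nat.zero_le _) hℓ
  have hb := hL.w_let y (hσ _ hℓ _ hy) _ _ _ hw
  exact (hl.r_none _ _ _ h2 (T.a_none.2 (hL.letters_start _ hb)) ℓ hℓ (by rw [hy]; simp)).1 hb

theorem Kd_sub (hc : Cfg col h B T 0 L rk) (hσ : ∀ ℓ < h, ∀ y, σ ℓ = some y → y ∈ (L ℓ).Y)
    {κ} (h1 : κ ∈ Kd col h T L σ) : ∃ ℓ < h, σ ℓ ≠ none ∧ κ ∈ (L ℓ).Y := by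
  obtain ⟨ℓ, hℓ, y, hy, b, d, src, hw, rfl⟩ := mem_Kd.1 h1
  exact ⟨ℓ, hℓ, by rw [hy]; simp, (hc.ok ℓ (Nat.zero_le _) hℓ).w_K y (hσ _ hℓ _ hy) _ _ _ hw⟩

theorem wd_col_inj (hc : Cfg col h B T 0 L rk) (hσ : ∀ ℓ < h, ∀ y, σ ℓ = some y → y ∈ (L ℓ).Y) :
    ∀ r v s r' v' s', (r, v, s) ∈ Wd col h T L σ → (r', v', s') ∈ Wd col h T L σ → col r v = col r' v' → r = r' := by
  intro r v s r' v' s' h1 h2 he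
  obtain ⟨ℓ, hℓ, y, hy, src, hw, rfl⟩ := mem_Wd.1 h1
  obtain ⟨ℓ', hℓ', y', hy', src', hw', rfl⟩ := mem_Wd.1 h2
  have hL := hc.ok ℓ (Nat.zero_le _) hℓ
  have hL' := hc.ok ℓ' (Nat.zero_le _) hℓ'
  have e1 := hL.w_K y (hσ _ hℓ _ hy) _ _ _ hw
  have e2 := hL'.w_K y' (hσ _ hℓ' _ hy') _ _ _ hw'
  rw [← he] at e2
  have := hc.yy ℓ ℓ' (Nat.zero_le _) hℓ (Nat.zero_le _) hℓ' _ e1 e2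
  subst this
  rw [hy] at hy'; cases hy'
  exact hL.w_col y (hσ _ hℓ _ hy) _ _ _ _ _ _ hw hw' he

theorem wd_inj_r (hc : Cfg col h B T 0 L rk) (hσ : ∀ ℓ < h, ∀ y, σ ℓ = some y → y ∈ (L ℓ).Y) :
    ∀ r v s v' s', (r, v, s) ∈ Wd col h T L σ → (r, v', s') ∈ Wd col h T L σ → v = v' ∧ s = s' := by
  intro r v s v' s' h1 h2
  obtain ⟨ℓ, hℓ, y, hy, src, hw, rfl⟩ := mem_Wd.1 h1
  obtain ⟨ℓ', hℓ', y', hy', src', hw', rfl⟩ := mem_Wd.1 h2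
  have hL := hc.ok ℓ (Nat.zero_le _) hℓ
  have hL' := hc.ok ℓ' (Nat.zero_le _) hℓ'
  have := hc.ll ℓ ℓ' (Nat.zero_le _) hℓ (Nat.zero_le _) hℓ' _ (hL.w_let y (hσ _ hℓ _ hy) _ _ _ hw)
    (hL'.w_let y' (hσ _ hℓ' _ hy') _ _ _ hw')
  subst this
  rw [hy] at hy'; cases hy'
  obtain ⟨rfl, rfl⟩ := hL.w_fst y (hσ _ hℓ _ hy) _ _ _ _ _ hw hw'
  exact ⟨rfl, rfl⟩

theorem wd_card (hc : Cfg col h B T 0 L rk) (hσ : ∀ ℓ < h, ∀ y, σ ℓ = some y → y ∈ (L ℓ).Y) :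
    (Kd col h T L σ).card = (Wd col h T L σ).card := by
  apply Finset.card_image_of_injOn
  rintro ⟨r, v, s⟩ h1 ⟨r', v', s'⟩ h2 he
  have := wd_col_inj hc hσ _ _ _ _ _ _ h1 h2 he
  subst this
  obtain ⟨rfl, rfl⟩ := wd_inj_r hc hσ _ _ _ _ _ h1 h2
  rfl

theorem total_valid (hc : Cfg col h B T 0 L rk) (hσ : ∀ ℓ < h, ∀ y, σ ℓ = some y → y ∈ (L ℓ).Y)
    (hl : Loose col h T L σ J C)
    (hr : ∃ ρ : Fin n → ℕ, ∀ r p, (r, p, false) ∈ Wd col h T L σ ∪ J → ρ (T.root p) < ρ (T.root r)) :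
    Valid col T (Kd col h T L σ ∪ C) (Wd col h T L σ ∪ J) := by
  have yK : ∀ ℓ < h, ∀ y, σ ℓ = some y → y ∈ Kd col h T L σ := by
    intro ℓ hℓ y hy
    obtain ⟨b, d, s, h1, h2⟩ := (hc.ok ℓ (Nat.zero_le _) hℓ).w_y y (hσ _ hℓ _ hy)
    exact mem_Kd.2 ⟨ℓ, hℓ, y, hy, b, d, s, h1, h2⟩
  -- facts about a word join
  have wj : ∀ b d s, (b, d, s) ∈ Wd col h T L σ → ∃ ℓ < h, σ ℓ ≠ none ∧ b ∈ (L ℓ).letters ∧ T.a col b = none ∧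
      ((T.own col d s = none ∧ d ∈ (L ℓ).bases ∧ s = true) ∨ (∃ κ, T.own col d s = some κ ∧ κ ∈ (L ℓ).Y ∧ 
        κ ∈ Kd col h T L σ ∧ σ ℓ ≠ some κ)) := by
    intro b d s h1
    obtain ⟨ℓ, hℓ, y, hy, src, hw, rfl⟩ := mem_Wd.1 h1
    have hL := hc.ok ℓ (Nat.zero_le _) hℓ
    have hyY := hσ _ hℓ _ hy
    have hb := hL.w_let y hyY _ _ _ hw
    refine ⟨ℓ, hℓ, by rw [hy]; simp, hb, T.a_none.2 (hL.letters_start _ hb), ?_⟩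
    rw [hL.own_src hyY hw]
    cases src with
    | none => 
      have hd := hL.w_none y hyY _ _ hw
      exact Or.inl ⟨rfl, hd, by simp [T.a_none.2 (hL.bases_start _ hd)]⟩
    | some κ =>
      obtain ⟨⟨b', d', s', k1, k2⟩, k3, k4⟩ := hL.w_some y hyY _ _ _ hw
      refine Or.inr ⟨κ, rfl, ?_, mem_Kd.2 ⟨ℓ, hℓ, y, hy, b', d', s', k1, k2⟩, ?_⟩
      · rw [← k2]; exact hL.w_K y hyY _ _ _ k1
      · rw [hy]; simpa using k3.symm
  have same : ∀ ℓ < h, ∀ ℓ' < h, ∀ κ, κ ∈ (L ℓ).Y → κ ∈ (L ℓ').Y → ℓ = ℓ' :=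
    fun ℓ hℓ ℓ' hℓ' κ h1 h2 => hc.yy ℓ ℓ' (Nat.zero_le _) hℓ (Nat.zero_le _) hℓ' κ h1 h2
  constructor
  · intro κ hκ
    rcases Finset.mem_union.1 hκ with h1 | h1
    · obtain ⟨ℓ, hℓ, _, h2⟩ := Kd_sub hc hσ h1
      exact (hc.ok ℓ (Nat.zero_le _) hℓ).Ysub h2
    · exact hl.Csub h1
  · intro r v s hj κ hκ
    rcases Finset.mem_union.1 hj with h1 | h1
    · obtain ⟨ℓ, hℓ, _, _, h2, _⟩ := wj _ _ _ h1
      rw [h2] at hκ; cases hκ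
    · obtain ⟨ℓ, hℓ, h2⟩ := hl.r_some _ _ _ h1 _ hκ
      exact Finset.mem_union_left _ (yK _ hℓ _ h2)
  · intro r v s hj κ hκ
    rcases Finset.mem_union.1 hj with h1 | h1
    · obtain ⟨ℓ, hℓ, _, _, _, h2 | ⟨κ', h2, _, h3, _⟩⟩ := wj _ _ _ h1
      · rw [h2.1] at hκ; cases hκ
      · rw [h2] at hκ; cases hκ; exact Finset.mem_union_left _ h3
    · rcases hl.v_some _ _ _ h1 _ hκ with h2 | ⟨ℓ, hℓ, h2⟩
      · exact Finset.mem_union_right _ h2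
      · exact Finset.mem_union_left _ (yK _ hℓ _ h2)
  · intro r v s v' s' hj hj'
    rcases Finset.mem_union.1 hj with h1 | h1 <;> rcases Finset.mem_union.1 hj' with h2 | h2
    · exact wd_inj_r hc hσ _ _ _ _ _ h1 h2
    · exact (loose_wj hc hσ hl h1 h2).elim
    · exact (loose_wj hc hσ hl h2 h1).elim
    · exact hl.inj_r _ _ _ _ _ h1 h2
  · have mixed : ∀ r r' v s, (r, v, s) ∈ Wd col h T L σ → (r', v, s) ∈ J → False := by
      intro r r' v s h1 h2
      obtain ⟨ℓ, hℓ, ha, _, _, ⟨k1, k2, rfl⟩ | ⟨κ, k1, k2, k3, k4⟩⟩ := wj _ _ _ h1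
      · exact (hl.v_none _ _ h2 k1 ℓ hℓ ha).2 k2
      · rcases hl.v_some _ _ _ h2 _ k1 with h5 | ⟨ℓ', hℓ', h5⟩
        · exact hl.CK _ h5 k3
        · have := same _ hℓ _ hℓ' _ k2 (hσ _ hℓ' _ h5)
          subst this; exact k4 h5
    intro r r' v s hj hj'
    rcases Finset.mem_union.1 hj with h1 | h1 <;> rcases Finset.mem_union.1 hj' with h2 | h2
    · obtain ⟨ℓ, hℓ, y, hy, src, hw, e1⟩ := mem_Wd.1 h1
      obtain ⟨ℓ', hℓ', y', hy', src', hw', e2⟩ := mem_Wd.1 h2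
      have hL := hc.ok ℓ (Nat.zero_le _) hℓ
      have hL' := hc.ok ℓ' (Nat.zero_le _) hℓ'
      have o1 := hL.own_src (hσ _ hℓ _ hy) hw
      have o2 := hL'.own_src (hσ _ hℓ' _ hy') hw'
      rw [← e1] at o1
      rw [← e2, o1] at o2
      subst o2
      have hll : ℓ = ℓ' := by
        cases src with
        | none => 
          exact hc.bb _ _ (Nat.zero_le _) hℓ (Nat.zero_le _) hℓ' _ (hL.w_none _ (hσ _ hℓ _ hy) _ _ hw)
            (hL'.w_none _ (hσ _ hℓ' _ hy') _ _ hw')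
        | some κ =>
          obtain ⟨b1, d1, s1, u1, u2⟩ := (hL.w_some _ (hσ _ hℓ _ hy) _ _ _ hw).1
          obtain ⟨b2, d2, s2, u3, u4⟩ := (hL'.w_some _ (hσ _ hℓ' _ hy') _ _ _ hw').1
          have u5 := hL.w_K _ (hσ _ hℓ _ hy) _ _ _ u1
          have u6 := hL'.w_K _ (hσ _ hℓ' _ hy') _ _ _ u3
          rw [u2] at u5; rw [u4] at u6
          exact same _ hℓ _ hℓ' _ u5 u6
      subst hll
      rw [hy] at hy'; cases hy'
      exact hL.w_src _ (hσ _ hℓ _ hy) _ _ _ _ _ hw hw'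
    · exact (mixed _ _ _ _ h1 h2).elim
    · exact (mixed _ _ _ _ h2 h1).elim
    · exact hl.inj_v _ _ _ _ h1 h2
  · intro r v r' v' s' hj hj' he
    subst he
    rcases Finset.mem_union.1 hj with h1 | h1 <;> rcases Finset.mem_union.1 hj' with h2 | h2
    · obtain ⟨ℓ, hℓ, ha, _, _, k⟩ := wj _ _ _ h1
      obtain ⟨ℓ', hℓ', ha', hb', hn', _⟩ := wj _ _ _ h2
      rcases k with ⟨k1, k2, -⟩ | ⟨κ, k1, _⟩
      · exact hc.lb _ _ (Nat.zero_le _) hℓ' (Nat.zero_le _) hℓ _ hb' k2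
      · rw [T.own_true, hn'] at k1; cases k1
    · obtain ⟨ℓ, hℓ, ha, _, _, ⟨k1, k2, -⟩ | ⟨κ, k1, k2, k3, k4⟩⟩ := wj _ _ _ h1
      · exact (hl.r_none _ _ _ h2 k1 ℓ hℓ ha).2 k2
      · obtain ⟨ℓ', hℓ', h5⟩ := hl.r_some _ _ _ h2 _ k1
        have := same _ hℓ _ hℓ' _ k2 (hσ _ hℓ' _ h5)
        subst this; exact k4 h5
    · obtain ⟨ℓ', hℓ', ha', hb', hn', _⟩ := wj _ _ _ h2
      exact (hl.v_none _ _ h1 hn' ℓ' hℓ' ha').1 hb'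
    · exact hl.ne _ _ _ _ _ h1 h2 rfl
  · exact hr
  · have mixed : ∀ r v s r' v' s', (r, v, s) ∈ Wd col h T L σ → (r', v', s') ∈ J → col r v = col r' v' → False := by
      intro r v s r' v' s' h1 h2 he
      have h3 : col r v ∈ Kd col h T L σ := Finset.mem_image.2 ⟨_, h1, rfl⟩
      rcases hl.col_C _ _ _ h2 with h4 | h4
      · rw [← he] at h4; exact hl.CK _ h4 h3
      · rw [← he] at h4
        obtain ⟨ℓ, hℓ, _, h5⟩ := Kd_sub hc hσ h3
        exact h4 ((hc.ok ℓ (Nat.zero_le _) hℓ).Ysub h5)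
    intro r v s r' v' s' hj hj' he
    rcases Finset.mem_union.1 hj with h1 | h1 <;> rcases Finset.mem_union.1 hj' with h2 | h2
    · exact wd_col_inj hc hσ _ _ _ _ _ _ h1 h2 he
    · exact (mixed _ _ _ _ _ _ h1 h2 he).elim
    · exact (mixed _ _ _ _ _ _ h2 h1 he.symm).elim
    · exact hl.col_inj _ _ _ _ _ _ h1 h2 he
  · intro r v s hj hcol
    rcases Finset.mem_union.1 hj with h1 | h1
    · exact Finset.mem_union_left _ (Finset.mem_image.2 ⟨_, h1, rfl⟩)
    · rcases hl.col_C _ _ _ h1 with h2 | h2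
      · exact Finset.mem_union_right _ h2
      · exact (h2 hcol).elim

theorem total_card (hc : Cfg col h B T 0 L rk) (hσ : ∀ ℓ < h, ∀ y, σ ℓ = some y → y ∈ (L ℓ).Y)
    (hl : Loose col h T L σ J C) : (Wd col h T L σ ∪ J).card + C.card = (Kd col h T L σ ∪ C).card + J.card := by
  rw [Finset.card_union_of_disjoint, Finset.card_union_of_disjoint, wd_card hc hσ]
  · omega
  · rw [Finset.disjoint_left]; exact fun κ h1 h2 => hl.CK _ h2 h1
  · rw [Finset.disjoint_left]; rintro ⟨r, v, s⟩ h1 h2; exact loose_wj hc hσ hl h1 h2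

/-- no gain -/
theorem no_gain (hsym : ∀ u v, col u v = col v u) (hM : Mx col T) 
    (hc : Cfg col h B T 0 L rk) (hσ : ∀ ℓ < h, ∀ y, σ ℓ = some y → y ∈ (L ℓ).Y)
    (hl : Loose col h T L σ J C)
    (hr : ∃ ρ : Fin n → ℕ, ∀ r p, (r, p, false) ∈ Wd col h T L σ ∪ J → ρ (T.root p) < ρ (T.root r)) :
    J.card ≤ C.card := by
  have hv := total_valid hc hσ hl hr
  obtain ⟨T', hT'⟩ := main_mod hsym hM.rb hv
  have h1 := card_mod hv
  rw [← hT'.cols] at h1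
  have h2 := hM.mx T' hT'.rb
  have h3 := total_card hc hσ hl
  omega
end
end HC

namespace HC
open scoped Classical
variable {n : ℕ}

section
variable {col : Fin n → Fin n → ℕ} {h B : ℕ} {T : DF n} {L : ℕ → Lst n} {rk : Fin n → ℕ}

theorem commit (hsym : ∀ u v, col u v = col v u) (hM : Mx col T) {t : ℕ} (hc : Cfg col h B T t L rk)
    {cut : Finset ℕ} {J : Finset (Fin n × Fin n × Bool)} (hv : Valid col T cut J) (hcard : J.card = cut.card)
    (hY : ∀ ℓ, t ≤ ℓ → ℓ < h → ∀ κ ∈ (L ℓ).Y, κ ∉ cut)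
    (hlet : ∀ ℓ, t ≤ ℓ → ℓ < h → ∀ b ∈ (L ℓ).letters, (∀ v s, (b, v, s) ∉ J) ∧ (∀ r, (r, b, true) ∉ J) ∧
      (∀ r p, (r, p, false) ∈ J → T.root p ≠ b))
    (hbase : ∀ ℓ, t ≤ ℓ → ℓ < h → ∀ b ∈ (L ℓ).bases, (∀ v s, (b, v, s) ∉ J) ∧ (∀ r, (r, b, true) ∉ J)) :
    ∃ T' : DF n, Mod col T cut J T' ∧ Mx col T' ∧ Cfg col h B T' t L rk := by
  obtain ⟨T', hT'⟩ := main_mod hsym hM.rb hv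
  have hcd := card_mod hv
  rw [← hT'.cols] at hcd
  refine ⟨T', hT', ⟨hT'.rb, fun T'' h'' => by have := hM.mx T'' h''; omega⟩, ?_⟩
  have hstart : ∀ b, T.pred b = none → ∀ κ, T.a col b = some κ → κ ∈ cut := by
    intro b hb κ hκ; rw [T.a_none.2 hb] at hκ; cases hκ
  constructor
  · intro ℓ h1 h2
    have hL := hc.ok ℓ h1 h2
    refine ⟨?_, ?_, hL.bases_card, ?_, hL.grow, hL.w_let, hL.w_fst, hL.w_src, hL.w_col, hL.w_K, hL.w_y, ?_, hL.w_none⟩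
    · intro b hb
      have := hlet ℓ h1 h2 b hb
      exact hT'.start b (hstart b (hL.letters_start b hb)) this.1 this.2.1
    · intro b hb
      have := hbase ℓ h1 h2 b hb
      exact hT'.start b (hstart b (hL.bases_start b hb)) this.1 this.2
    · intro κ hκ
      rw [hT'.cols]
      exact Finset.mem_union_left _ (Finset.mem_sdiff.2 ⟨hL.Ysub hκ, hY ℓ h1 h2 κ hκ⟩)
    · intro y hy b d κ hw
      obtain ⟨e1, e2, e3⟩ := hL.w_some y hy b d κ hw
      refine ⟨e1, e2, ?_⟩
      have hκ : κ ∉ cut := by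
        obtain ⟨b', d', s', e4, e5⟩ := e1
        have := hL.w_K y hy _ _ _ e4
        rw [e5] at this
        exact hY ℓ h1 h2 κ this
      rcases e3 with e3 | e3
      · obtain ⟨p, hp, hpc⟩ := T.a_eq.1 e3
        rcases hT'.keep _ _ hp (by rwa [hpc]) with e4 | e4
        · exact Or.inl (T'.a_eq.2 ⟨p, e4, hpc⟩)
        · exact Or.inr (T'.own_false.2 ⟨p, e4, by rw [hsym]; exact hpc⟩)
      · obtain ⟨x, hp, hpc⟩ := T.own_false.1 e3
        rcases hT'.keep _ _ hp (by rwa [hpc]) with e4 | e4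
        · exact Or.inr (T'.own_false.2 ⟨x, e4, hpc⟩)
        · exact Or.inl (T'.a_eq.2 ⟨x, e4, by rw [hsym]; exact hpc⟩)
  · exact hc.lb
  · exact hc.ll
  · exact hc.bb
  · exact hc.yy
  · exact hc.rk_lo
  · exact hc.rk_hi
  · intro ℓ ℓ' h1 h2 h1' h2' y hy b d κ hw ho hr
    obtain ⟨x, hx, hxc⟩ := T'.own_false.1 ho
    have h3 := hlet ℓ' h1' h2' _ hr
    have harm := hT'.arm _ ((hc.ok ℓ' h1' h2').letters_start _ hr) h3.1 h3.2.1 h3.2.2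
    have h4 := harm d rfl
    have h5 := harm x (by rw [T'.root_pred hx])
    rw [hx] at h5
    have := hc.L4 ℓ ℓ' h1 h2 h1' h2' y hy b d κ hw (T.own_false.2 ⟨x, h5.2.1.symm, hxc⟩) (by rw [h4.1]; exact hr)
    rwa [h4.1] at this

/-- fresh list -/
theorem reset1 {t Q : ℕ} (hc : Cfg col h B T (t + 1) L rk) (hth : t < h)
    (hQ : ∀ ℓ, t + 1 ≤ ℓ → ℓ < h → (L ℓ).letters.card ≤ Q) (hs : h * (Q + 2) + 2 ≤ T.starts.card) :
    ∃ L', Cfg col h B T t L' rk ∧ (∀ ℓ, t + 1 ≤ ℓ → L' ℓ = L ℓ) ∧ (L' t).letters.card ≤ Q := by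
  let U : Finset (Fin n) := (Finset.Ico (t + 1) h).biUnion fun ℓ => (L ℓ).letters ∪ (L ℓ).bases
  have hU : U.card ≤ h * (Q + 2) := by
    calc U.card ≤ (Finset.Ico (t + 1) h).card * (Q + 2) := by
          apply Finset.card_biUnion_le_card_mul
          intro ℓ hℓ
          rw [Finset.mem_Ico] at hℓ
          have h1 := Finset.card_union_le (L ℓ).letters (L ℓ).bases
          have h2 := hQ ℓ hℓ.1 hℓ.2
          have h3 := (hc.ok ℓ hℓ.1 hℓ.2).bases_card
          omega
      _ ≤ h * (Q + 2) := by
          apply Nat.mul_le_mul_right; simp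
  have h2c : 2 ≤ (T.starts \ U).card := by
    have := Finset.le_card_sdiff U T.starts
    omega
  obtain ⟨bs, hbs, hbc⟩ := Finset.exists_subset_card_eq h2c
  have hb1 : ∀ b ∈ bs, T.pred b = none := fun b hb => T.mem_starts.1 (Finset.mem_sdiff.1 (hbs hb)).1
  have hb2 : ∀ b ∈ bs, ∀ ℓ, t + 1 ≤ ℓ → ℓ < h → b ∉ (L ℓ).letters ∧ b ∉ (L ℓ).bases := by
    intro b hb ℓ h1 h2
    have h3 := (Finset.mem_sdiff.1 (hbs hb)).2
    simp only [U, Finset.mem_biUnion, Finset.mem_Ico, Finset.mem_union, not_exists, not_and, not_or] at h3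
    exact h3 ℓ ⟨h1, h2⟩
  let L0 : Lst n := ⟨∅, bs, ∅, fun _ => ∅⟩
  let L' := Function.update L t L0
  have e0 : L' t = L0 := by simp [L']
  have e1 : ∀ ℓ, t + 1 ≤ ℓ → L' ℓ = L ℓ := by
    intro ℓ hℓ
    simp only [L']
    rw [Function.update_of_ne (by omega)]
  have cs : ∀ ℓ, t ≤ ℓ → ℓ = t ∨ t + 1 ≤ ℓ := by intro ℓ h; omega
  refine ⟨L', ?_, e1, by simp [e0, L0]⟩
  constructor
  · intro ℓ h1 h2
    rcases cs ℓ h1 with rfl | h1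
    · rw [e0]
      constructor <;> simp [L0]
      · exact hb1
      · exact hbc
    · rw [e1 _ h1]; exact hc.ok ℓ h1 h2
  · intro ℓ ℓ' h1 h2 h1' h2' b hb
    rcases cs ℓ h1 with rfl | h1
    · simp [e0, L0] at hb
    · rw [e1 _ h1] at hb
      rcases cs ℓ' h1' with rfl | h1'
      · rw [e0]; intro hb'; exact (hb2 b hb' ℓ h1 h2).1 hb
      · rw [e1 _ h1']; exact hc.lb _ _ h1 h2 h1' h2' _ hb
  · intro ℓ ℓ' h1 h2 h1' h2' b hb hb'
    rcases cs ℓ h1 with rfl | h1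
    · simp [e0, L0] at hb
    · rcases cs ℓ' h1' with rfl | h1'
      · simp [e0, L0] at hb'
      · rw [e1 _ h1] at hb; rw [e1 _ h1'] at hb'; exact hc.ll _ _ h1 h2 h1' h2' _ hb hb'
  · intro ℓ ℓ' h1 h2 h1' h2' b hb hb'
    rcases cs ℓ h1 with rfl | h1
    · rcases cs ℓ' h1' with rfl | h1'
      · rfl
      · rw [e0] at hb; rw [e1 _ h1'] at hb'; exact ((hb2 b hb _ h1' h2').2 hb').elim
    · rcases cs ℓ' h1' with rfl | h1'
      · rw [e0] at hb'; rw [e1 _ h1] at hb; exact ((hb2 b hb' _ h1 h2).2 hb).elim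
      · rw [e1 _ h1] at hb; rw [e1 _ h1'] at hb'; exact hc.bb _ _ h1 h2 h1' h2' _ hb hb'
  · intro ℓ ℓ' h1 h2 h1' h2' b hb hb'
    rcases cs ℓ h1 with rfl | h1
    · simp [e0, L0] at hb
    · rcases cs ℓ' h1' with rfl | h1'
      · simp [e0, L0] at hb'
      · rw [e1 _ h1] at hb; rw [e1 _ h1'] at hb'; exact hc.yy _ _ h1 h2 h1' h2' _ hb hb'
  · intro ℓ h1 h2 b hb
    rcases cs ℓ h1 with rfl | h1
    · simp [e0, L0] at hb
    · rw [e1 _ h1] at hb ⊢; exact hc.rk_lo _ h1 h2 _ hb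
  · intro ℓ h1 h2 b hb
    rcases cs ℓ h1 with rfl | h1
    · simp [e0, L0] at hb
    · rw [e1 _ h1] at hb; exact hc.rk_hi _ h1 h2 _ hb
  · intro ℓ ℓ' h1 h2 h1' h2' y hy b d κ hw ho hr
    rcases cs ℓ h1 with rfl | h1
    · simp [e0, L0] at hy
    · rcases cs ℓ' h1' with rfl | h1'
      · simp [e0, L0] at hr
      · rw [e1 _ h1] at hy hw; rw [e1 _ h1'] at hr
        exact hc.L4 _ _ h1 h2 h1' h2' y hy b d κ hw ho hr

theorem reset {t Q : ℕ} (hth : t ≤ h) (hc : Cfg col h B T t L rk)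
    (hQ : ∀ ℓ, t ≤ ℓ → ℓ < h → (L ℓ).letters.card ≤ Q) (hs : h * (Q + 2) + 2 ≤ T.starts.card) :
    ∃ L', Cfg col h B T 0 L' rk ∧ (∀ ℓ, t ≤ ℓ → L' ℓ = L ℓ) := by
  induction t generalizing L with
  | zero => exact ⟨L, hc, fun _ _ => rfl⟩
  | succ t ih =>
    obtain ⟨L1, h1, h2, h3⟩ := reset1 hc (by omega) hQ hs
    have hQ' : ∀ ℓ, t ≤ ℓ → ℓ < h → (L1 ℓ).letters.card ≤ Q := by
      intro ℓ a1 a2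
      rcases Nat.lt_or_ge t ℓ with a3 | a3
      · rw [h2 ℓ a3]; exact hQ ℓ a3 a2
      · have : ℓ = t := by omega
        subst this; exact h3
    obtain ⟨L2, h4, h5⟩ := ih (by omega) h1 hQ'
    exact ⟨L2, h4, fun ℓ hℓ => by rw [h5 ℓ (by omega), h2 ℓ hℓ]⟩

noncomputable def pl (T : DF n) (L : ℕ → Lst n) (ℓ : ℕ) : ℕ :=
  (L ℓ).letters.card * (n + 1) + (n - (Finset.univ.filter fun x => T.root x ∈ (L ℓ).letters).card)

noncomputable def pot (h Q : ℕ) (T : DF n) (L : ℕ → Lst n) : ℕ :=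
  ∑ ℓ ∈ Finset.range h, pl T L ℓ * ((Q + 1) * (n + 1)) ^ ℓ

theorem pl_lt {T : DF n} {L : ℕ → Lst n} {ℓ Q : ℕ} (hq : (L ℓ).letters.card ≤ Q) : pl T L ℓ < (Q + 1) * (n + 1) := by
  unfold pl
  nlinarith [Nat.sub_le n (Finset.univ.filter fun x => T.root x ∈ (L ℓ).letters).card]

theorem sum_lt {W : ℕ} (hW : 0 < W) (p : ℕ → ℕ) (k : ℕ) (hp : ∀ ℓ < k, p ℓ < W) :
    ∑ ℓ ∈ Finset.range k, p ℓ * W ^ ℓ < W ^ k := by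
  induction k with
  | zero => simp
  | succ k ih =>
    rw [Finset.sum_range_succ, pow_succ]
    have h1 := ih fun ℓ hℓ => hp ℓ (by omega)
    have h2 := hp k (by omega)
    have h3 : (p k + 1) * W ^ k ≤ W * W ^ k := Nat.mul_le_mul_right _ h2
    nlinarith

theorem sum_lt_sum {W : ℕ} (hW : 0 < W) (p p' : ℕ → ℕ) (k ℓ0 : ℕ) (hk : ℓ0 < k) (hp : ∀ ℓ < ℓ0, p ℓ < W)
    (h0 : p ℓ0 < p' ℓ0) (h1 : ∀ ℓ, ℓ0 < ℓ → ℓ < k → p ℓ ≤ p' ℓ) :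
    ∑ ℓ ∈ Finset.range k, p ℓ * W ^ ℓ < ∑ ℓ ∈ Finset.range k, p' ℓ * W ^ ℓ := by
  induction k with
  | zero => omega
  | succ k ih =>
    rw [Finset.sum_range_succ, Finset.sum_range_succ]
    by_cases hk' : ℓ0 = k
    · subst hk'
      have h2 := sum_lt hW p ℓ0 hp
      have h3 : (p ℓ0 + 1) * W ^ ℓ0 ≤ p' ℓ0 * W ^ ℓ0 := Nat.mul_le_mul_right _ h0
      nlinarith [Nat.zero_le (∑ ℓ ∈ Finset.range ℓ0, p' ℓ * W ^ ℓ)]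
    · have h2 := ih (by omega) fun ℓ a b => h1 ℓ a (by omega)
      have h3 : p k * W ^ k ≤ p' k * W ^ k := Nat.mul_le_mul_right _ (h1 k (by omega) (by omega))
      omega

theorem letters_le {t Q : ℕ} (hQ : ∀ q, 2 * 5 ^ q ≤ 4 ^ q * (n + 2) → q ≤ Q) (hrb : T.Rb col) (hc : Cfg col h B T t L rk) :
    ∀ ℓ, t ≤ ℓ → ℓ < h → (L ℓ).letters.card ≤ Q := by
  intro ℓ h1 h2
  apply hQ
  have hL := hc.ok ℓ h1 h2
  refine hL.grow.trans (Nat.mul_le_mul_left _ ?_)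
  have h3 := Finset.card_le_card hL.Ysub
  have h4 := T.card_cols hrb
  omega

/-- potential-maximal configuration -/
structure PM (col : Fin n → Fin n → ℕ) (h B Q : ℕ) (T : DF n) (L : ℕ → Lst n) (rk : Fin n → ℕ) : Prop where
  sym : ∀ u v, col u v = col v u
  prop : ∀ u x y, x ≠ u → y ≠ u → col u x = col u y → x = y
  mx : Mx col T
  cfg : Cfg col h B T 0 L rk
  hQ : ∀ q, 2 * 5 ^ q ≤ 4 ^ q * (n + 2) → q ≤ Q
  hB : Q < B
  hs : h * (Q + 2) + 2 ≤ T.starts.card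
  mxp : ∀ T' L' rk', Mx col T' → Cfg col h B T' 0 L' rk' → pot h Q T' L' ≤ pot h Q T L

theorem exists_PM {Q : ℕ} (hsym : ∀ u v, col u v = col v u) 
    (hprop : ∀ u x y, x ≠ u → y ≠ u → col u x = col u y → x = y) (hM : Mx col T)
    (hQ : ∀ q, 2 * 5 ^ q ≤ 4 ^ q * (n + 2) → q ≤ Q) (hB : Q < B) (hs : h * (Q + 2) + 2 ≤ T.starts.card) :
    ∃ T L rk, PM col h B Q T L rk := by
  let P : ℕ → Prop := fun k => ∃ T L rk, Mx col T ∧ Cfg col h B T 0 L rk ∧ pot h Q T L = k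
  have hstart : ∀ T', Mx col T' → T'.starts.card = T.starts.card := by
    intro T' h'
    have h1 := hM.mx T' h'.rb
    have h2 := h'.mx T hM.rb
    have h3 := T.card_cols hM.rb
    have h4 := T'.card_cols h'.rb
    omega
  have hbd : ∀ k, P k → k ≤ ((Q + 1) * (n + 1)) ^ h := by
    rintro k ⟨T', L', rk', h1, h2, rfl⟩
    refine (sum_lt (by positivity) _ _ ?_).le
    intro ℓ hℓ
    exact pl_lt (letters_le hQ h1.rb h2 ℓ (Nat.zero_le _) hℓ)
  have hne : ∃ k, P k := by
    have hc : Cfg col h B T h (fun _ => ⟨∅, ∅, ∅, fun _ => ∅⟩) (fun _ => 0) := by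
      constructor <;> intros <;> omega
    obtain ⟨L', h1, _⟩ := reset le_rfl hc (Q := Q) (by intros; simp) hs
    exact ⟨_, T, L', _, hM, h1, rfl⟩
  obtain ⟨k0, hk0⟩ := hne
  have hg := Nat.findGreatest_spec (P := P) (hbd k0 hk0) hk0
  obtain ⟨T', L', rk', h1, h2, h3⟩ := hg
  refine ⟨T', L', rk', hsym, hprop, h1, h2, hQ, hB, by rw [hstart T' h1]; exact hs, ?_⟩
  intro T'' L'' rk'' g1 g2
  rw [h3]
  exact Nat.le_findGreatest (hbd _ ⟨T'', L'', rk'', g1, g2, rfl⟩) ⟨T'', L'', rk'', g1, g2, rfl⟩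

theorem PM.no_improve {Q : ℕ} (hp : PM col h B Q T L rk) {T' : DF n} {L' rk'} {t ℓ0 : ℕ} (hM : Mx col T')
    (hc : Cfg col h B T' t L' rk') (h1 : t ≤ ℓ0) (h2 : ℓ0 < h) (h3 : pl T L ℓ0 < pl T' L' ℓ0)
    (h4 : ∀ ℓ, ℓ0 < ℓ → ℓ < h → pl T L ℓ ≤ pl T' L' ℓ) : False := by
  have hst : T'.starts.card = T.starts.card := by
    have a1 := hM.mx T hp.mx.rb
    have a2 := hp.mx.mx T' hM.rb
    have a3 := T.card_cols hp.mx.rb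
    have a4 := T'.card_cols hM.rb
    omega
  obtain ⟨L2, h5, h6⟩ := reset (by omega) hc (letters_le hp.hQ hM.rb hc) (by rw [hst]; exact hp.hs)
  have h7 := hp.mxp T' L2 rk' hM h5
  have h8 : ∀ ℓ, t ≤ ℓ → pl T' L2 ℓ = pl T' L' ℓ := by
    intro ℓ hℓ; unfold pl; rw [h6 ℓ hℓ]
  have h9 : pot h Q T L < pot h Q T' L2 := by
    refine sum_lt_sum (by positivity) _ _ h ℓ0 h2 ?_ ?_ ?_
    · intro ℓ hℓ; exact pl_lt (letters_le hp.hQ hp.mx.rb hp.cfg ℓ (Nat.zero_le _) (by omega))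
    · rw [h8 _ h1]; exact h3
    · intro ℓ a1 a2; rw [h8 _ (by omega)]; exact h4 ℓ a1 a2
  omega

end
end HC

namespace HC
open scoped Classical
variable {n : ℕ}

noncomputable def sg (col : Fin n → Fin n → ℕ) (T : DF n) (tw : ℕ) (c : ℕ → Fin n) : ℕ → Option ℕ :=
  fun s => if s < tw then T.a col (c s) else none

structure SX (col : Fin n → Fin n → ℕ) (h : ℕ) (T : DF n) (L : ℕ → Lst n) (tw : ℕ) (c : ℕ → Fin n)
    (σ : ℕ → Option ℕ) : Prop where
  lo : ∀ s < tw, σ s = T.a col (c s)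
  hi : ∀ ℓ, tw ≤ ℓ → ℓ < h → ∀ y, σ ℓ = some y → y ∈ (L ℓ).Y

structure Sel (col : Fin n → Fin n → ℕ) (h : ℕ) (T : DF n) (L : ℕ → Lst n) (tw k : ℕ) (c cs : ℕ → Fin n) : Prop where
  twh : tw ≤ h
  ktw : k ≤ tw + 1
  lab : ∀ s < tw, c s ∈ (L s).bases ∨ ∃ y ∈ (L s).Y, T.a col (c s) = some y
  cs_start : ∀ i < k, T.pred (cs i) = none
  cs_inj : ∀ i < k, ∀ j < k, cs i = cs j → i = j
  cs_nl : ∀ i < k, ∀ ℓ < h, cs i ∉ (L ℓ).letters ∧ cs i ∉ (L ℓ).bases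
  f5 : ∀ s < tw, ∀ i < k, s < i → ∀ y, T.a col (c s) = some y → ∀ b d κ, (b, d, some κ) ∈ (L s).W y →
    T.own col d false = some κ → T.root d ≠ cs i

def C4 (h : ℕ) (T : DF n) (L : ℕ → Lst n) (k : ℕ) (cs : ℕ → Fin n) (J : Finset (Fin n × Fin n × Bool)) : Prop :=
  ∀ r v, (r, v, false) ∈ J → ∃ i < k, r = cs i ∧ (∀ ℓ, i ≤ ℓ → ℓ < h → T.root v ∉ (L ℓ).letters) ∧
    ∀ j < k, T.root v = cs j → (∃ p, (cs j, p, false) ∈ J) → j < i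

noncomputable def R0 (tw k : ℕ) (c cs : ℕ → Fin n) : Finset (Fin n) :=
  (Finset.range tw).image c ∪ (Finset.range k).image cs

section
variable {col : Fin n → Fin n → ℕ} {h B Q : ℕ} {T : DF n} {L : ℕ → Lst n} {rk : Fin n → ℕ} {tw k : ℕ}
  {c cs : ℕ → Fin n} {σ : ℕ → Option ℕ} {J : Finset (Fin n × Fin n × Bool)} {C : Finset ℕ}

theorem mem_R0 {r : Fin n} : r ∈ R0 tw k c cs ↔ (∃ s < tw, c s = r) ∨ ∃ i < k, cs i = r := by
  simp [R0]

theorem SX.mem (hp : PM col h B Q T L rk) (hs : Sel col h T L tw k c cs) (hx : SX col h T L tw c σ) :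
    ∀ ℓ < h, ∀ y, σ ℓ = some y → y ∈ (L ℓ).Y := by
  intro ℓ hℓ y hy
  rcases Nat.lt_or_ge ℓ tw with h1 | h1
  · rw [hx.lo ℓ h1] at hy
    rcases hs.lab ℓ h1 with h2 | ⟨y', h2, h3⟩
    · rw [T.a_none.2 ((hp.cfg.ok ℓ (Nat.zero_le _) hℓ).bases_start _ h2)] at hy; cases hy
    · rw [h3] at hy; cases hy; exact h2
  · exact hx.hi ℓ h1 hℓ y hy

theorem sg_SX : SX col h T L tw c (sg col T tw c) := by
  constructor
  · intro s hs; simp [sg, hs]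
  · intro ℓ h1 h2 y hy
    simp [sg, Nat.not_lt.2 h1] at hy

theorem upd_SX {ℓ y} (h1 : tw ≤ ℓ) (hy : y ∈ (L ℓ).Y) :
    SX col h T L tw c (Function.update (sg col T tw c) ℓ (some y)) := by
  constructor
  · intro s hs; rw [Function.update_of_ne (by omega)]; simp [sg, hs]
  · intro ℓ' h1' h2 y' hy'
    by_cases he : ℓ' = ℓ
    · subst he; simp at hy'; subst hy'; exact hy
    · rw [Function.update_of_ne he] at hy'
      simp [sg, Nat.not_lt.2 h1'] at hy'

theorem Kd_SX (hp : PM col h B Q T L rk) (hs : Sel col h T L tw k c cs) (hx : SX col h T L tw c σ) {κ}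
    (hκ : κ ∈ Kd col h T L σ) : κ ∈ Kd col h T L (sg col T tw c) ∨ ∃ ℓ, tw ≤ ℓ ∧ ℓ < h ∧ κ ∈ (L ℓ).Y := by
  obtain ⟨ℓ, hℓ, y, hy, b, d, src, hw, rfl⟩ := mem_Kd.1 hκ
  rcases Nat.lt_or_ge ℓ tw with h1 | h1
  · left
    refine mem_Kd.2 ⟨ℓ, hℓ, y, ?_, b, d, src, hw, rfl⟩
    rw [sg_SX (L := L) (h := h) |>.lo ℓ h1, ← hx.lo ℓ h1, hy]
  · right
    exact ⟨ℓ, h1, hℓ, (hp.cfg.ok ℓ (Nat.zero_le _) hℓ).w_K y (hx.mem hp hs _ hℓ _ hy) _ _ _ hw⟩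

theorem letters_Q (hp : PM col h B Q T L rk) {ℓ} (hℓ : ℓ < h) : (L ℓ).letters.card ≤ Q :=
  letters_le hp.hQ hp.mx.rb hp.cfg ℓ (Nat.zero_le _) hℓ

theorem rk_gt (hp : PM col h B Q T L rk) {ℓ b} (hℓ : ℓ < h) (hb : b ∈ (L ℓ).letters) : (ℓ + 1) * B < rk b := by
  have h1 := hp.cfg.rk_lo ℓ (Nat.zero_le _) hℓ b hb
  have h2 := letters_Q hp hℓ
  have h3 := hp.hB
  nlinarith

theorem rank_ex (hp : PM col h B Q T L rk) (hs : Sel col h T L tw k c cs) (hx : SX col h T L tw c σ)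
    (hJ : C4 h T L k cs J) :
    ∃ ρ : Fin n → ℕ, ∀ r p, (r, p, false) ∈ Wd col h T L σ ∪ J → ρ (T.root p) < ρ (T.root r) := by
  have hB : 0 < B := by have := hp.hB; omega
  let ρ : Fin n → ℕ := fun x => if ∃ ℓ < h, x ∈ (L ℓ).letters then rk x else
    if hh : ∃ i < k, x = cs i ∧ ∃ p, (cs i, p, false) ∈ J then (hh.choose + 1) * B else 0
  have r1 : ∀ ℓ < h, ∀ x ∈ (L ℓ).letters, ρ x = rk x := by
    intro ℓ hℓ x hx'
    simp only [ρ]; rw [if_pos ⟨ℓ, hℓ, hx'⟩]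
  have r2 : ∀ i < k, (∃ p, (cs i, p, false) ∈ J) → ρ (cs i) = (i + 1) * B := by
    intro i hi hp'
    simp only [ρ]
    rw [if_neg (by rintro ⟨ℓ, hℓ, h1⟩; exact (hs.cs_nl i hi ℓ hℓ).1 h1)]
    have hh : ∃ j < k, cs i = cs j ∧ ∃ p, (cs j, p, false) ∈ J := ⟨i, hi, rfl, hp'⟩
    rw [dif_pos hh]
    have := hh.choose_spec
    have e := hs.cs_inj _ hi _ this.1 this.2.1
    exact congrArg (fun z => (z + 1) * B) e.symm
  have r3 : ∀ x, (∃ ℓ < h, x ∈ (L ℓ).letters) ∨ (∃ i < k, x = cs i ∧ ∃ p, (cs i, p, false) ∈ J) ∨ ρ x = 0 := by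
    intro x
    by_cases h1 : ∃ ℓ < h, x ∈ (L ℓ).letters
    · exact Or.inl h1
    · by_cases h2 : ∃ i < k, x = cs i ∧ ∃ p, (cs i, p, false) ∈ J
      · exact Or.inr (Or.inl h2)
      · right; right; simp only [ρ]; rw [if_neg h1, dif_neg h2]
  refine ⟨ρ, ?_⟩
  intro r p hj
  rcases Finset.mem_union.1 hj with h1 | h1
  · obtain ⟨ℓ, hℓ, y, hy, src, hw, hsrc⟩ := mem_Wd.1 h1
    have hL := hp.cfg.ok ℓ (Nat.zero_le _) hℓ
    have hyY := hx.mem hp hs _ hℓ _ hy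
    have hb := hL.w_let y hyY _ _ _ hw
    rw [T.root_start (hL.letters_start _ hb), r1 ℓ hℓ r hb]
    have hgt := rk_gt hp hℓ hb
    have ho := hL.own_src hyY hw
    rw [← hsrc] at ho
    cases src with
    | none =>
      have := hL.bases_start _ (hL.w_none y hyY _ _ hw)
      simp [T.a_none.2 this] at hsrc
    | some κ =>
      rcases r3 (T.root p) with ⟨ℓ', hℓ', h2⟩ | ⟨i, hi, h2, h3⟩ | h2
      · rw [r1 ℓ' hℓ' _ h2]
        exact hp.cfg.L4 ℓ ℓ' (Nat.zero_le _) hℓ (Nat.zero_le _) hℓ' y hyY _ _ _ hw ho h2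
      · rw [h2, r2 i hi h3]
        rcases Nat.lt_or_ge ℓ i with h4 | h4
        · exfalso
          have h5 : ℓ < tw := by have := hs.ktw; omega
          exact hs.f5 ℓ h5 i hi h4 y (by rw [← hx.lo ℓ h5, hy]) _ _ _ hw ho h2
        · have : (i + 1) * B ≤ (ℓ + 1) * B := Nat.mul_le_mul_right _ (by omega)
          omega
      · omega
  · obtain ⟨i, hi, rfl, h2, h3⟩ := hJ _ _ h1
    rw [T.root_start (hs.cs_start i hi), r2 i hi ⟨_, h1⟩]
    rcases r3 (T.root p) with ⟨ℓ', hℓ', h4⟩ | ⟨j, hj, h4, h5⟩ | h4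
    · rw [r1 ℓ' hℓ' _ h4]
      have h5 := hp.cfg.rk_hi ℓ' (Nat.zero_le _) hℓ' _ h4
      have h6 : ℓ' < i := by
        by_contra h6
        exact h2 ℓ' (by omega) hℓ' h4
      have : (ℓ' + 2) * B ≤ (i + 1) * B := Nat.mul_le_mul_right _ (by omega)
      omega
    · rw [h4, r2 j hj h5]
      have := h3 j hj h4 h5
      exact Nat.mul_lt_mul_of_pos_right (by omega) hB
    · rw [h4]; positivity

theorem y_Kd (hp : PM col h B Q T L rk) (hs : Sel col h T L tw k c cs) (hx : SX col h T L tw c σ) {ℓ y}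
    (hℓ : ℓ < h) (hy : σ ℓ = some y) : y ∈ Kd col h T L σ := by
  obtain ⟨b, d, s, h1, h2⟩ := (hp.cfg.ok ℓ (Nat.zero_le _) hℓ).w_y y (hx.mem hp hs _ hℓ _ hy)
  exact mem_Kd.2 ⟨ℓ, hℓ, y, hy, b, d, s, h1, h2⟩

/-- facts about labels -/
theorem R0_cases (hp : PM col h B Q T L rk) (hs : Sel col h T L tw k c cs) {r} (hr : r ∈ R0 tw k c cs) :
    (∃ s < tw, r = c s ∧ r ∈ (L s).bases ∧ T.a col r = none) ∨ (∃ s < tw, ∃ y ∈ (L s).Y, r = c s ∧ T.a col r = some y) ∨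
    (∃ i < k, r = cs i ∧ T.a col r = none) := by
  rcases mem_R0.1 hr with ⟨s, h1, rfl⟩ | ⟨i, h1, rfl⟩
  · rcases hs.lab s h1 with h2 | ⟨y, h2, h3⟩
    · exact Or.inl ⟨s, h1, rfl, h2, T.a_none.2 ((hp.cfg.ok s (Nat.zero_le _) (by have := hs.twh; omega)).bases_start _ h2)⟩
    · exact Or.inr (Or.inl ⟨s, h1, y, h2, rfl, h3⟩)
  · exact Or.inr (Or.inr ⟨i, h1, rfl, T.a_none.2 (hs.cs_start i h1)⟩)

/-- a label is a start or its colour is in Kd -/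
theorem R0_a (hp : PM col h B Q T L rk) (hs : Sel col h T L tw k c cs) {r κ} (hr : r ∈ R0 tw k c cs)
    (ha : T.a col r = some κ) : κ ∈ Kd col h T L (sg col T tw c) := by
  rcases R0_cases hp hs hr with ⟨s, h1, h2, h3, h4⟩ | ⟨s, h1, y, h2, h3, h4⟩ | ⟨i, h1, h2, h3⟩
  · rw [h4] at ha; cases ha
  · rw [h4] at ha; cases ha
    exact y_Kd hp hs (sg_SX) (ℓ := s) (by have := hs.twh; omega) (by rw [sg_SX (L := L) (h := h) |>.lo s h1, ← h3, h4])
  · rw [h3] at ha; cases ha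

/-- labels avoid letters and bases of unselected lists -/
theorem R0_nl (hp : PM col h B Q T L rk) (hs : Sel col h T L tw k c cs) (hx : SX col h T L tw c σ) {r}
    (hr : r ∈ R0 tw k c cs) {ℓ} (hℓ : ℓ < h) (hn : σ ℓ ≠ none ∨ tw ≤ ℓ) : r ∉ (L ℓ).letters ∧ r ∉ (L ℓ).bases := by
  have hL := hp.cfg.ok ℓ (Nat.zero_le _) hℓ
  rcases R0_cases hp hs hr with ⟨s, h1, h2, h3, h4⟩ | ⟨s, h1, y, h2, h3, h4⟩ | ⟨i, h1, h2, h3⟩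
  · have hsh : s < h := by have := hs.twh; omega
    refine ⟨fun h5 => hp.cfg.lb ℓ s (Nat.zero_le _) hℓ (Nat.zero_le _) hsh _ h5 h3, fun h5 => ?_⟩
    have := hp.cfg.bb ℓ s (Nat.zero_le _) hℓ (Nat.zero_le _) hsh _ h5 h3
    subst this
    rcases hn with hn | hn
    · rw [hx.lo ℓ h1, ← h2, h4] at hn; exact hn rfl
    · omega
  · constructor
    · intro h5; rw [T.a_none.2 (hL.letters_start _ h5)] at h4; cases h4
    · intro h5; rw [T.a_none.2 (hL.bases_start _ h5)] at h4; cases h4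
  · subst h2; exact hs.cs_nl i h1 ℓ hℓ

theorem mk_loose (hp : PM col h B Q T L rk) (hs : Sel col h T L tw k c cs) (hx : SX col h T L tw c σ)
    (hC : C ⊆ T.cols col) (hCK : ∀ κ ∈ C, κ ∉ Kd col h T L σ)
    (rR : ∀ r v s, (r, v, s) ∈ J → r ∈ R0 tw k c cs) (vR : ∀ r v, (r, v, true) ∈ J → v ∉ R0 tw k c cs)
    (v_some : ∀ r v s, (r, v, s) ∈ J → ∀ κ, T.own col v s = some κ → κ ∈ C ∨ ∃ ℓ < h, σ ℓ = some κ)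
    (v_none : ∀ r v, (r, v, true) ∈ J → T.a col v = none → ∀ ℓ < h, σ ℓ ≠ none → v ∉ (L ℓ).letters ∧ v ∉ (L ℓ).bases)
    (inj_r : ∀ r v s v' s', (r, v, s) ∈ J → (r, v', s') ∈ J → v = v' ∧ s = s')
    (inj_v : ∀ r r' v s, (r, v, s) ∈ J → (r', v, s) ∈ J → r = r')
    (col_inj : ∀ r v s r' v' s', (r, v, s) ∈ J → (r', v', s') ∈ J → col r v = col r' v' → r = r')
    (col_C : ∀ r v s, (r, v, s) ∈ J → col r v ∈ C ∨ col r v ∉ T.cols col) : Loose col h T L σ J C := by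
  refine ⟨hC, hCK, ?_, ?_, v_some, v_none, inj_r, inj_v, ?_, col_inj, col_C⟩
  · intro r v s hj κ hκ
    rcases R0_cases hp hs (rR _ _ _ hj) with ⟨s, h1, h2, h3, h4⟩ | ⟨s, h1, y, h2, h3, h4⟩ | ⟨i, h1, h2, h3⟩
    · rw [h4] at hκ; cases hκ
    · rw [h4] at hκ; cases hκ
      exact ⟨s, by have := hs.twh; omega, by rw [hx.lo s h1, ← h3, h4]⟩
    · rw [h3] at hκ; cases hκ
  · intro r v s hj ha ℓ hℓ hn
    exact R0_nl hp hs hx (rR _ _ _ hj) hℓ (Or.inl hn)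
  · intro r v r' v' s' h1 h2 he
    subst he
    exact vR _ _ h1 (rR _ _ _ h2)

/-- chains -/
structure Chain (col : Fin n → Fin n → ℕ) (h : ℕ) (T : DF n) (L : ℕ → Lst n) (k : ℕ) (cs : ℕ → Fin n)
    (R : Finset (Fin n)) (E : Finset ℕ) (f : ℕ) (J : Finset (Fin n × Fin n × Bool)) (C : Finset ℕ) (m : ℕ) : Prop where
  CE : C ⊆ E
  card : J.card = C.card
  rR : ∀ r v s, (r, v, s) ∈ J → r ∈ R
  own : ∀ r v s, (r, v, s) ∈ J → ∃ κ ∈ C, T.own col v s = some κ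
  inj_r : ∀ r v s v' s', (r, v, s) ∈ J → (r, v', s') ∈ J → v = v' ∧ s = s'
  inj_v : ∀ r r' v s, (r, v, s) ∈ J → (r', v, s) ∈ J → r = r'
  col_inj : ∀ r v s r' v' s', (r, v, s) ∈ J → (r', v', s') ∈ J → col r v = col r' v' → r = r'
  colm : ∀ r v s, (r, v, s) ∈ J → col r v ∈ C ∨ col r v = m
  colf : ∀ r v s, (r, v, s) ∈ J → col r v ≠ f
  m_new : m ∉ T.cols col
  fm : f ∈ C ∨ f = m
  c4 : C4 h T L k cs J

structure Fam (col : Fin n → Fin n → ℕ) (h : ℕ) (T : DF n) (L : ℕ → Lst n) (tw k : ℕ) (c cs : ℕ → Fin n)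
    (R : Finset (Fin n)) (E : Finset ℕ) : Prop where
  RR : R ⊆ R0 tw k c cs
  Ec : E ⊆ T.cols col
  EY : ∀ κ ∈ E, ∀ ℓ, tw ≤ ℓ → ℓ < h → κ ∉ (L ℓ).Y
  EK : ∀ κ ∈ E, κ ∉ Kd col h T L (sg col T tw c)
  El : ∀ x κ, T.a col x = some κ → κ ∈ E → ∀ ℓ, tw ≤ ℓ → ℓ < h → T.root x ∉ (L ℓ).letters
  ch : ∀ κ ∈ E, ∃ J C m, Chain col h T L k cs R E κ J C m

variable {R R' : Finset (Fin n)} {E E' : Finset ℕ} {f m : ℕ}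

theorem Chain.mono (hc : Chain col h T L k cs R E f J C m) (hR : R ⊆ R') (hE : E ⊆ E') :
    Chain col h T L k cs R' E' f J C m :=
  { hc with CE := hc.CE.trans hE, rR := fun r v s hj => hR (hc.rR r v s hj) }

theorem empty_chain (hf : f ∉ T.cols col) : Chain col h T L k cs R E f ∅ ∅ f := by
  constructor <;> simp [hf, C4]

theorem Chain.vR (hp : PM col h B Q T L rk) (hs : Sel col h T L tw k c cs) (hF : Fam col h T L tw k c cs R E)
    (hc : Chain col h T L k cs R E f J C m) : ∀ r v, (r, v, true) ∈ J → v ∉ R0 tw k c cs := by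
  intro r v hj hv
  obtain ⟨κ, h1, h2⟩ := hc.own _ _ _ hj
  exact hF.EK κ (hc.CE h1) (R0_a hp hs hv h2)

theorem Fam.CK (hp : PM col h B Q T L rk) (hs : Sel col h T L tw k c cs) (hF : Fam col h T L tw k c cs R E)
    (hx : SX col h T L tw c σ) {κ} (hκ : κ ∈ E) : κ ∉ Kd col h T L σ := by
  intro h1
  rcases Kd_SX hp hs hx h1 with h2 | ⟨ℓ, h2, h3, h4⟩
  · exact hF.EK κ hκ h2
  · exact hF.EY κ hκ ℓ h2 h3 h4

/-- adding one join -/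
theorem ext_loose (hp : PM col h B Q T L rk) (hs : Sel col h T L tw k c cs) (hF : Fam col h T L tw k c cs R E)
    (hx : SX col h T L tw c σ) (hc : Chain col h T L k cs R E f J C m) {C' : Finset ℕ} (hC : C ⊆ C')
    (hCc : C' ⊆ T.cols col) (hCK : ∀ κ ∈ C', κ ∉ Kd col h T L σ)
    {r x : Fin n} {s : Bool} (hr : r ∈ R0 tw k c cs) (hrR : r ∉ R) (hxJ : ∀ r', (r', x, s) ∉ J)
    (hxr : s = true → x ∉ R0 tw k c cs)
    (hown : ∀ κ, T.own col x s = some κ → κ ∈ C' ∨ ∃ ℓ < h, σ ℓ = some κ)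
    (hnone : s = true → T.a col x = none → ∀ ℓ < h, σ ℓ ≠ none → x ∉ (L ℓ).letters ∧ x ∉ (L ℓ).bases)
    (hf : ∀ r' v s', (r', v, s') ∈ J → col r' v ≠ col r x) (hfC : col r x ∈ C' ∨ col r x ∉ T.cols col) :
    Loose col h T L σ (insert (r, x, s) J) C' := by
  have hrJ : ∀ v s, (r, v, s) ∉ J := fun v s hj => hrR (hc.rR _ _ _ hj)
  apply mk_loose hp hs hx hCc hCK
  · intro r' v s' hj
    rcases Finset.mem_insert.1 hj with h1 | h1
    · cases h1; exact hr
    · exact hF.RR (hc.rR _ _ _ h1)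
  · intro r' v hj
    rcases Finset.mem_insert.1 hj with h1 | h1
    · cases h1; exact hxr rfl
    · exact hc.vR hp hs hF _ _ h1
  · intro r' v s' hj κ hκ
    rcases Finset.mem_insert.1 hj with h1 | h1
    · cases h1; exact hown κ hκ
    · obtain ⟨κ', h2, h3⟩ := hc.own _ _ _ h1
      rw [h3] at hκ; cases hκ
      exact Or.inl (hC h2)
  · intro r' v hj ha
    rcases Finset.mem_insert.1 hj with h1 | h1
    · cases h1; exact hnone rfl ha
    · obtain ⟨κ', h2, h3⟩ := hc.own _ _ _ h1
      rw [T.own_true, ha] at h3; cases h3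
  · intro r' v s1 v' s2 hj hj'
    rcases Finset.mem_insert.1 hj with h1 | h1 <;> rcases Finset.mem_insert.1 hj' with h2 | h2
    · cases h1; cases h2; exact ⟨rfl, rfl⟩
    · cases h1; exact (hrJ _ _ h2).elim
    · cases h2; exact (hrJ _ _ h1).elim
    · exact hc.inj_r _ _ _ _ _ h1 h2
  · intro r1 r2 v s1 hj hj'
    rcases Finset.mem_insert.1 hj with h1 | h1 <;> rcases Finset.mem_insert.1 hj' with h2 | h2
    · cases h1; cases h2; rfl
    · cases h1; exact (hxJ _ h2).elim
    · cases h2; exact (hxJ _ h1).elim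
    · exact hc.inj_v _ _ _ _ h1 h2
  · intro r1 v1 s1 r2 v2 s2 hj hj' he
    rcases Finset.mem_insert.1 hj with h1 | h1 <;> rcases Finset.mem_insert.1 hj' with h2 | h2
    · cases h1; cases h2; rfl
    · cases h1; exact (hf _ _ _ h2 he.symm).elim
    · cases h2; exact (hf _ _ _ h1 he).elim
    · exact hc.col_inj _ _ _ _ _ _ h1 h2 he
  · intro r1 v1 s1 hj
    rcases Finset.mem_insert.1 hj with h1 | h1
    · cases h1; exact hfC
    · rcases hc.colm _ _ _ h1 with h2 | h2
      · exact Or.inl (hC h2)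
      · right; rw [h2]; exact hc.m_new

theorem gain (hp : PM col h B Q T L rk) (hs : Sel col h T L tw k c cs) (hF : Fam col h T L tw k c cs R E)
    (hx : SX col h T L tw c σ) (hc : Chain col h T L k cs R E f J C m)
    {r x : Fin n} {s : Bool} (hr : r ∈ R0 tw k c cs) (hrR : r ∉ R) (hxJ : ∀ r', (r', x, s) ∉ J)
    (hxr : s = true → x ∉ R0 tw k c cs)
    (hown : ∀ κ, T.own col x s = some κ → κ ∈ C ∨ ∃ ℓ < h, σ ℓ = some κ)
    (hnone : s = true → T.a col x = none → ∀ ℓ < h, σ ℓ ≠ none → x ∉ (L ℓ).letters ∧ x ∉ (L ℓ).bases)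
    (hf : ∀ r' v s', (r', v, s') ∈ J → col r' v ≠ col r x) (hfC : col r x ∈ C ∨ col r x ∉ T.cols col)
    (h4 : C4 h T L k cs (insert (r, x, s) J)) : False := by
  have hl := ext_loose hp hs hF hx hc (Finset.Subset.refl C) (hc.CE.trans hF.Ec)
    (fun κ hκ => hF.CK hp hs hx (hc.CE hκ)) hr hrR hxJ hxr hown hnone hf hfC
  have h1 := no_gain hp.sym hp.mx hp.cfg (hx.mem hp hs) hl (rank_ex hp hs hx h4)
  rw [Finset.card_insert_of_notMem (hxJ r), hc.card] at h1
  omega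

/-- committing a loose set using only lists `< tw` -/
theorem commit_total (hp : PM col h B Q T L rk) (hs : Sel col h T L tw k c cs)
    (hl : Loose col h T L (sg col T tw c) J C) (hcard : J.card = C.card) (h4 : C4 h T L k cs J)
    (hCY : ∀ κ ∈ C, ∀ ℓ, tw ≤ ℓ → ℓ < h → κ ∉ (L ℓ).Y)
    (rR : ∀ r v s, (r, v, s) ∈ J → r ∈ R0 tw k c cs)
    (hv : ∀ r v, (r, v, true) ∈ J → T.a col v ≠ none) :
    ∃ T' : DF n, Mod col T (Kd col h T L (sg col T tw c) ∪ C) (Wd col h T L (sg col T tw c) ∪ J) T' ∧ Mx col T' ∧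
      Cfg col h B T' tw L rk ∧ (∀ ℓ, tw ≤ ℓ → ℓ < h → 
        (Finset.univ.filter fun x => T'.root x ∈ (L ℓ).letters) ⊆ (Finset.univ.filter fun x => T.root x ∈ (L ℓ).letters) ∧
        ∀ x, T'.root x ∈ (L ℓ).letters → ∀ κ, T.a col x = some κ → κ ∉ C) ∧
      (∀ ℓ, tw ≤ ℓ → ℓ < h → ∀ b ∈ (L ℓ).letters, ∀ x p, T'.root x = b → T.pred x = some p → 
        col p x ∉ Kd col h T L (sg col T tw c) ∪ C → T'.pred x = some p) := by
  have hx : SX col h T L tw c (sg col T tw c) := sg_SX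
  have hval := total_valid hp.cfg (hx.mem hp hs) hl (rank_ex hp hs hx h4)
  have htc := total_card hp.cfg (hx.mem hp hs) hl
  have hc' : Cfg col h B T tw L rk := by
    have hc := hp.cfg
    have z : ∀ {ℓ : ℕ}, tw ≤ ℓ → 0 ≤ ℓ := fun _ => Nat.zero_le _
    exact ⟨fun ℓ a b => hc.ok ℓ (z a) b, fun ℓ ℓ' a b a' b' => hc.lb ℓ ℓ' (z a) b (z a') b',
      fun ℓ ℓ' a b a' b' => hc.ll ℓ ℓ' (z a) b (z a') b', fun ℓ ℓ' a b a' b' => hc.bb ℓ ℓ' (z a) b (z a') b',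
      fun ℓ ℓ' a b a' b' => hc.yy ℓ ℓ' (z a) b (z a') b', fun ℓ a b => hc.rk_lo ℓ (z a) b, 
      fun ℓ a b => hc.rk_hi ℓ (z a) b, fun ℓ ℓ' a b a' b' => hc.L4 ℓ ℓ' (z a) b (z a') b'⟩
  have wl : ∀ b d s, (b, d, s) ∈ Wd col h T L (sg col T tw c) → ∃ ℓ < tw, ℓ < h ∧ ∃ y ∈ (L ℓ).Y, ∃ src, (b, d, src) ∈ (L ℓ).W y ∧
      s = decide (src = T.a col d) := by
    intro b d s hj
    obtain ⟨ℓ, hℓ, y, hy, src, hw, e⟩ := mem_Wd.1 hj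
    refine ⟨ℓ, ?_, hℓ, y, hx.mem hp hs _ hℓ _ hy, src, hw, e⟩
    by_contra h1
    simp [sg, h1] at hy
  have wlt : ∀ r b, T.pred b = none → (r, b, true) ∈ Wd col h T L (sg col T tw c) → ∃ ℓ < tw, b ∈ (L ℓ).bases := by
    intro r b hb hj
    obtain ⟨ℓ, h1, h2, y, hy, src, hw, e⟩ := wl _ _ _ hj
    rw [T.a_none.2 hb] at e
    have e : src = none := by simpa using e.symm
    subst e
    exact ⟨ℓ, h1, (hp.cfg.ok ℓ (Nat.zero_le _) h2).w_none y hy _ _ hw⟩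
  have hlet : ∀ ℓ, tw ≤ ℓ → ℓ < h → ∀ b ∈ (L ℓ).letters, 
      (∀ v s, (b, v, s) ∉ Wd col h T L (sg col T tw c) ∪ J) ∧ (∀ r, (r, b, true) ∉ Wd col h T L (sg col T tw c) ∪ J) ∧
      (∀ r p, (r, p, false) ∈ Wd col h T L (sg col T tw c) ∪ J → T.root p ≠ b) := by
    intro ℓ h1 h2 b hb
    have hbs := (hp.cfg.ok ℓ (Nat.zero_le _) h2).letters_start b hb
    refine ⟨?_, ?_, ?_⟩
    · intro v s hj
      rcases Finset.mem_union.1 hj with h3 | h3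
      · obtain ⟨ℓ', g1, g2, y, hy, src, hw, e⟩ := wl _ _ _ h3
        have := hp.cfg.ll ℓ ℓ' (Nat.zero_le _) h2 (Nat.zero_le _) g2 b hb ((hp.cfg.ok ℓ' (Nat.zero_le _) g2).w_let y hy _ _ _ hw)
        omega
      · exact (R0_nl hp hs hx (rR _ _ _ h3) h2 (Or.inr h1)).1 hb
    · intro r hj
      rcases Finset.mem_union.1 hj with h3 | h3
      · obtain ⟨ℓ', g1, g2⟩ := wlt _ _ hbs h3
        exact hp.cfg.lb ℓ ℓ' (Nat.zero_le _) h2 (Nat.zero_le _) (by omega) b hb g2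
      · exact hv _ _ h3 (T.a_none.2 hbs)
    · intro r p hj he
      rcases Finset.mem_union.1 hj with h3 | h3
      · obtain ⟨ℓ', g1, g2, y, hy, src, hw, e⟩ := wl _ _ _ h3
        have hL' := hp.cfg.ok ℓ' (Nat.zero_le _) g2
        have ho := hL'.own_src hy hw
        rw [← e] at ho
        cases src with
        | none =>
          have := hL'.bases_start _ (hL'.w_none y hy _ _ hw)
          simp [T.a_none.2 this] at e
        | some κ =>
          have g3 := hp.cfg.L4 ℓ' ℓ (Nat.zero_le _) g2 (Nat.zero_le _) h2 y hy _ _ _ hw ho (by rw [he]; exact hb)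
          rw [he] at g3
          have g4 := rk_gt hp h2 hb
          have g5 := hp.cfg.rk_hi ℓ' (Nat.zero_le _) g2 _ (hL'.w_let y hy _ _ _ hw)
          have : (ℓ' + 2) * B ≤ (ℓ + 1) * B := Nat.mul_le_mul_right _ (by omega)
          omega
      · obtain ⟨i, hi, _, g1, _⟩ := h4 _ _ h3
        exact g1 ℓ (by have := hs.ktw; omega) h2 (by rw [he]; exact hb)
  obtain ⟨T', hT', hM', hc''⟩ := commit hp.sym hp.mx hc' hval (by omega) (by
    intro ℓ h1 h2 κ hκ hκ'
    rcases Finset.mem_union.1 hκ' with h3 | h3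
    · obtain ⟨ℓ', g1, g2, g3⟩ := Kd_sub hp.cfg (hx.mem hp hs) h3
      have := hp.cfg.yy ℓ ℓ' (Nat.zero_le _) h2 (Nat.zero_le _) g1 κ hκ g3
      subst this
      simp [sg, Nat.not_lt.2 h1] at g2
    · exact hCY κ h3 ℓ h1 h2 hκ) hlet (by
    intro ℓ h1 h2 b hb
    have hbs := (hp.cfg.ok ℓ (Nat.zero_le _) h2).bases_start b hb
    refine ⟨?_, ?_⟩
    · intro v s hj
      rcases Finset.mem_union.1 hj with h3 | h3
      · obtain ⟨ℓ', g1, g2, y, hy, src, hw, e⟩ := wl _ _ _ h3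
        exact hp.cfg.lb ℓ' ℓ (Nat.zero_le _) g2 (Nat.zero_le _) h2 b ((hp.cfg.ok ℓ' (Nat.zero_le _) g2).w_let y hy _ _ _ hw) hb
      · exact (R0_nl hp hs hx (rR _ _ _ h3) h2 (Or.inr h1)).2 hb
    · intro r hj
      rcases Finset.mem_union.1 hj with h3 | h3
      · obtain ⟨ℓ', g1, g2⟩ := wlt _ _ hbs h3
        have := hp.cfg.bb ℓ ℓ' (Nat.zero_le _) h2 (Nat.zero_le _) (by omega) b hb g2
        omega
      · exact hv _ _ h3 (T.a_none.2 hbs))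
  refine ⟨T', hT', hM', hc'', ?_, ?_⟩
  · intro ℓ h1 h2
    have key : ∀ x, T'.root x ∈ (L ℓ).letters → T.root x = T'.root x ∧ ∀ κ, T.a col x = some κ → κ ∉ C := by
      intro x hx'
      obtain ⟨g1, g2, g3⟩ := hlet ℓ h1 h2 _ hx'
      obtain ⟨k1, k2, k3⟩ := hT'.arm _ ((hp.cfg.ok ℓ (Nat.zero_le _) h2).letters_start _ hx') g1 g2 g3 x rfl
      exact ⟨k1, fun κ hκ hC => k3 κ hκ (Finset.mem_union_right _ hC)⟩
    refine ⟨?_, fun x hx' => (key x hx').2⟩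
    intro x hx'
    simp only [Finset.mem_filter, Finset.mem_univ, true_and] at hx' ⊢
    rw [(key x hx').1]; exact hx'
  · intro ℓ h1 h2 b hb x p hxb hpx hcol
    obtain ⟨g1, g2, g3⟩ := hlet ℓ h1 h2 _ hb
    refine hT'.arm2 b ?_ g1 g2 x p hxb hpx hcol
    intro κ hκ
    rw [T.a_none.2 ((hp.cfg.ok ℓ (Nat.zero_le _) h2).letters_start _ hb)] at hκ; cases hκ

end
end HC

namespace HC
open scoped Classical
variable {n : ℕ}

noncomputable def ex (col : Fin n → Fin n → ℕ) (h : ℕ) (T : DF n) (L : ℕ → Lst n) (tw k : ℕ) (c cs : ℕ → Fin n) :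
    Finset (Fin n) :=
  Finset.univ.filter fun x => (∃ s < tw, x ∈ (L s).letters ∨ x ∈ (L s).bases) ∨ (∃ i < k, x = cs i) ∨
    (∃ κ ∈ Kd col h T L (sg col T tw c), T.a col x = some κ) ∨
    (∃ κ ∈ Kd col h T L (sg col T tw c), T.own col x false = some κ)

structure New (col : Fin n → Fin n → ℕ) (h : ℕ) (T : DF n) (L : ℕ → Lst n) (tw k : ℕ) (c cs : ℕ → Fin n)
    (R : Finset (Fin n)) (E : Finset ℕ) (κ : ℕ) : Prop where
  cc : κ ∈ T.cols col
  cY : ∀ ℓ, tw ≤ ℓ → ℓ < h → κ ∉ (L ℓ).Y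
  cK : κ ∉ Kd col h T L (sg col T tw c)
  cl : ∀ x, T.a col x = some κ → ∀ ℓ, tw ≤ ℓ → ℓ < h → T.root x ∉ (L ℓ).letters
  ch : ∃ J C m, Chain col h T L k cs R (insert κ E) κ J C m

section
variable {col : Fin n → Fin n → ℕ} {h B Q : ℕ} {T : DF n} {L : ℕ → Lst n} {rk : Fin n → ℕ} {tw k : ℕ}
  {c cs : ℕ → Fin n} {σ : ℕ → Option ℕ} {J : Finset (Fin n × Fin n × Bool)} {C : Finset ℕ}
  {R R' : Finset (Fin n)} {E E' : Finset ℕ} {f m : ℕ}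

theorem Fam.add (hF : Fam col h T L tw k c cs R E) (hR : R ⊆ R') (hR' : R' ⊆ R0 tw k c cs) {N : Finset ℕ}
    (hN : ∀ κ ∈ N, κ ∈ E ∨ New col h T L tw k c cs R' E κ) : Fam col h T L tw k c cs R' (E ∪ N) := by
  have hN' : ∀ κ ∈ E ∪ N, κ ∈ E ∨ (κ ∈ N ∧ New col h T L tw k c cs R' E κ) := by
    intro κ hκ
    rcases Finset.mem_union.1 hκ with h1 | h1
    · exact Or.inl h1
    · rcases hN κ h1 with h2 | h2
      · exact Or.inl h2
      · exact Or.inr ⟨h1, h2⟩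
  refine ⟨hR', ?_, ?_, ?_, ?_, ?_⟩
  · intro κ hκ
    rcases hN' κ hκ with h1 | ⟨_, h1⟩
    · exact hF.Ec h1
    · exact h1.cc
  · intro κ hκ
    rcases hN' κ hκ with h1 | ⟨_, h1⟩
    · exact hF.EY κ h1
    · exact h1.cY
  · intro κ hκ
    rcases hN' κ hκ with h1 | ⟨_, h1⟩
    · exact hF.EK κ h1
    · exact h1.cK
  · intro x κ hx hκ
    rcases hN' κ hκ with h1 | ⟨_, h1⟩
    · exact hF.El x κ hx h1
    · exact h1.cl x hx
  · intro κ hκ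
    rcases hN' κ hκ with h1 | ⟨h0, h1⟩
    · obtain ⟨J, C, m, hc⟩ := hF.ch κ h1
      exact ⟨J, C, m, hc.mono hR Finset.subset_union_left⟩
    · obtain ⟨J, C, m, hc⟩ := h1.ch
      exact ⟨J, C, m, hc.mono (Finset.Subset.refl _)
        (Finset.insert_subset (Finset.mem_union_right _ h0) Finset.subset_union_left)⟩

theorem C4_true (h4 : C4 h T L k cs J) (r x : Fin n) : C4 h T L k cs (insert (r, x, true) J) := by
  intro r' v hj
  have e : ∀ r' v, (r', v, false) ∈ insert (r, x, true) J → (r', v, false) ∈ J := by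
    intro r' v hj
    rcases Finset.mem_insert.1 hj with h1 | h1
    · cases h1
    · exact h1
  obtain ⟨i, hi, h1, h2, h3⟩ := h4 _ _ (e _ _ hj)
  exact ⟨i, hi, h1, h2, fun j hj h5 ⟨p, h6⟩ => h3 j hj h5 ⟨p, e _ _ h6⟩⟩

theorem C4_false (h4 : C4 h T L (tw + 1) cs J) {p : Fin n}
    (h1 : ∀ ℓ, tw ≤ ℓ → ℓ < h → T.root p ∉ (L ℓ).letters) (h2 : T.root p ≠ cs tw)
    (h3 : ∀ r' v, (r', v, false) ∈ J → T.root v ≠ cs tw) : C4 h T L (tw + 1) cs (insert (cs tw, p, false) J) := by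
  intro r' v hj
  rcases Finset.mem_insert.1 hj with h5 | h5
  · cases h5
    refine ⟨tw, by omega, rfl, h1, ?_⟩
    intro j hj h6 _
    have : j ≠ tw := by rintro rfl; exact h2 h6
    omega
  · obtain ⟨i, hi, k1, k2, k3⟩ := h4 _ _ h5
    refine ⟨i, hi, k1, k2, ?_⟩
    rintro j hj h6 ⟨p', h7⟩
    rcases Finset.mem_insert.1 h7 with h8 | h8
    · have : cs j = cs tw := by
        have := congrArg Prod.fst h8; exact this
      exact (h3 _ _ h5 (by rw [h6, this])).elim
    · exact k3 j hj h6 ⟨p', h8⟩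

/-- inserting a join to get a chain for a new colour -/
theorem Chain.ext (hc : Chain col h T L k cs R E f J C m) {r x : Fin n} {s : Bool} {κ : ℕ} (hrR : r ∉ R)
    (hEc : E ⊆ T.cols col) (hκc : κ ∈ T.cols col)
    (hf : col r x = f) (ho : T.own col x s = some κ) (hκ : κ ∉ C)
    (h4 : C4 h T L k cs (insert (r, x, s) J)) :
    Chain col h T L k cs (insert r R) (insert κ E) κ (insert (r, x, s) J) (insert κ C) m := by
  have hrJ : ∀ v s, (r, v, s) ∉ J := fun v s hj => hrR (hc.rR _ _ _ hj)
  have hxJ : ∀ r', (r', x, s) ∉ J := by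
    intro r' hj
    obtain ⟨κ', h1, h2⟩ := hc.own _ _ _ hj
    rw [ho] at h2; cases h2; exact hκ h1
  refine ⟨Finset.insert_subset_insert _ hc.CE, ?_, ?_, ?_, ?_, ?_, ?_, ?_, ?_, hc.m_new, 
    Or.inl (Finset.mem_insert_self _ _), h4⟩
  · rw [Finset.card_insert_of_notMem (hxJ r), Finset.card_insert_of_notMem hκ, hc.card]
  · intro r' v s' hj
    rcases Finset.mem_insert.1 hj with h1 | h1
    · cases h1; exact Finset.mem_insert_self _ _
    · exact Finset.mem_insert_of_mem (hc.rR _ _ _ h1)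
  · intro r' v s' hj
    rcases Finset.mem_insert.1 hj with h1 | h1
    · cases h1; exact ⟨κ, Finset.mem_insert_self _ _, ho⟩
    · obtain ⟨κ', h2, h3⟩ := hc.own _ _ _ h1
      exact ⟨κ', Finset.mem_insert_of_mem h2, h3⟩
  · intro r' v s1 v' s2 hj hj'
    rcases Finset.mem_insert.1 hj with h1 | h1 <;> rcases Finset.mem_insert.1 hj' with h2 | h2
    · cases h1; cases h2; exact ⟨rfl, rfl⟩
    · cases h1; exact (hrJ _ _ h2).elim
    · cases h2; exact (hrJ _ _ h1).elim
    · exact hc.inj_r _ _ _ _ _ h1 h2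
  · intro r1 r2 v s1 hj hj'
    rcases Finset.mem_insert.1 hj with h1 | h1 <;> rcases Finset.mem_insert.1 hj' with h2 | h2
    · cases h1; cases h2; rfl
    · cases h1; exact (hxJ _ h2).elim
    · cases h2; exact (hxJ _ h1).elim
    · exact hc.inj_v _ _ _ _ h1 h2
  · intro r1 v1 s1 r2 v2 s2 hj hj' he
    rcases Finset.mem_insert.1 hj with h1 | h1 <;> rcases Finset.mem_insert.1 hj' with h2 | h2
    · cases h1; cases h2; rfl
    · cases h1; exact (hc.colf _ _ _ h2 (he.symm.trans hf)).elim
    · cases h2; exact (hc.colf _ _ _ h1 (he.trans hf)).elim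
    · exact hc.col_inj _ _ _ _ _ _ h1 h2 he
  · intro r1 v1 s1 hj
    rcases Finset.mem_insert.1 hj with h1 | h1
    · cases h1
      rw [hf]
      rcases hc.fm with h2 | h2
      · exact Or.inl (Finset.mem_insert_of_mem h2)
      · exact Or.inr h2
    · rcases hc.colm _ _ _ h1 with h2 | h2
      · exact Or.inl (Finset.mem_insert_of_mem h2)
      · exact Or.inr h2
  · intro r1 v1 s1 hj
    have key : ∀ z, z ∈ C ∨ z = m → z ≠ κ := by
      rintro z (h2 | h2) rfl
      · exact hκ h2
      · subst h2; exact hc.m_new hκc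
    rcases Finset.mem_insert.1 hj with h1 | h1
    · cases h1; rw [hf]; exact key _ hc.fm
    · exact key _ (hc.colm _ _ _ h1)

theorem Fam.chain (hF : Fam col h T L tw k c cs R E) (hf : f ∈ E ∨ f ∉ T.cols col) :
    ∃ J C m, Chain col h T L k cs R E f J C m := by
  rcases hf with h1 | h1
  · exact hF.ch f h1
  · exact ⟨∅, ∅, f, empty_chain h1⟩

theorem ex_R0 (hp : PM col h B Q T L rk) (hs : Sel col h T L tw k c cs) {x} (hx : x ∉ ex col h T L tw k c cs) :
    x ∉ R0 tw k c cs := by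
  intro h1
  apply hx
  simp only [ex, Finset.mem_filter, Finset.mem_univ, true_and]
  rcases R0_cases hp hs h1 with ⟨s, h1, h2, h3, h4⟩ | ⟨s, h1', y, h2, h3, h4⟩ | ⟨i, h1, h2, h3⟩
  · exact Or.inl ⟨s, h1, Or.inr h3⟩
  · exact Or.inr (Or.inr (Or.inl ⟨y, R0_a hp hs h1 h4, h4⟩))
  · exact Or.inr (Or.inl ⟨i, h1, h2⟩)

theorem Chain.f_or (hc : Chain col h T L k cs R E f J C m) : f ∈ C ∨ f ∉ T.cols col := by
  rcases hc.fm with h1 | h1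
  · exact Or.inl h1
  · right; rw [h1]; exact hc.m_new

theorem in_step (hp : PM col h B Q T L rk) (hs : Sel col h T L tw k c cs) (hF : Fam col h T L tw k c cs R E)
    {r x : Fin n} (hr : r ∈ R0 tw k c cs) (hrR : r ∉ R) (hx : x ∉ ex col h T L tw k c cs)
    (hf : col r x ∈ E ∨ col r x ∉ T.cols col) :
    ∃ κ, T.a col x = some κ ∧ (κ ∈ E ∨ New col h T L tw k c cs (insert r R) E κ) := by
  obtain ⟨J, C, m, hc⟩ := hF.chain hf
  have hxR := ex_R0 hp hs hx
  have h4 := C4_true hc.c4 r x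
  simp only [ex, Finset.mem_filter, Finset.mem_univ, true_and, not_or] at hx
  obtain ⟨x1, x2, x3, x4⟩ := hx
  cases ha : T.a col x with
  | none =>
    exfalso
    refine gain hp hs hF sg_SX hc (s := true) hr hrR ?_ (fun _ => hxR) ?_ ?_ hc.colf hc.f_or h4
    · intro r' hj
      obtain ⟨κ, _, h2⟩ := hc.own _ _ _ hj
      rw [T.own_true, ha] at h2; cases h2
    · intro κ hκ
      rw [T.own_true, ha] at hκ; cases hκ
    · intro _ _ ℓ hℓ hn
      have : ℓ < tw := by
        by_contra h1; simp [sg, h1] at hn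
      constructor
      · intro h1; exact x1 ⟨ℓ, this, Or.inl h1⟩
      · intro h1; exact x1 ⟨ℓ, this, Or.inr h1⟩
  | some κ =>
    refine ⟨κ, rfl, ?_⟩
    by_cases hκE : κ ∈ E
    · exact Or.inl hκE
    right
    have hκC : κ ∉ C := fun h1 => hκE (hc.CE h1)
    have hxJ : ∀ r', (r', x, true) ∉ J := by
      intro r' hj
      obtain ⟨κ', h1, h2⟩ := hc.own _ _ _ hj
      rw [T.own_true, ha] at h2; cases h2; exact hκC h1
    have hκc : κ ∈ T.cols col := T.mem_cols.2 ⟨x, ha⟩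
    have hY : ∀ ℓ, tw ≤ ℓ → ℓ < h → κ ∉ (L ℓ).Y := by
      intro ℓ h1 h2 h3
      refine gain hp hs hF (upd_SX h1 h3) hc (s := true) hr hrR hxJ (fun _ => hxR) ?_ ?_ hc.colf hc.f_or h4
      · intro κ' hκ'
        rw [T.own_true, ha] at hκ'; cases hκ'
        exact Or.inr ⟨ℓ, h2, by simp⟩
      · intro _ h5; rw [ha] at h5; cases h5
    have hK : κ ∉ Kd col h T L (sg col T tw c) := fun h1 => x3 ⟨κ, h1, ha⟩
    refine ⟨hκc, hY, hK, ?_, ⟨_, _, m, hc.ext hrR hF.Ec hκc rfl (s := true) ha hκC h4⟩⟩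
    intro x' hx' ℓ h1 h2 h3
    have := hp.mx.rb x' x κ hx' ha
    subst this
    have hl := ext_loose hp hs hF sg_SX hc (C' := insert κ C) (Finset.subset_insert _ _)
      (Finset.insert_subset hκc (hc.CE.trans hF.Ec)) (by
        intro κ' hκ'
        rcases Finset.mem_insert.1 hκ' with rfl | h5
        · exact hK
        · exact hF.EK _ (hc.CE h5)) (s := true) hr hrR hxJ (fun _ => hxR) (by
        intro κ' hκ'
        rw [T.own_true, ha] at hκ'; cases hκ'
        exact Or.inl (Finset.mem_insert_self _ _)) (by
        intro _ h5; rw [ha] at h5; cases h5) hc.colf (by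
        rcases hc.f_or with h5 | h5
        · exact Or.inl (Finset.mem_insert_of_mem h5)
        · exact Or.inr h5)
    obtain ⟨T', hT', hM', hc', hsub, -⟩ := commit_total hp hs hl (by
      rw [Finset.card_insert_of_notMem (hxJ r), Finset.card_insert_of_notMem hκC, hc.card]) h4 (by
        intro κ' hκ'
        rcases Finset.mem_insert.1 hκ' with rfl | h5
        · exact hY
        · exact hF.EY _ (hc.CE h5)) (by
        intro r' v s' hj
        rcases Finset.mem_insert.1 hj with h5 | h5
        · cases h5; exact hr
        · exact hF.RR (hc.rR _ _ _ h5)) (by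
        intro r' v hj
        rcases Finset.mem_insert.1 hj with h5 | h5
        · cases h5; rw [ha]; simp
        · obtain ⟨κ', g1, g2⟩ := hc.own _ _ _ h5
          rw [T.own_true] at g2; rw [g2]; simp)
    refine hp.no_improve hM' hc' h1 h2 ?_ ?_
    · obtain ⟨g1, g2⟩ := hsub ℓ h1 h2
      have g3 : (Finset.univ.filter fun x => T'.root x ∈ (L ℓ).letters) ⊂ (Finset.univ.filter fun x => T.root x ∈ (L ℓ).letters) := by
        refine Finset.ssubset_iff_subset_ne.2 ⟨g1, fun he => ?_⟩
        have : x' ∈ (Finset.univ.filter fun x => T'.root x ∈ (L ℓ).letters) := by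
          rw [he]; simpa using h3
        exact g2 x' (by simpa using this) κ ha (Finset.mem_insert_self _ _)
      have g4 := Finset.card_lt_card g3
      have g5 : (Finset.univ.filter fun x => T.root x ∈ (L ℓ).letters).card ≤ n := by
        have := Finset.card_le_univ (Finset.univ.filter fun x => T.root x ∈ (L ℓ).letters)
        simpa using this
      unfold pl; omega
    · intro ℓ' g1 g2
      have g3 := Finset.card_le_card (hsub ℓ' (by omega) g2).1
      unfold pl; omega

theorem out_step (hp : PM col h B Q T L rk) (hs : Sel col h T L tw (tw + 1) c cs)
    (hF : Fam col h T L tw (tw + 1) c cs R E) {p : Fin n} (hrR : cs tw ∉ R) (hx : p ∉ ex col h T L tw (tw + 1) c cs)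
    (hc : Chain col h T L (tw + 1) cs R E (col (cs tw) p) J C m)
    (h1 : ∀ ℓ, tw ≤ ℓ → ℓ < h → T.root p ∉ (L ℓ).letters) (h2 : T.root p ≠ cs tw)
    (h3 : ∀ r' v, (r', v, false) ∈ J → T.root v ≠ cs tw) (hC : ∀ κ ∈ C, T.own col p false ≠ some κ) :
    ∃ κ, T.own col p false = some κ ∧ New col h T L tw (tw + 1) c cs (insert (cs tw) R) E κ ∧
      ∃ J C m, Chain col h T L (tw + 1) cs (insert (cs tw) R) (insert κ E) κ J C m ∧
        ∀ z, T.a col z = some κ → ∀ r', (r', z, true) ∉ J := by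
  have h4 := C4_false hc.c4 h1 h2 h3
  have hr : cs tw ∈ R0 tw (tw + 1) c cs := mem_R0.2 (Or.inr ⟨tw, by omega, rfl⟩)
  simp only [ex, Finset.mem_filter, Finset.mem_univ, true_and, not_or] at hx
  obtain ⟨x1, x2, x3, x4⟩ := hx
  have hxJ : ∀ r', (r', p, false) ∉ J := by
    intro r' hj
    obtain ⟨κ', g1, g2⟩ := hc.own _ _ _ hj
    exact hC κ' g1 g2
  cases ha : T.own col p false with
  | none =>
    exfalso
    refine gain hp hs hF sg_SX hc (s := false) hr hrR hxJ (by simp) ?_ (by simp) hc.colf hc.f_or h4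
    · intro κ hκ
      rw [ha] at hκ; cases hκ
  | some κ =>
    have hκC : κ ∉ C := fun g1 => hC κ g1 ha
    obtain ⟨z, hz, hzc⟩ := T.own_false.1 ha
    have haz : T.a col z = some κ := T.a_eq.2 ⟨p, hz, hzc⟩
    have hκc : κ ∈ T.cols col := T.mem_cols.2 ⟨z, haz⟩
    have hch := hc.ext hrR hF.Ec hκc rfl (s := false) ha hκC h4
    refine ⟨κ, rfl, ⟨hκc, ?_, fun g1 => x4 ⟨κ, g1, ha⟩, ?_, ⟨_, _, m, hch⟩⟩, ⟨_, _, m, hch, ?_⟩⟩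
    · intro ℓ g1 g2 g3
      refine gain hp hs hF (upd_SX g1 g3) hc (s := false) hr hrR hxJ (by simp) ?_ (by simp) hc.colf hc.f_or h4
      intro κ' hκ'
      rw [ha] at hκ'; cases hκ'
      exact Or.inr ⟨ℓ, g2, by simp⟩
    · intro x hx
      have := hp.mx.rb x z κ hx haz
      subst this
      rw [T.root_pred hz]; exact h1
    · intro z' hz' r' hj
      rcases Finset.mem_insert.1 hj with g1 | g1
      · cases g1
      · obtain ⟨κ', g2, g3⟩ := hc.own _ _ _ g1
        rw [T.own_true, hz'] at g3; cases g3; exact hκC g2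

end
end HC

namespace HC
open scoped Classical
variable {n : ℕ}

def Lab (col : Fin n → Fin n → ℕ) (T : DF n) (L : Lst n) (c : Fin n) : Prop :=
  c ∈ L.bases ∨ ∃ y ∈ L.Y, T.a col c = some y

noncomputable def wordOf (L : Lst n) : Option ℕ → Finset (Fin n × Fin n × Option ℕ)
  | none => ∅
  | some y => L.W y

/-- the list extended by a new letter -/
noncomputable def newL (col : Fin n → Fin n → ℕ) (T : DF n) (L : Lst n) (z : Fin n) (G : Finset (Fin n)) : Lst n where
  letters := insert z L.letters
  bases := L.bases
  Y := L.Y ∪ G.image (fun c => col c z)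
  W := fun y => if y ∈ L.Y then L.W y else
    (G.filter fun c => col c z = y).biUnion fun c => insert (z, c, T.a col c) (wordOf L (T.a col c))

section
variable {col : Fin n → Fin n → ℕ} {h B Q : ℕ} {T T' : DF n} {L : ℕ → Lst n} {rk : Fin n → ℕ} {tw k : ℕ}
  {c cs : ℕ → Fin n} {σ : ℕ → Option ℕ} {J : Finset (Fin n × Fin n × Bool)} {C : Finset ℕ}
  {R R' : Finset (Fin n)} {E E' : Finset ℕ} {f m : ℕ} {z : Fin n} {G : Finset (Fin n)}

theorem newW_old {L : Lst n} {y} (hy : y ∈ L.Y) : (newL col T L z G).W y = L.W y := by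
  simp [newL, hy]

theorem newW_new {L : Lst n} {cc} (hprop : ∀ c ∈ G, ∀ c' ∈ G, col c z = col c' z → c = c') (hG : cc ∈ G) (hy : col cc z ∉ L.Y) :
    (newL col T L z G).W (col cc z) = insert (z, cc, T.a col cc) (wordOf L (T.a col cc)) := by
  have : (G.filter fun c => col c z = col cc z) = {cc} := by
    ext c
    simp only [Finset.mem_filter, Finset.mem_singleton]
    constructor
    · rintro ⟨h1, h2⟩; exact hprop _ h1 _ hG h2
    · rintro rfl; exact ⟨hG, rfl⟩
  simp [newL, hy, this]

theorem newL_ok (hsym : ∀ u v, col u v = col v u) {L : Lst n} (hL : LOK col T' L)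
    (hprop : ∀ c ∈ G, ∀ c' ∈ G, col c z = col c' z → c = c')
    (hlab : ∀ c ∈ G, Lab col T L c) (hb : ∀ b ∈ L.bases, T.a col b = none)
    (hz : T'.pred z = none) (hzl : z ∉ L.letters)
    (hGc : ∀ c ∈ G, col c z ∈ T'.cols col) (hGY : ∀ c ∈ G, col c z ∉ L.Y)
    (hcard : 2 + L.Y.card ≤ 4 * G.card)
    (hor : ∀ c ∈ G, ∀ y, T.a col c = some y → T'.a col c = some y ∨ T'.own col c false = some y) :
    LOK col T' (newL col T L z G) := by
  have hlab' : ∀ c ∈ G, ∀ y, T.a col c = some y → y ∈ L.Y := by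
    intro c hc y hy
    rcases hlab c hc with h1 | ⟨y', h1, h2⟩
    · rw [hb c h1] at hy; cases hy
    · rw [h2] at hy; cases hy; exact h1
  have hY : ∀ y ∈ (newL col T L z G).Y, (y ∈ L.Y ∧ (newL col T L z G).W y = L.W y) ∨
      (∃ c ∈ G, col c z = y ∧ y ∉ L.Y ∧ (newL col T L z G).W y = insert (z, c, T.a col c) (wordOf L (T.a col c))) := by
    intro y hy
    by_cases h1 : y ∈ L.Y
    · exact Or.inl ⟨h1, newW_old h1⟩
    · rcases Finset.mem_union.1 hy with h2 | h2
      · exact (h1 h2).elim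
      · obtain ⟨c, hc, rfl⟩ := Finset.mem_image.1 h2
        exact Or.inr ⟨c, hc, rfl, h1, newW_new hprop hc h1⟩
  have hw : ∀ c ∈ G, ∀ j, j ∈ wordOf L (T.a col c) → ∃ y ∈ L.Y, T.a col c = some y ∧ j ∈ L.W y := by
    intro c hc j hj
    cases ha : T.a col c with
    | none => rw [ha] at hj; simp [wordOf] at hj
    | some y => rw [ha] at hj; exact ⟨y, hlab' c hc y ha, rfl, hj⟩
  -- membership in any word
  have key : ∀ y ∈ (newL col T L z G).Y, ∀ b d s, (b, d, s) ∈ (newL col T L z G).W y →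
      (∃ y' ∈ L.Y, (b, d, s) ∈ L.W y' ∧ (y' = y ∨ y ∉ L.Y) ∧ ∀ j ∈ L.W y', j ∈ (newL col T L z G).W y) ∨
      (b = z ∧ d ∈ G ∧ s = T.a col d ∧ col d z = y ∧ y ∉ L.Y) := by
    intro y hy b d s hj
    rcases hY y hy with ⟨h1, h2⟩ | ⟨c, hc, h1, h2, h3⟩
    · left; exact ⟨y, h1, by rwa [h2] at hj, Or.inl rfl, fun j hj => by rwa [h2]⟩
    · rw [h3] at hj
      rcases Finset.mem_insert.1 hj with h4 | h4
      · cases h4; exact Or.inr ⟨rfl, hc, rfl, h1, h2⟩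
      · obtain ⟨y', h5, h6, h7⟩ := hw c hc _ h4
        left; refine ⟨y', h5, h7, Or.inr h2, ?_⟩
        intro j hj; rw [h3, h6]; exact Finset.mem_insert_of_mem hj
  -- two members
  have key2 : ∀ y ∈ (newL col T L z G).Y, ∀ b d s b' d' s', (b, d, s) ∈ (newL col T L z G).W y →
      (b', d', s') ∈ (newL col T L z G).W y →
      (∃ y' ∈ L.Y, (b, d, s) ∈ L.W y' ∧ (b', d', s') ∈ L.W y') ∨ (b = b' ∧ d = d' ∧ s = s') ∨
      (b = z ∧ col b d ∉ L.Y ∧ (b', d', s') ∈ wordOf L s ∧ d ∈ G ∧ s = T.a col d) ∨ 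
      (b' = z ∧ col b' d' ∉ L.Y ∧ (b, d, s) ∈ wordOf L s' ∧ d' ∈ G ∧ s' = T.a col d') := by
    intro y hy b d s b' d' s' hj hj'
    rcases hY y hy with ⟨h1, h2⟩ | ⟨c, hc, h1, h2, h3⟩
    · left; rw [h2] at hj hj'; exact ⟨y, h1, hj, hj'⟩
    · rw [h3] at hj hj'
      rcases Finset.mem_insert.1 hj with h4 | h4 <;> rcases Finset.mem_insert.1 hj' with h5 | h5
      · cases h4; cases h5; exact Or.inr (Or.inl ⟨rfl, rfl, rfl⟩)
      · cases h4; refine Or.inr (Or.inr (Or.inl ⟨rfl, ?_, h5, hc, rfl⟩)); rw [hsym, h1]; exact h2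
      · cases h5; refine Or.inr (Or.inr (Or.inr ⟨rfl, ?_, h4, hc, rfl⟩)); rw [hsym, h1]; exact h2
      · left
        obtain ⟨y', g1, g2, g3⟩ := hw c hc _ h4
        obtain ⟨y'', g4, g5, g6⟩ := hw c hc _ h5
        rw [g2] at g5; cases g5
        exact ⟨y', g1, g3, g6⟩
  refine ⟨?_, hL.bases_start, hL.bases_card, ?_, ?_, ?_, ?_, ?_, ?_, ?_, ?_, ?_, ?_⟩
  · intro b hb
    rcases Finset.mem_insert.1 hb with rfl | h1
    · exact hz
    · exact hL.letters_start b h1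
  · intro y hy
    rcases Finset.mem_union.1 hy with h2 | h2
    · exact hL.Ysub h2
    · obtain ⟨c, hc, rfl⟩ := Finset.mem_image.1 h2
      exact hGc c hc
  · have e1 : (newL col T L z G).letters.card = L.letters.card + 1 := Finset.card_insert_of_notMem hzl
    have e2 : (newL col T L z G).Y.card = L.Y.card + G.card := by
      show (L.Y ∪ G.image (fun c => col c z)).card = _
      rw [Finset.card_union_of_disjoint, Finset.card_image_of_injOn]
      · intro c hc c' hc' he; exact hprop c hc c' hc' he
      · rw [Finset.disjoint_left]
        intro y h1 h2
        obtain ⟨c, hc, rfl⟩ := Finset.mem_image.1 h2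
        exact hGY c hc h1
    rw [e1, e2, pow_succ, pow_succ]
    have g := hL.grow
    calc 2 * (5 ^ L.letters.card * 5) = 5 * (2 * 5 ^ L.letters.card) := by ring
      _ ≤ 5 * (4 ^ L.letters.card * (2 + L.Y.card)) := Nat.mul_le_mul_left _ g
      _ = 4 ^ L.letters.card * (5 * (2 + L.Y.card)) := by ring
      _ ≤ 4 ^ L.letters.card * (4 * (2 + (L.Y.card + G.card))) := Nat.mul_le_mul_left _ (by omega)
      _ = _ := by ring
  · intro y hy b d s hj
    rcases key y hy _ _ _ hj with ⟨y', h1, h2, _⟩ | ⟨rfl, _⟩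
    · exact Finset.mem_insert_of_mem (hL.w_let y' h1 _ _ _ h2)
    · exact Finset.mem_insert_self _ _
  · intro y hy b d s d' s' hj hj'
    rcases key2 y hy _ _ _ _ _ _ hj hj' with ⟨y', h1, h2, h3⟩ | h1 | ⟨rfl, h1, h2, h3, h4⟩ | ⟨rfl, h1, h2, h3, h4⟩
    · exact hL.w_fst y' h1 _ _ _ _ _ h2 h3
    · exact h1.2
    · subst h4
      obtain ⟨y', g1, g2, g3⟩ := hw _ h3 _ h2
      exact (hzl (hL.w_let y' g1 _ _ _ g3)).elim
    · subst h4
      obtain ⟨y', g1, g2, g3⟩ := hw _ h3 _ h2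
      exact (hzl (hL.w_let y' g1 _ _ _ g3)).elim
  · intro y hy b d s b' d' hj hj'
    have aux : ∀ b d d', d' ∈ G → (b, d, T.a col d') ∈ wordOf L (T.a col d') → False := by
      intro b d d' h3 h2
      obtain ⟨y', g1, g2, g3⟩ := hw _ h3 _ h2
      rw [g2] at g3
      exact (hL.w_some y' g1 _ _ _ g3).2.1 rfl
    rcases key2 y hy _ _ _ _ _ _ hj hj' with ⟨y', h1, h2, h3⟩ | h1 | ⟨rfl, h1, h2, h3, h4⟩ | ⟨rfl, h1, h2, h3, h4⟩
    · exact hL.w_src y' h1 _ _ _ _ _ h2 h3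
    · exact h1.1
    · subst h4; exact (aux _ _ _ h3 h2).elim
    · subst h4; exact (aux _ _ _ h3 h2).elim
  · intro y hy b d s b' d' s' hj hj' he
    rcases key2 y hy _ _ _ _ _ _ hj hj' with ⟨y', h1, h2, h3⟩ | h1 | ⟨rfl, h1, h2, h3, h4⟩ | ⟨rfl, h1, h2, h3, h4⟩
    · exact hL.w_col y' h1 _ _ _ _ _ _ h2 h3 he
    · exact h1.1
    · subst h4
      obtain ⟨y', g1, g2, g3⟩ := hw _ h3 _ h2
      rw [he] at h1
      exact (h1 (hL.w_K y' g1 _ _ _ g3)).elim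
    · subst h4
      obtain ⟨y', g1, g2, g3⟩ := hw _ h3 _ h2
      rw [← he] at h1
      exact (h1 (hL.w_K y' g1 _ _ _ g3)).elim
  · intro y hy b d s hj
    rcases key y hy _ _ _ hj with ⟨y', h1, h2, _⟩ | ⟨rfl, h1, h2, h3, h4⟩
    · exact Finset.mem_union_left _ (hL.w_K y' h1 _ _ _ h2)
    · rw [hsym, h3]; exact hy
  · intro y hy
    rcases hY y hy with ⟨h1, h2⟩ | ⟨c, hc, h1, h2, h3⟩
    · rw [h2]; exact hL.w_y y h1
    · exact ⟨z, c, _, by rw [h3]; exact Finset.mem_insert_self _ _, by rw [hsym]; exact h1⟩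
  · intro y hy b d κ hj
    rcases key y hy _ _ _ hj with ⟨y', h1, h2, h3, h4⟩ | ⟨rfl, h1, h2, h3, h4⟩
    · obtain ⟨⟨b', d', s', e1, e2⟩, e3, e4⟩ := hL.w_some y' h1 _ _ _ h2
      refine ⟨⟨b', d', s', h4 _ e1, e2⟩, ?_, e4⟩
      rcases h3 with rfl | h3
      · exact e3
      · rintro rfl
        apply h3
        rw [← e2]
        exact hL.w_K y' h1 _ _ _ e1
    · have hκ := hlab' d h1 κ h2.symm
      refine ⟨?_, ?_, hor d h1 κ h2.symm⟩
      · obtain ⟨b', d', s', e1, e2⟩ := hL.w_y κ hκ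
        refine ⟨b', d', s', ?_, e2⟩
        rw [← h3, newW_new hprop h1 (hGY d h1), ← h2]
        exact Finset.mem_insert_of_mem e1
      · rintro rfl; exact h4 hκ
  · intro y hy b d hj
    rcases key y hy _ _ _ hj with ⟨y', h1, h2, h3, h4⟩ | ⟨rfl, h1, h2, h3, h4⟩
    · exact hL.w_none y' h1 _ _ h2
    · rcases hlab d h1 with g | ⟨y', g1, g2⟩
      · exact g
      · rw [g2] at h2; cases h2

theorem newL_cfg (hsym : ∀ u v, col u v = col v u) (hrb : T'.Rb col) {t : ℕ} (hth : t < h) (hc : Cfg col h B T' t L rk)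
    (hq : ∀ ℓ, t ≤ ℓ → ℓ < h → (L ℓ).letters.card < B)
    (hprop : ∀ c ∈ G, ∀ c' ∈ G, col c z = col c' z → c = c')
    (hlab : ∀ c ∈ G, Lab col T (L t) c) (hb : ∀ b ∈ (L t).bases, T.a col b = none)
    (hz : T'.pred z = none) (hzl : ∀ ℓ, t ≤ ℓ → ℓ < h → z ∉ (L ℓ).letters ∧ z ∉ (L ℓ).bases)
    (hGc : ∀ c ∈ G, col c z ∈ T'.cols col) (hGY : ∀ c ∈ G, ∀ ℓ, t ≤ ℓ → ℓ < h → col c z ∉ (L ℓ).Y)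
    (hcard : 2 + (L t).Y.card ≤ 4 * G.card)
    (hor : ∀ c ∈ G, ∀ y, T.a col c = some y → T'.a col c = some y ∨ T'.own col c false = some y)
    (harm : ∀ c ∈ G, ∀ y, T.a col c = some y → (T'.root c = z ∨ ∃ ℓ, t ≤ ℓ ∧ ℓ < h ∧ T'.root c ∈ (L ℓ).letters) →
      T'.a col c = some y) :
    Cfg col h B T' t (Function.update L t (newL col T (L t) z G)) 
      (Function.update rk z ((t + 2) * B - ((L t).letters.card + 1))) := by
  set L' := Function.update L t (newL col T (L t) z G) with hL'
  set rk' := Function.update rk z ((t + 2) * B - ((L t).letters.card + 1)) with hrk'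
  have e0 : L' t = newL col T (L t) z G := by simp [hL']
  have e1 : ∀ ℓ, ℓ ≠ t → L' ℓ = L ℓ := by intro ℓ hℓ; rw [hL', Function.update_of_ne hℓ]
  have el : ∀ ℓ b, b ∈ (L' ℓ).letters → b ∈ (L ℓ).letters ∨ (b = z ∧ ℓ = t) := by
    intro ℓ b hb
    by_cases h1 : ℓ = t
    · subst h1; rw [e0] at hb
      rcases Finset.mem_insert.1 hb with h2 | h2
      · exact Or.inr ⟨h2, rfl⟩
      · exact Or.inl h2
    · rw [e1 ℓ h1] at hb; exact Or.inl hb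
  have eb : ∀ ℓ, (L' ℓ).bases = (L ℓ).bases := by
    intro ℓ
    by_cases h1 : ℓ = t
    · subst h1; rw [e0]; rfl
    · rw [e1 ℓ h1]
  have eY : ∀ ℓ y, y ∈ (L' ℓ).Y → y ∈ (L ℓ).Y ∨ (ℓ = t ∧ ∃ c ∈ G, col c z = y) := by
    intro ℓ b hb
    by_cases h1 : ℓ = t
    · subst h1; rw [e0] at hb
      rcases Finset.mem_union.1 hb with h2 | h2
      · exact Or.inl h2
      · obtain ⟨c, hc, h3⟩ := Finset.mem_image.1 h2
        exact Or.inr ⟨rfl, c, hc, h3⟩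
    · rw [e1 ℓ h1] at hb; exact Or.inl hb
  have rz : rk' z = (t + 2) * B - ((L t).letters.card + 1) := by simp [hrk']
  have rn : ∀ ℓ, t ≤ ℓ → ℓ < h → ∀ b ∈ (L ℓ).letters, rk' b = rk b := by
    intro ℓ h1 h2 b hb
    rw [hrk', Function.update_of_ne]
    rintro rfl; exact (hzl ℓ h1 h2).1 hb
  have hB : (L t).letters.card < B := hq t le_rfl hth
  have rlt : ∀ ℓ, t ≤ ℓ → ℓ < h → ∀ b ∈ (L ℓ).letters, rk' z < rk b := by
    intro ℓ h1 h2 b hb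
    have g1 := hc.rk_lo ℓ h1 h2 b hb
    have g2 := hq ℓ h1 h2
    rw [rz]
    by_cases h3 : ℓ = t
    · subst h3
      have : (ℓ + 2) * B = ℓ * B + 2 * B := by ring
      omega
    · have g3 : (t + 3) * B ≤ (ℓ + 2) * B := Nat.mul_le_mul_right _ (by omega)
      have : (t + 3) * B = (t + 2) * B + B := by ring
      omega
  constructor
  · intro ℓ h1 h2
    by_cases h3 : ℓ = t
    · subst h3; rw [e0]
      exact newL_ok hsym (hc.ok ℓ h1 h2) hprop hlab hb hz (hzl ℓ h1 h2).1 hGc (fun c hc => hGY c hc ℓ h1 h2) hcard hor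
    · rw [e1 ℓ h3]; exact hc.ok ℓ h1 h2
  · intro ℓ ℓ' h1 h2 h3 h4 b hb
    rw [eb]
    rcases el _ _ hb with h5 | ⟨rfl, _⟩
    · exact hc.lb ℓ ℓ' h1 h2 h3 h4 b h5
    · exact (hzl ℓ' h3 h4).2
  · intro ℓ ℓ' h1 h2 h3 h4 b hb hb'
    rcases el _ _ hb with h5 | ⟨h5, h7⟩ <;> rcases el _ _ hb' with h6 | ⟨h6, h8⟩
    · exact hc.ll ℓ ℓ' h1 h2 h3 h4 b h5 h6
    · subst h6; exact ((hzl ℓ h1 h2).1 h5).elim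
    · subst h5; exact ((hzl ℓ' h3 h4).1 h6).elim
    · omega
  · intro ℓ ℓ' h1 h2 h3 h4 b hb hb'
    rw [eb] at hb hb'
    exact hc.bb ℓ ℓ' h1 h2 h3 h4 b hb hb'
  · intro ℓ ℓ' h1 h2 h3 h4 b hb hb'
    rcases eY _ _ hb with h5 | ⟨h5, cc, h7, h9⟩ <;> rcases eY _ _ hb' with h6 | ⟨h6, cc', h8, h10⟩
    · exact hc.yy ℓ ℓ' h1 h2 h3 h4 b h5 h6
    · subst h10; exact (hGY cc' h8 ℓ h1 h2 h5).elim
    · subst h9; exact (hGY cc h7 ℓ' h3 h4 h6).elim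
    · omega
  · intro ℓ h1 h2 b hb
    have hcc : ℓ = t → (L' ℓ).letters.card = (L ℓ).letters.card + 1 := by
      rintro rfl; rw [e0]; exact Finset.card_insert_of_notMem (hzl ℓ h1 h2).1
    rcases el _ _ hb with h5 | ⟨rfl, h5⟩
    · rw [rn ℓ h1 h2 b h5]
      have := hc.rk_lo ℓ h1 h2 b h5
      by_cases h3 : ℓ = t
      · have := hcc h3; omega
      · rw [e1 ℓ h3]; exact this
    · have := hcc h5
      subst h5
      rw [rz]; omega
  · intro ℓ h1 h2 b hb
    rcases el _ _ hb with h5 | ⟨rfl, h5⟩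
    · rw [rn ℓ h1 h2 b h5]; exact hc.rk_hi ℓ h1 h2 b h5
    · subst h5; rw [rz]
      have : (ℓ + 2) * B = ℓ * B + 2 * B := by ring
      omega
  · intro ℓ ℓ' h1 h2 h3 h4 y hy b d κ hw ho hr
    -- old word
    have old : ∀ y' ∈ (L ℓ).Y, (b, d, some κ) ∈ (L ℓ).W y' → rk' (T'.root d) < rk' b := by
      intro y' hy' hw'
      have hb := (hc.ok ℓ h1 h2).w_let y' hy' _ _ _ hw'
      rw [rn ℓ h1 h2 b hb]
      rcases el _ _ hr with h5 | ⟨h5, _⟩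
      · rw [rn ℓ' h3 h4 _ h5]
        exact hc.L4 ℓ ℓ' h1 h2 h3 h4 y' hy' b d κ hw' ho h5
      · rw [h5]; exact rlt ℓ h1 h2 b hb
    by_cases h5 : ℓ = t
    · subst h5
      rw [e0] at hw hy
      by_cases h6 : y ∈ (L ℓ).Y
      · rw [newW_old h6] at hw; exact old y h6 hw
      · rcases Finset.mem_union.1 hy with h7 | h7
        · exact (h6 h7).elim
        · obtain ⟨cc, hcc, rfl⟩ := Finset.mem_image.1 h7
          rw [newW_new hprop hcc h6] at hw
          rcases Finset.mem_insert.1 hw with h8 | h8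
          · exfalso
            obtain ⟨rfl, rfl, h9⟩ : b = z ∧ d = cc ∧ some κ = T.a col cc := by
              simpa using h8
            have h10 := harm d hcc κ h9.symm (by
              rcases el _ _ hr with h5 | ⟨h5, _⟩
              · exact Or.inr ⟨ℓ', h3, h4, h5⟩
              · exact Or.inl h5)
            obtain ⟨x, hx, hxc⟩ := T'.own_false.1 ho
            have := hrb x d κ (T'.a_eq.2 ⟨d, hx, hxc⟩) h10
            subst this
            exact lt_irrefl _ (T'.lt _ _ hx)
          · cases ha : T.a col cc with
            | none => rw [ha] at h8; simp [wordOf] at h8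
            | some y' =>
              rw [ha] at h8
              refine old y' ?_ h8
              rcases hlab cc hcc with g1 | ⟨y'', g1, g2⟩
              · rw [hb cc g1] at ha; cases ha
              · rw [g2] at ha; cases ha; exact g1
    · rw [e1 ℓ h5] at hw hy
      exact old y hy hw

end
end HC

namespace HC
open scoped Classical
variable {n : ℕ}

section
variable {col : Fin n → Fin n → ℕ} {h B Q : ℕ} {T T' : DF n} {L : ℕ → Lst n} {rk : Fin n → ℕ} {tw k : ℕ}
  {c cs : ℕ → Fin n} {σ : ℕ → Option ℕ} {J : Finset (Fin n × Fin n × Bool)} {C : Finset ℕ}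
  {R R' : Finset (Fin n)} {E E' : Finset ℕ} {f m : ℕ} {z : Fin n} {G : Finset (Fin n)}

theorem Sel.addcs (hs : Sel col h T L tw tw c cs) {x : Fin n} (h1 : T.pred x = none) (h2 : ∀ i < tw, cs i ≠ x)
    (h3 : ∀ ℓ < h, x ∉ (L ℓ).letters ∧ x ∉ (L ℓ).bases)
    (h4 : ∀ s < tw, ∀ y, T.a col (c s) = some y → ∀ b d κ, (b, d, some κ) ∈ (L s).W y →
      T.own col d false = some κ → T.root d ≠ x) : Sel col h T L tw (tw + 1) c (Function.update cs tw x) := by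
  have e : ∀ i < tw + 1, (i < tw ∧ Function.update cs tw x i = cs i) ∨ (i = tw ∧ Function.update cs tw x i = x) := by
    intro i hi
    by_cases g : i = tw
    · right; exact ⟨g, by subst g; simp⟩
    · left; exact ⟨by omega, by rw [Function.update_of_ne g]⟩
  refine ⟨hs.twh, le_rfl, hs.lab, ?_, ?_, ?_, ?_⟩
  · intro i hi
    rcases e i hi with ⟨g1, g2⟩ | ⟨g1, g2⟩ <;> rw [g2]
    · exact hs.cs_start i g1
    · exact h1
  · intro i hi j hj he
    rcases e i hi with ⟨g1, g2⟩ | ⟨g1, g2⟩ <;> rcases e j hj with ⟨g3, g4⟩ | ⟨g3, g4⟩ <;> rw [g2, g4] at he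
    · exact hs.cs_inj i g1 j g3 he
    · exact (h2 i g1 he).elim
    · exact (h2 j g3 he.symm).elim
    · omega
  · intro i hi ℓ hℓ
    rcases e i hi with ⟨g1, g2⟩ | ⟨g1, g2⟩ <;> rw [g2]
    · exact hs.cs_nl i g1 ℓ hℓ
    · exact h3 ℓ hℓ
  · intro s hs' i hi hsi y hy b d κ hw ho
    rcases e i hi with ⟨g1, g2⟩ | ⟨g1, g2⟩ <;> rw [g2]
    · exact hs.f5 s hs' i g1 hsi y hy b d κ hw ho
    · exact h4 s hs' y hy b d κ hw ho

theorem R0_addcs {x : Fin n} : R0 tw (tw + 1) c (Function.update cs tw x) = insert x (R0 tw tw c cs) := by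
  ext r
  rw [Finset.mem_insert, mem_R0, mem_R0]
  constructor
  · rintro (h1 | ⟨i, hi, rfl⟩)
    · exact Or.inr (Or.inl h1)
    · by_cases g : i = tw
      · left; subst g; simp
      · right; right; exact ⟨i, by omega, by rw [Function.update_of_ne g]⟩
  · rintro (rfl | h1 | ⟨i, hi, rfl⟩)
    · right; exact ⟨tw, by omega, by simp⟩
    · exact Or.inl h1
    · right; exact ⟨i, by omega, by rw [Function.update_of_ne (by omega)]⟩

theorem C4.addcs (h4 : C4 h T L tw cs J) {x : Fin n} (hx : ∀ v s, (x, v, s) ∉ J) :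
    C4 h T L (tw + 1) (Function.update cs tw x) J := by
  intro r v hj
  obtain ⟨i, hi, h1, h2, h3⟩ := h4 r v hj
  refine ⟨i, by omega, by rw [Function.update_of_ne (by omega)]; exact h1, h2, ?_⟩
  rintro j hj he ⟨p, hp⟩
  by_cases g : j = tw
  · subst g; simp at hp; exact (hx _ _ hp).elim
  · rw [Function.update_of_ne g] at he hp
    exact h3 j (by omega) he ⟨p, hp⟩

theorem Chain.addcs (hc : Chain col h T L tw cs R E f J C m) {x : Fin n} (hx : x ∉ R) :
    Chain col h T L (tw + 1) (Function.update cs tw x) R E f J C m :=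
  { hc with c4 := hc.c4.addcs (fun _ _ hj => hx (hc.rR _ _ _ hj)) }

theorem Fam.addcs (hF : Fam col h T L tw tw c cs R E) {x : Fin n} (hx : x ∉ R) :
    Fam col h T L tw (tw + 1) c (Function.update cs tw x) R E := by
  refine ⟨?_, hF.Ec, hF.EY, hF.EK, hF.El, ?_⟩
  · rw [R0_addcs]; exact hF.RR.trans (Finset.subset_insert _ _)
  · intro κ hκ
    obtain ⟨J, C, m, hc⟩ := hF.ch κ hκ
    exact ⟨J, C, m, hc.addcs hx⟩

theorem Sel.addc (hs : Sel col h T L tw (tw + 1) c cs) (htw : tw < h) {cc : Fin n} (hl : Lab col T (L tw) cc) :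
    Sel col h T L (tw + 1) (tw + 1) (Function.update c tw cc) cs := by
  refine ⟨htw, by omega, ?_, hs.cs_start, hs.cs_inj, hs.cs_nl, ?_⟩
  · intro s hs'
    by_cases g : s = tw
    · subst g; rw [Function.update_self]; exact hl
    · rw [Function.update_of_ne g]; exact hs.lab s (by omega)
  · intro s hs' i hi hsi
    rw [Function.update_of_ne (by omega)]
    exact hs.f5 s (by omega) i hi hsi

theorem Kd_addc (hp : PM col h B Q T L rk) (htw : tw < h) {cc : Fin n} (hl : Lab col T (L tw) cc) {κ}
    (hκ : κ ∈ Kd col h T L (sg col T (tw + 1) (Function.update c tw cc))) :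
    κ ∈ Kd col h T L (sg col T tw c) ∨ κ ∈ (L tw).Y := by
  obtain ⟨ℓ, hℓ, y, hy, b, d, src, hw, rfl⟩ := mem_Kd.1 hκ
  by_cases g : ℓ = tw
  · subst g
    right
    simp [sg] at hy
    have hL := hp.cfg.ok ℓ (Nat.zero_le _) hℓ
    refine hL.w_K y ?_ _ _ _ hw
    rcases hl with h1 | ⟨y', h1, h2⟩
    · rw [T.a_none.2 (hL.bases_start _ h1)] at hy; cases hy
    · rw [h2] at hy; cases hy; exact h1
  · left
    refine mem_Kd.2 ⟨ℓ, hℓ, y, ?_, b, d, src, hw, rfl⟩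
    simp only [sg] at hy ⊢
    split_ifs at hy with h1
    rw [Function.update_of_ne g] at hy
    rw [if_pos (by omega), hy]

theorem R0_addc {cc : Fin n} : R0 (tw + 1) k (Function.update c tw cc) cs = insert cc (R0 tw k c cs) := by
  ext r
  rw [Finset.mem_insert, mem_R0, mem_R0]
  constructor
  · rintro (⟨i, hi, rfl⟩ | h1)
    · by_cases g : i = tw
      · left; subst g; simp
      · right; left; exact ⟨i, by omega, by rw [Function.update_of_ne g]⟩
    · exact Or.inr (Or.inr h1)
  · rintro (rfl | ⟨i, hi, rfl⟩ | h1)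
    · left; exact ⟨tw, by omega, by simp⟩
    · left; exact ⟨i, by omega, by rw [Function.update_of_ne (by omega)]⟩
    · exact Or.inr h1

theorem Fam.addc (hp : PM col h B Q T L rk) (hF : Fam col h T L tw (tw + 1) c cs R E) (htw : tw < h) {cc : Fin n}
    (hl : Lab col T (L tw) cc) : Fam col h T L (tw + 1) (tw + 1) (Function.update c tw cc) cs R E := by
  refine ⟨?_, hF.Ec, ?_, ?_, ?_, hF.ch⟩
  · rw [R0_addc]; exact hF.RR.trans (Finset.subset_insert _ _)
  · intro κ hκ ℓ h1 h2; exact hF.EY κ hκ ℓ (by omega) h2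
  · intro κ hκ h1
    rcases Kd_addc hp htw hl h1 with h2 | h2
    · exact hF.EK κ hκ h2
    · exact hF.EY κ hκ tw le_rfl htw h2
  · intro x κ hx hκ ℓ h1 h2; exact hF.El x κ hx hκ ℓ (by omega) h2

theorem sg_Kd_Y (hp : PM col h B Q T L rk) (hs : Sel col h T L tw k c cs) {κ} (hκ : κ ∈ Kd col h T L (sg col T tw c))
    {ℓ} (h1 : tw ≤ ℓ) (h2 : ℓ < h) : κ ∉ (L ℓ).Y := by
  intro h3
  obtain ⟨ℓ', g1, g2, g3⟩ := Kd_sub hp.cfg (sg_SX.mem hp hs) hκ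
  have := hp.cfg.yy ℓ ℓ' (Nat.zero_le _) h2 (Nat.zero_le _) g1 κ h3 g3
  subst this
  simp [sg, Nat.not_lt.2 h1] at g2

theorem lab_R0 (hp : PM col h B Q T L rk) (hs : Sel col h T L tw k c cs) (htw : tw < h) {cc : Fin n}
    (hl : Lab col T (L tw) cc) : cc ∉ R0 tw k c cs := by
  intro h1
  rcases hl with h2 | ⟨y, h2, h3⟩
  · exact (R0_nl hp hs sg_SX h1 htw (Or.inr le_rfl)).2 h2
  · exact sg_Kd_Y hp hs (R0_a hp hs h1 h3) le_rfl htw h2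

theorem Chain.loose (hp : PM col h B Q T L rk) (hs : Sel col h T L tw k c cs) (hF : Fam col h T L tw k c cs R E)
    (hc : Chain col h T L k cs R E f J C m) : Loose col h T L (sg col T tw c) J C := by
  refine mk_loose hp hs sg_SX (hc.CE.trans hF.Ec) (fun κ hκ => hF.CK hp hs sg_SX (hc.CE hκ))
    (fun r v s hj => hF.RR (hc.rR r v s hj)) (hc.vR hp hs hF) ?_ ?_ hc.inj_r hc.inj_v hc.col_inj ?_
  · intro r v s hj κ hκ
    obtain ⟨κ', h1, h2⟩ := hc.own _ _ _ hj
    rw [h2] at hκ; cases hκ; exact Or.inl h1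
  · intro r v hj ha
    obtain ⟨κ', h1, h2⟩ := hc.own _ _ _ hj
    rw [T.own_true, ha] at h2; cases h2
  · intro r v s hj
    rcases hc.colm _ _ _ hj with h1 | h1
    · exact Or.inl h1
    · right; rw [h1]; exact hc.m_new

theorem Chain.image (hc : Chain col h T L k cs R E f J C m) (hEc : E ⊆ T.cols col) (hf : f ∈ C) :
    J.image (fun j => col j.1 j.2.1) = (insert m C).erase f := by
  apply Finset.eq_of_subset_of_card_le
  · intro x hx
    simp only [Finset.mem_image, Prod.exists] at hx
    obtain ⟨r, v, s, hj, rfl⟩ := hx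
    rw [Finset.mem_erase, Finset.mem_insert]
    exact ⟨hc.colf _ _ _ hj, (hc.colm _ _ _ hj).symm⟩
  · rw [Finset.card_image_of_injOn, Finset.card_erase_of_mem (Finset.mem_insert_of_mem hf), Finset.card_insert_of_notMem, hc.card]
    · simp
    · intro h1; exact hc.m_new (hEc (hc.CE h1))
    · rintro ⟨r, v, s⟩ h1 ⟨r', v', s'⟩ h2 he
      have := hc.col_inj _ _ _ _ _ _ h1 h2 he
      subst this
      obtain ⟨rfl, rfl⟩ := hc.inj_r _ _ _ _ _ h1 h2
      rfl

theorem commitB (hp : PM col h B Q T L rk) (hs : Sel col h T L tw (tw + 1) c cs) (htw : tw < h)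
    (hF : Fam col h T L tw (tw + 1) c cs R E) {κ κp : ℕ} (hc : Chain col h T L (tw + 1) cs R E κ J C m)
    (hκ : T.a col z = some κ) (hzJ : ∀ r', (r', z, true) ∉ J) {p : Fin n} (hpz : T.pred z = some p)
    (hpE : κp ∈ E) (hap : T.a col p = some κp)
    (hlab : ∀ cc ∈ G, Lab col T (L tw) cc) (hG : ∀ cc ∈ G, col cc z ∈ E ∨ col cc z ∉ T.cols col)
    (hcard : 2 + (L tw).Y.card ≤ 4 * G.card) : False := by
  have hLt := hp.cfg.ok tw (Nat.zero_le _) htw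
  have hκc : κ ∈ T.cols col := T.mem_cols.2 ⟨z, hκ⟩
  have hκC : κ ∈ C := by
    rcases hc.fm with h1 | h1
    · exact h1
    · subst h1; exact (hc.m_new hκc).elim
  have hκE := hc.CE hκC
  have hpc : col p z = κ := by
    obtain ⟨p', h1, h2⟩ := T.a_eq.1 hκ
    rw [hpz] at h1; cases h1; exact h2
  have hpzne : p ≠ z := by
    rintro rfl; exact lt_irrefl _ (T.lt _ _ hpz)
  have hlabE : ∀ cc ∈ G, ∀ κ, T.a col cc = some κ → κ ∈ (L tw).Y := by
    intro cc hcc κ hκ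
    rcases hlab cc hcc with h1 | ⟨y, h1, h2⟩
    · rw [T.a_none.2 (hLt.bases_start _ h1)] at hκ; cases hκ
    · rw [h2] at hκ; cases hκ; exact h1
  have hzG : ∀ cc ∈ G, cc ≠ z := by
    rintro cc hcc rfl
    exact hF.EY κ hκE tw le_rfl htw (hlabE _ hcc _ hκ)
  have hneκ : ∀ cc ∈ G, col cc z ≠ κ := by
    intro cc hcc he
    have := hp.prop z cc p (hzG cc hcc) hpzne (by rw [hp.sym z cc, hp.sym z p, he, hpc])
    subst this
    exact hF.EY κp hpE tw le_rfl htw (hlabE _ hcc _ hap)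
  have hprop : ∀ c ∈ G, ∀ c' ∈ G, col c z = col c' z → c = c' := by
    intro c hc c' hc' he
    exact hp.prop z c c' (hzG c hc) (hzG c' hc') (by rw [hp.sym z c, hp.sym z c', he])
  have hm : ∀ cc ∈ G, col cc z ∉ T.cols col → col cc z = m := by
    intro cc hcc h1
    by_contra h2
    have hs' := hs.addc htw (hlab cc hcc)
    have hF' := hF.addc hp htw (hlab cc hcc)
    refine gain hp hs' hF' sg_SX hc (r := cc) (x := z) (s := true) ?_ ?_ hzJ ?_ ?_ ?_ ?_ (Or.inr h1) (C4_true hc.c4 _ _)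
    · rw [R0_addc]; exact Finset.mem_insert_self _ _
    · intro h3; exact lab_R0 hp hs htw (hlab cc hcc) (hF.RR h3)
    · intro _ h3; exact hF'.EK κ hκE (R0_a hp hs' h3 hκ)
    · intro κ' hκ'; rw [T.own_true, hκ] at hκ'; cases hκ'; exact Or.inl hκC
    · intro _ h3; rw [hκ] at h3; cases h3
    · intro r' v s' hj he
      rcases hc.colm _ _ _ hj with h4 | h4
      · rw [he] at h4; exact h1 (hF.Ec (hc.CE h4))
      · exact h2 (by rw [← he, h4])
  have hzR : z ∉ R0 tw (tw + 1) c cs := fun h3 => hF.EK κ hκE (R0_a hp hs h3 hκ)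
  obtain ⟨T', hT', hM', hc', hsub, harm⟩ := commit_total hp hs (hc.loose hp hs hF) hc.card hc.c4
    (fun κ' hκ' => hF.EY _ (hc.CE hκ')) (fun r v s hj => hF.RR (hc.rR _ _ _ hj)) (by
      intro r v hj
      obtain ⟨κ', g1, g2⟩ := hc.own _ _ _ hj
      rw [T.own_true] at g2; rw [g2]; simp)
  have hzl : ∀ ℓ < h, z ∉ (L ℓ).letters ∧ z ∉ (L ℓ).bases := by
    intro ℓ hℓ
    have hL := hp.cfg.ok ℓ (Nat.zero_le _) hℓ
    constructor
    · intro h1; rw [T.a_none.2 (hL.letters_start _ h1)] at hκ; cases hκ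
    · intro h1; rw [T.a_none.2 (hL.bases_start _ h1)] at hκ; cases hκ
  have z1 : ∀ κ', T.a col z = some κ' → κ' ∈ Kd col h T L (sg col T tw c) ∪ C := by
    intro κ' h1; rw [hκ] at h1; cases h1; exact Finset.mem_union_right _ hκC
  have z2 : ∀ v s, (z, v, s) ∉ Wd col h T L (sg col T tw c) ∪ J := by
    intro v s hj
    rcases Finset.mem_union.1 hj with h1 | h1
    · obtain ⟨ℓ, hℓ, y, hy, src, hw, -⟩ := mem_Wd.1 h1
      exact (hzl ℓ hℓ).1 ((hp.cfg.ok ℓ (Nat.zero_le _) hℓ).w_let y (sg_SX.mem hp hs ℓ hℓ y hy) _ _ _ hw)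
    · exact hzR (hF.RR (hc.rR _ _ _ h1))
  have z3 : ∀ r, (r, z, true) ∉ Wd col h T L (sg col T tw c) ∪ J := by
    intro r hj
    rcases Finset.mem_union.1 hj with h1 | h1
    · obtain ⟨ℓ, hℓ, y, hy, src, hw, he⟩ := mem_Wd.1 h1
      have he : src = T.a col z := by simpa using he.symm
      rw [hκ] at he; subst he
      obtain ⟨⟨b', d', s', g1, g2⟩, -⟩ := (hp.cfg.ok ℓ (Nat.zero_le _) hℓ).w_some y (sg_SX.mem hp hs ℓ hℓ y hy) _ _ _ hw
      exact hF.EK κ hκE (mem_Kd.2 ⟨ℓ, hℓ, y, hy, b', d', s', g1, g2⟩)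
    · exact hzJ r h1
  have hz' : T'.pred z = none := hT'.start z z1 z2 z3
  have hYcut : ∀ y ∈ (L tw).Y, y ∉ Kd col h T L (sg col T tw c) ∪ C := by
    intro y hy h1
    rcases Finset.mem_union.1 h1 with h2 | h2
    · exact sg_Kd_Y hp hs h2 le_rfl htw hy
    · exact hF.EY y (hc.CE h2) tw le_rfl htw hy
  have hnew := newL_cfg (T := T) (z := z) (G := G) hp.sym hT'.rb htw hc' 
    (fun ℓ _ h2 => lt_of_le_of_lt (letters_Q hp h2) hp.hB) hprop hlab (fun b hb => T.a_none.2 (hLt.bases_start b hb))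
    hz' (fun ℓ _ h2 => hzl ℓ h2) (by
      intro cc hcc
      rw [hT'.cols, Finset.image_union, hc.image hF.Ec hκC]
      by_cases h1 : col cc z ∈ insert m C
      · exact Finset.mem_union_right _ (Finset.mem_union_right _ (Finset.mem_erase.2 ⟨hneκ cc hcc, h1⟩))
      · refine Finset.mem_union_left _ (Finset.mem_sdiff.2 ?_)
        rw [Finset.mem_insert, not_or] at h1
        rcases hG cc hcc with h2 | h2
        · refine ⟨hF.Ec h2, fun h3 => ?_⟩
          rcases Finset.mem_union.1 h3 with h4 | h4
          · exact hF.EK _ h2 h4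
          · exact h1.2 h4
        · exact (h1.1 (hm cc hcc h2)).elim) (by
      intro cc hcc ℓ h1 h2 h3
      rcases hG cc hcc with h4 | h4
      · exact hF.EY _ h4 ℓ h1 h2 h3
      · exact h4 ((hp.cfg.ok ℓ (Nat.zero_le _) h2).Ysub h3)) hcard (by
      intro cc hcc y hy
      have h0 := hYcut y (hlabE cc hcc y hy)
      obtain ⟨q, hq, hqc⟩ := T.a_eq.1 hy
      rcases hT'.keep _ _ hq (by rwa [hqc]) with e4 | e4
      · exact Or.inl (T'.a_eq.2 ⟨q, e4, hqc⟩)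
      · exact Or.inr (T'.own_false.2 ⟨q, e4, by rw [hp.sym]; exact hqc⟩)) (by
      intro cc hcc y hy hor
      have h0 := hYcut y (hlabE cc hcc y hy)
      obtain ⟨q, hq, hqc⟩ := T.a_eq.1 hy
      refine T'.a_eq.2 ⟨q, ?_, hqc⟩
      rcases hor with h1 | ⟨ℓ, h1, h2, h3⟩
      · exact hT'.arm2 z z1 z2 z3 cc q h1 hq (by rwa [hqc])
      · exact harm ℓ h1 h2 _ h3 cc q rfl hq (by rwa [hqc]))
  refine hp.no_improve hM' hnew le_rfl htw ?_ ?_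
  · have e1 : (newL col T (L tw) z G).letters.card = (L tw).letters.card + 1 := Finset.card_insert_of_notMem (hzl tw htw).1
    unfold pl
    rw [Function.update_self, e1]
    have : ((L tw).letters.card + 1) * (n + 1) = (L tw).letters.card * (n + 1) + (n + 1) := by ring
    omega
  · intro ℓ h1 h2
    have g3 := Finset.card_le_card (hsub ℓ (by omega) h2).1
    unfold pl
    rw [Function.update_of_ne (by omega)]
    omega

end
end HC

namespace HC
open scoped Classical
variable {n : ℕ}

noncomputable def PP (col : Fin n → Fin n → ℕ) (T : DF n) (E : Finset ℕ) (r : Fin n) : Finset (Fin n) :=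
  Finset.univ.filter fun x => x ≠ r ∧ (col r x ∈ E ∨ col r x ∉ T.cols col)

section
variable {col : Fin n → Fin n → ℕ} {h B Q : ℕ} {T T' : DF n} {L : ℕ → Lst n} {rk : Fin n → ℕ} {tw k : ℕ}
  {c cs : ℕ → Fin n} {σ : ℕ → Option ℕ} {J : Finset (Fin n × Fin n × Bool)} {C : Finset ℕ}
  {R R' : Finset (Fin n)} {E E' : Finset ℕ} {f m : ℕ} {z : Fin n} {G : Finset (Fin n)}

theorem mem_PP {x r : Fin n} : x ∈ PP col T E r ↔ x ≠ r ∧ (col r x ∈ E ∨ col r x ∉ T.cols col) := by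
  simp [PP]

theorem own_inj (hrb : T.Rb col) {p q s κ} (h1 : T.own col p s = some κ) (h2 : T.own col q s = some κ) : p = q := by
  cases s with
  | true => exact hrb _ _ _ h1 h2
  | false =>
    obtain ⟨x, hx, hxc⟩ := T.own_false.1 h1
    obtain ⟨y, hy, hyc⟩ := T.own_false.1 h2
    have := hrb x y κ (T.a_eq.2 ⟨_, hx, hxc⟩) (T.a_eq.2 ⟨_, hy, hyc⟩)
    subst this
    rw [hx] at hy; cases hy; rfl

theorem card_PP (hp : PM col h B Q T L rk) (hE : E ⊆ T.cols col) (r : Fin n) :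
    E.card + T.starts.card ≤ (PP col T E r).card + 1 := by
  have h1 := T.card_cols hp.mx.rb
  have h2 : ((Finset.univ.erase r) \ PP col T E r).card ≤ (T.cols col \ E).card := by
    apply Finset.card_le_card_of_injOn (fun x => col r x)
    · intro x hx
      simp only [Finset.coe_sdiff, Set.mem_diff, Finset.mem_coe, Finset.mem_erase, mem_PP, not_and, not_or, not_not] at hx ⊢
      have := hx.2 hx.1.1
      exact ⟨this.2, this.1⟩
    · intro x hx y hy he
      simp only [Finset.coe_sdiff, Set.mem_diff, Finset.mem_coe, Finset.mem_erase] at hx hy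
      exact hp.prop r x y hx.1.1 hy.1.1 he
  have h3 := Finset.card_sdiff_add_card_eq_card hE
  have h4 := Finset.le_card_sdiff (PP col T E r) (Finset.univ.erase r)
  rw [Finset.card_erase_of_mem (Finset.mem_univ _), Finset.card_univ, Fintype.card_fin] at h4
  omega

theorem card_word (hp : PM col h B Q T L rk) {ℓ y} (hℓ : ℓ < h) (hy : y ∈ (L ℓ).Y) : ((L ℓ).W y).card ≤ Q := by
  refine le_trans ?_ (letters_Q hp hℓ)
  have hL := hp.cfg.ok ℓ (Nat.zero_le _) hℓ
  apply Finset.card_le_card_of_injOn (fun j => j.1)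
  · rintro ⟨b, d, s⟩ hj; exact hL.w_let y hy _ _ _ hj
  · rintro ⟨b, d, s⟩ hj ⟨b', d', s'⟩ hj' he
    simp only at he; subst he
    obtain ⟨rfl, rfl⟩ := hL.w_fst y hy _ _ _ _ _ hj hj'
    rfl

theorem card_words (hp : PM col h B Q T L rk) (hs : Sel col h T L tw k c cs) :
    ((Finset.range tw).biUnion fun ℓ => wordOf (L ℓ) (sg col T tw c ℓ)).card ≤ tw * Q := by
  refine (Finset.card_biUnion_le_card_mul _ _ Q ?_).trans (by simp)
  intro ℓ hℓ
  have hℓ : ℓ < h := by have := Finset.mem_range.1 hℓ; have := hs.twh; omega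
  cases hy : sg col T tw c ℓ with
  | none => simp [wordOf]
  | some y => exact card_word hp hℓ (sg_SX.mem hp hs ℓ hℓ y hy)

theorem card_Kd (hp : PM col h B Q T L rk) (hs : Sel col h T L tw k c cs) :
    (Kd col h T L (sg col T tw c)).card ≤ tw * Q := by
  refine le_trans ?_ (card_words hp hs)
  refine le_trans (Finset.card_le_card ?_) (Finset.card_image_le (f := fun j => col j.1 j.2.1))
  intro κ hκ
  obtain ⟨ℓ, hℓ, y, hy, b, d, src, hw, rfl⟩ := mem_Kd.1 hκ
  refine Finset.mem_image.2 ⟨(b, d, src), Finset.mem_biUnion.2 ⟨ℓ, ?_, by rw [hy]; exact hw⟩, rfl⟩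
  rw [Finset.mem_range]
  by_contra h1
  simp [sg, h1] at hy

theorem card_own (hrb : T.Rb col) (K : Finset ℕ) (s : Bool) :
    (Finset.univ.filter fun x => ∃ κ ∈ K, T.own col x s = some κ).card ≤ K.card := by
  have : K.card = (K.image some).card := (Finset.card_image_of_injective _ (Option.some_injective _)).symm
  rw [this]
  apply Finset.card_le_card_of_injOn (fun x => T.own col x s)
  · intro x hx
    simp only [Finset.coe_filter, Finset.mem_univ, true_and, Set.mem_setOf_eq] at hx
    obtain ⟨κ, h1, h2⟩ := hx
    exact Finset.mem_coe.2 (Finset.mem_image.2 ⟨κ, h1, h2.symm⟩)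
  · intro x hx y hy he
    simp only [Finset.coe_filter, Finset.mem_univ, true_and, Set.mem_setOf_eq] at hx
    obtain ⟨κ, h1, h2⟩ := hx
    exact own_inj hrb h2 (he.symm.trans h2)

theorem card_ex (hp : PM col h B Q T L rk) (hs : Sel col h T L tw k c cs) :
    (ex col h T L tw k c cs).card ≤ tw * (3 * Q + 2) + k := by
  let K := Kd col h T L (sg col T tw c)
  have hsub : ex col h T L tw k c cs ⊆ ((Finset.range tw).biUnion fun s => (L s).letters ∪ (L s).bases) ∪
      ((Finset.range k).image cs ∪ ((Finset.univ.filter fun x => ∃ κ ∈ K, T.own col x true = some κ) ∪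
        (Finset.univ.filter fun x => ∃ κ ∈ K, T.own col x false = some κ))) := by
    intro x hx
    simp only [ex, Finset.mem_filter, Finset.mem_univ, true_and] at hx
    simp only [Finset.mem_union, Finset.mem_biUnion, Finset.mem_range, Finset.mem_image, Finset.mem_filter, Finset.mem_univ,
      true_and]
    rcases hx with h1 | ⟨i, h1, h2⟩ | h1 | h1
    · exact Or.inl h1
    · exact Or.inr (Or.inl ⟨i, h1, h2.symm⟩)
    · exact Or.inr (Or.inr (Or.inl h1))
    · exact Or.inr (Or.inr (Or.inr h1))
  have h1 : ((Finset.range tw).biUnion fun s => (L s).letters ∪ (L s).bases).card ≤ tw * (Q + 2) := by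
    refine (Finset.card_biUnion_le_card_mul _ _ (Q + 2) ?_).trans (by simp)
    intro ℓ hℓ
    have hℓ : ℓ < h := by have := Finset.mem_range.1 hℓ; have := hs.twh; omega
    have h1 := Finset.card_union_le (L ℓ).letters (L ℓ).bases
    have h2 := letters_Q hp hℓ
    have h3 := (hp.cfg.ok ℓ (Nat.zero_le _) hℓ).bases_card
    omega
  have h2 : ((Finset.range k).image cs).card ≤ k := Finset.card_image_le.trans (by simp)
  have h3 := card_own hp.mx.rb K true
  have h4 := card_own hp.mx.rb K false
  have h5 : K.card ≤ tw * Q := card_Kd hp hs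
  have h6 := Finset.card_le_card hsub
  have u1 := Finset.card_union_le ((Finset.range tw).biUnion fun s => (L s).letters ∪ (L s).bases) (((Finset.range k).image cs ∪ ((Finset.univ.filter fun x => ∃ κ ∈ K, T.own col x true = some κ) ∪
        (Finset.univ.filter fun x => ∃ κ ∈ K, T.own col x false = some κ))))
  have u2 := Finset.card_union_le ((Finset.range k).image cs) ((Finset.univ.filter fun x => ∃ κ ∈ K, T.own col x true = some κ) ∪
        (Finset.univ.filter fun x => ∃ κ ∈ K, T.own col x false = some κ))
  have u3 := Finset.card_union_le (Finset.univ.filter fun x => ∃ κ ∈ K, T.own col x true = some κ) 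
        (Finset.univ.filter fun x => ∃ κ ∈ K, T.own col x false = some κ)
  have e1 : tw * (Q + 2) = tw * Q + 2 * tw := by ring
  have e2 : tw * (3 * Q + 2) = 3 * (tw * Q) + 2 * tw := by ring
  omega

theorem card_R (hF : Fam col h T L tw k c cs R E) : R.card ≤ tw + k := by
  refine (Finset.card_le_card hF.RR).trans ((Finset.card_union_le _ _).trans ?_)
  have h1 : ((Finset.range k).image cs).card ≤ k := Finset.card_image_le.trans (by simp)
  have h2 : ((Finset.range tw).image c).card ≤ tw := Finset.card_image_le.trans (by simp)
  omega

theorem Chain.card_le (hc : Chain col h T L k cs R E f J C m) : J.card ≤ R.card := by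
  apply Finset.card_le_card_of_injOn (fun j => j.1)
  · rintro ⟨b, d, s⟩ hj; exact hc.rR _ _ _ hj
  · rintro ⟨b, d, s⟩ hj ⟨b', d', s'⟩ hj' he
    simp only at he; subst he
    obtain ⟨rfl, rfl⟩ := hc.inj_r _ _ _ _ _ hj hj'
    rfl

/-- candidates for the new spare start -/
theorem exists_cand (hp : PM col h B Q T L rk) (hs : Sel col h T L tw k c cs) (hk : k ≤ h) {M : ℕ}
    (hM : h * (2 * Q + 3) + M ≤ T.starts.card) : ∃ S : Finset (Fin n), M ≤ S.card ∧ ∀ x ∈ S, 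
      T.pred x = none ∧ (∀ i < k, cs i ≠ x) ∧ (∀ ℓ < h, x ∉ (L ℓ).letters ∧ x ∉ (L ℓ).bases) ∧
      (∀ s < tw, ∀ y, T.a col (c s) = some y → ∀ b d κ, (b, d, some κ) ∈ (L s).W y →
      T.own col d false = some κ → T.root d ≠ x) ∧ x ∉ R0 tw k c cs := by
  let A := (Finset.range h).biUnion fun s => (L s).letters ∪ (L s).bases
  let B := (Finset.range k).image cs
  let C := ((Finset.range tw).biUnion fun ℓ => wordOf (L ℓ) (sg col T tw c ℓ)).image fun j => T.root j.2.1
  have h1 : A.card ≤ h * (Q + 2) := by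
    refine (Finset.card_biUnion_le_card_mul _ _ (Q + 2) ?_).trans (by simp)
    intro ℓ hℓ
    have hℓ : ℓ < h := Finset.mem_range.1 hℓ
    have h1 := Finset.card_union_le (L ℓ).letters (L ℓ).bases
    have h2 := letters_Q hp hℓ
    have h3 := (hp.cfg.ok ℓ (Nat.zero_le _) hℓ).bases_card
    omega
  have h2 : B.card ≤ h := Finset.card_image_le.trans (by simpa using hk)
  have h3 : C.card ≤ h * Q := Finset.card_image_le.trans ((card_words hp hs).trans (Nat.mul_le_mul_right _ hs.twh))
  refine ⟨T.starts \ (A ∪ (B ∪ C)), ?_, ?_⟩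
  · have g1 := Finset.le_card_sdiff (A ∪ (B ∪ C)) T.starts
    have g2 := Finset.card_union_le A (B ∪ C)
    have g3 := Finset.card_union_le B C
    have e1 : h * (Q + 2) = h * Q + 2 * h := by ring
    have e2 : h * (2 * Q + 3) = 2 * (h * Q) + 3 * h := by ring
    omega
  · intro x hx
    simp only [Finset.mem_sdiff, Finset.mem_union, not_or, T.mem_starts] at hx
    obtain ⟨x1, x2, x3, x4⟩ := hx
    have y2 : ∀ i < k, cs i ≠ x := fun i hi he => x3 (Finset.mem_image.2 ⟨i, Finset.mem_range.2 hi, he⟩)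
    have y3 : ∀ ℓ < h, x ∉ (L ℓ).letters ∧ x ∉ (L ℓ).bases := by
      intro ℓ hℓ
      constructor
      · intro h1; exact x2 (Finset.mem_biUnion.2 ⟨ℓ, Finset.mem_range.2 hℓ, Finset.mem_union_left _ h1⟩)
      · intro h1; exact x2 (Finset.mem_biUnion.2 ⟨ℓ, Finset.mem_range.2 hℓ, Finset.mem_union_right _ h1⟩)
    refine ⟨x1, y2, y3, ?_, ?_⟩
    · intro s hs' y hy b d κ hw ho he
      refine x4 (Finset.mem_image.2 ⟨(b, d, some κ), Finset.mem_biUnion.2 ⟨s, Finset.mem_range.2 hs', ?_⟩, he⟩)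
      simp only [sg, if_pos hs', hy]; exact hw
    · intro h1
      rcases R0_cases hp hs h1 with ⟨s, h1, h2, h3, h4⟩ | ⟨s, h1, y, h2, h3, h4⟩ | ⟨i, h1, h2, h3⟩
      · exact (y3 s (by have := hs.twh; omega)).2 h3
      · rw [T.a_none.2 x1] at h4; cases h4
      · exact y2 i h1 h2.symm

/-- averaging: `Σ_x #{i ∈ A | r x i} ≤ K |A|` gives a cheap `x`. -/
theorem avg {α ι : Type} {S : Finset α} {A : Finset ι} (r : α → ι → Prop) {K : ℕ}
    (hr : ∀ i ∈ A, (S.filter fun x => r x i).card ≤ K) (hS : 64 * K ≤ S.card) (hS0 : 0 < S.card) :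
    ∃ x ∈ S, 64 * (A.filter fun i => r x i).card ≤ A.card := by
  by_contra hcon
  push Not at hcon
  have h1 := Finset.sum_card_bipartiteAbove_eq_sum_card_bipartiteBelow (s := S) (t := A) r
  have h2 : ∑ i ∈ A, (S.bipartiteBelow r i).card ≤ A.card * K := by
    rw [← smul_eq_mul]; exact Finset.sum_le_card_nsmul _ _ _ hr
  have h3 : S.card * (A.card + 1) ≤ ∑ x ∈ S, 64 * (A.bipartiteAbove r x).card := by
    rw [← smul_eq_mul]; exact Finset.card_nsmul_le_sum _ _ _ (fun x hx => hcon x hx)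
  rw [← Finset.mul_sum, h1] at h3
  have h4 : A.card * (64 * K) ≤ A.card * S.card := Nat.mul_le_mul_left _ hS
  nlinarith

theorem avg2 {α : Type} {O : Finset ℕ} {Lb : Finset α} (r : α → ℕ → Prop) (hO : O.Nonempty)
    (hr : ∀ x ∈ Lb, O.card ≤ 4 * (O.filter fun i => r x i).card) :
    ∃ κ ∈ O, Lb.card ≤ 4 * (Lb.filter fun x => r x κ).card := by
  by_contra hcon
  push Not at hcon
  have h1 := Finset.sum_card_bipartiteAbove_eq_sum_card_bipartiteBelow (s := Lb) (t := O) r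
  have h2 : Lb.card * O.card ≤ ∑ x ∈ Lb, 4 * (O.bipartiteAbove r x).card := by
    rw [← smul_eq_mul]; exact Finset.card_nsmul_le_sum _ _ _ hr
  have h3 : ∑ i ∈ O, 4 * (Lb.bipartiteBelow r i).card < ∑ i ∈ O, Lb.card := 
    Finset.sum_lt_sum_of_nonempty hO hcon
  rw [← Finset.mul_sum] at h2 h3
  rw [h1] at h2
  simp at h3
  nlinarith

end
end HC

namespace HC
open scoped Classical
variable {n : ℕ}

section
variable {col : Fin n → Fin n → ℕ} {h B Q : ℕ} {T T' : DF n} {L : ℕ → Lst n} {rk : Fin n → ℕ} {tw k : ℕ}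
  {c cs : ℕ → Fin n} {σ : ℕ → Option ℕ} {J : Finset (Fin n × Fin n × Bool)} {C : Finset ℕ}
  {R R' : Finset (Fin n)} {E E' : Finset ℕ} {f m : ℕ} {z : Fin n} {G : Finset (Fin n)}

theorem pick (hp : PM col h B Q T L rk) (hs : Sel col h T L tw tw c cs) (hF : Fam col h T L tw tw c cs R E)
    (hM : h * (2 * Q + 3) + 64 * (4 * h + 1) ≤ T.starts.card) :
    ∃ x, Sel col h T L tw (tw + 1) c (Function.update cs tw x) ∧
      Fam col h T L tw (tw + 1) c (Function.update cs tw x) R E ∧ x ∉ R ∧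
      ∃ Bd : Finset ℕ, 64 * Bd.card ≤ E.card ∧ ∀ f ∈ E, f ∉ Bd →
        (∀ y, T.a col y = some f → T.root y ≠ x) ∧
        ∃ J C m, Chain col h T L (tw + 1) (Function.update cs tw x) R E f J C m ∧
          (∀ r v, (r, v, false) ∈ J → T.root v ≠ x) ∧
          (∀ p, p ≠ x → col x p = f → ∀ κ ∈ C, T.own col p false ≠ some κ) := by
  have hch : ∀ f, ∃ J C m, f ∈ E → Chain col h T L tw cs R E f J C m := by
    intro f
    by_cases hf : f ∈ E
    · obtain ⟨J, C, m, hc⟩ := hF.ch f hf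
      exact ⟨J, C, m, fun _ => hc⟩
    · exact ⟨∅, ∅, 0, fun h => absurd h hf⟩
  choose J C m hc using hch
  obtain ⟨S, hSc, hS⟩ := exists_cand hp hs hs.twh hM
  obtain ⟨x, hxS, hx⟩ := avg (S := S) (A := E) (fun x f => (∃ y, T.a col y = some f ∧ T.root y = x) ∨
      (∃ r v, (r, v, false) ∈ J f ∧ T.root v = x) ∨
      (∃ p, p ≠ x ∧ col x p = f ∧ ∃ κ ∈ C f, T.own col p false = some κ)) (K := 4 * h + 1) (by
    intro f hf
    have hcf := hc f hf
    let A1 := (Finset.univ.filter fun y => ∃ κ ∈ ({f} : Finset ℕ), T.own col y true = some κ).image T.root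
    let A2 := (J f).image fun j => T.root j.2.1
    let A3 := (Finset.univ.filter fun p => ∃ κ ∈ C f, T.own col p false = some κ).biUnion
      fun p => Finset.univ.filter fun x => x ≠ p ∧ col p x = f
    have hsub : (S.filter fun x => (∃ y, T.a col y = some f ∧ T.root y = x) ∨
      (∃ r v, (r, v, false) ∈ J f ∧ T.root v = x) ∨
      (∃ p, p ≠ x ∧ col x p = f ∧ ∃ κ ∈ C f, T.own col p false = some κ)) ⊆ A1 ∪ (A2 ∪ A3) := by
      intro x hx
      rcases (Finset.mem_filter.1 hx).2 with ⟨y, h1, h2⟩ | ⟨r, v, h1, h2⟩ | ⟨p, h1, h2, h3⟩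
      · refine Finset.mem_union_left _ (Finset.mem_image.2 ⟨y, ?_, h2⟩)
        simp only [Finset.mem_filter, Finset.mem_univ, true_and]
        exact ⟨f, by simp, h1⟩
      · exact Finset.mem_union_right _ (Finset.mem_union_left _ (Finset.mem_image.2 ⟨(r, v, false), h1, h2⟩))
      · refine Finset.mem_union_right _ (Finset.mem_union_right _ (Finset.mem_biUnion.2 ⟨p, ?_, ?_⟩))
        · simp only [Finset.mem_filter, Finset.mem_univ, true_and]; exact h3
        · simp only [Finset.mem_filter, Finset.mem_univ, true_and]
          exact ⟨h1.symm, by rw [hp.sym]; exact h2⟩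
    have a1 : A1.card ≤ 1 := Finset.card_image_le.trans ((card_own hp.mx.rb _ _).trans (by simp))
    have a2 : A2.card ≤ (J f).card := Finset.card_image_le
    have a3 : A3.card ≤ (C f).card := by
      refine (Finset.card_biUnion_le_card_mul _ _ 1 ?_).trans (by rw [mul_one]; exact card_own hp.mx.rb _ _)
      intro p _
      rw [Finset.card_le_one]
      intro u hu v hv
      simp only [Finset.mem_filter, Finset.mem_univ, true_and] at hu hv
      exact hp.prop p u v hu.1 hv.1 (hu.2.trans hv.2.symm)
    have b1 := hcf.card_le
    have b2 := hcf.card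
    have b3 := card_R hF
    have b4 := hs.twh
    have c1 := Finset.card_union_le A1 (A2 ∪ A3)
    have c2 := Finset.card_union_le A2 A3
    have c3 := Finset.card_le_card hsub
    refine le_trans (le_of_eq ?_) (le_trans c3 (by omega : _ ≤ 4 * h + 1))
    congr) (by omega) (by omega)
  obtain ⟨x1, x2, x3, x4, x5⟩ := hS x hxS
  have hxR : x ∉ R := fun h => x5 (hF.RR h)
  refine ⟨x, hs.addcs x1 x2 x3 x4, hF.addcs hxR, hxR, _, hx, ?_⟩
  intro f hf hfB
  simp only [Finset.mem_filter, not_and, not_or] at hfB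
  obtain ⟨g1, g2, g3⟩ := hfB hf
  refine ⟨fun y h1 h2 => g1 ⟨y, h1, h2⟩, J f, C f, m f, (hc f hf).addcs hxR, fun r v h1 h2 => g2 ⟨r, v, h1, h2⟩, ?_⟩
  intro p h1 h2 κ h3 h4
  exact g3 ⟨p, h1, h2, κ, h3, h4⟩

/-- in-step images -/
theorem in_image (hp : PM col h B Q T L rk) (hs : Sel col h T L tw k c cs) (hF : Fam col h T L tw k c cs R E)
    {r : Fin n} (hr : r ∈ R0 tw k c cs) (hrR : r ∉ R) (hM : tw * (3 * Q + 2) + k + 2 ≤ T.starts.card) :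
    ∃ P : Finset (Fin n), (∀ x ∈ P, x ∈ PP col T E r ∧ x ∉ ex col h T L tw k c cs) ∧ E.card + 1 ≤ P.card ∧
      ∃ g : Fin n → ℕ, (∀ x ∈ P, T.a col x = some (g x) ∧ (g x ∈ E ∨ New col h T L tw k c cs (insert r R) E (g x))) ∧
        (P.image g).card = P.card := by
  refine ⟨PP col T E r \ ex col h T L tw k c cs, fun x hx => Finset.mem_sdiff.1 hx, ?_, 
    fun x => (T.a col x).getD 0, ?_, ?_⟩
  · have h1 := card_PP hp hF.Ec r
    have h2 := card_ex hp hs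
    have h3 := Finset.le_card_sdiff (ex col h T L tw k c cs) (PP col T E r)
    omega
  · intro x hx
    obtain ⟨hx1, hx2⟩ := Finset.mem_sdiff.1 hx
    obtain ⟨κ, h1, h2⟩ := in_step hp hs hF hr hrR hx2 (mem_PP.1 hx1).2
    refine ⟨by simp [h1], ?_⟩
    simpa only [h1, Option.getD_some] using h2
  · apply Finset.card_image_of_injOn
    intro x hx y hy he
    obtain ⟨hx1, hx2⟩ := Finset.mem_sdiff.1 hx
    obtain ⟨hy1, hy2⟩ := Finset.mem_sdiff.1 hy
    obtain ⟨κ, h1, h2⟩ := in_step hp hs hF hr hrR hx2 (mem_PP.1 hx1).2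
    obtain ⟨κ', h1', h2'⟩ := in_step hp hs hF hr hrR hy2 (mem_PP.1 hy1).2
    simp only [h1, h1', Option.getD_some] at he
    subst he
    exact hp.mx.rb _ _ _ h1 h1'

theorem out_image (hp : PM col h B Q T L rk) (hs : Sel col h T L tw (tw + 1) c cs)
    (hF : Fam col h T L tw (tw + 1) c cs R E) (hxR : cs tw ∉ R)
    (hM : tw * (3 * Q + 2) + (tw + 1) + 2 ≤ T.starts.card)
    {Bd : Finset ℕ} (hBd : ∀ f ∈ E, f ∉ Bd →
        (∀ y, T.a col y = some f → T.root y ≠ cs tw) ∧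
        ∃ J C m, Chain col h T L (tw + 1) cs R E f J C m ∧
          (∀ r v, (r, v, false) ∈ J → T.root v ≠ cs tw) ∧
          (∀ p, p ≠ cs tw → col (cs tw) p = f → ∀ κ ∈ C, T.own col p false ≠ some κ)) :
    ∃ N O : Finset ℕ, (∀ κ ∈ N, κ ∈ E ∨ New col h T L tw (tw + 1) c cs (insert (cs tw) R) E κ) ∧
      (∀ κ ∈ O, New col h T L tw (tw + 1) c cs (insert (cs tw) R) E κ ∧
        ∃ p κp, T.own col p false = some κ ∧ T.a col p = some κp ∧ κp ∈ E ∧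
        ∃ J C m, Chain col h T L (tw + 1) cs (insert (cs tw) R) (insert κ E) κ J C m ∧
        ∀ z, T.a col z = some κ → ∀ r', (r', z, true) ∉ J) ∧
      E.card + 1 ≤ N.card ∧ N.card ≤ O.card + (N \ E).card + 2 * Bd.card := by
  have hr : cs tw ∈ R0 tw (tw + 1) c cs := mem_R0.2 (Or.inr ⟨tw, by omega, rfl⟩)
  obtain ⟨P, hP, hPc, g, hg, hgc⟩ := in_image hp hs hF hr hxR hM
  let Pg := P.filter fun p => g p ∈ E ∧ g p ∉ Bd ∧ col (cs tw) p ∉ Bd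
  have key : ∀ p ∈ Pg, ∃ κ, T.own col p false = some κ ∧ New col h T L tw (tw + 1) c cs (insert (cs tw) R) E κ ∧
      ∃ J C m, Chain col h T L (tw + 1) cs (insert (cs tw) R) (insert κ E) κ J C m ∧
        ∀ z, T.a col z = some κ → ∀ r', (r', z, true) ∉ J := by
    intro p hpg
    obtain ⟨p1, p2, p3, p4⟩ := Finset.mem_filter.1 hpg
    obtain ⟨q1, q2⟩ := hP p p1
    obtain ⟨q3, q4⟩ := mem_PP.1 q1
    obtain ⟨q5, _⟩ := hg p p1
    have hroot := (hBd _ p2 p3).1 p q5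
    have hl := hF.El p _ q5 p2
    rcases q4 with q4 | q4
    · obtain ⟨_, J, C, m, hc, hJ, hC⟩ := hBd _ q4 p4
      exact out_step hp hs hF hxR q2 hc hl hroot hJ (hC p q3 rfl)
    · exact out_step hp hs hF hxR q2 (empty_chain q4) hl hroot (by simp) (by simp)
  refine ⟨P.image g, Pg.image fun p => (T.own col p false).getD 0, ?_, ?_, by omega, ?_⟩
  · intro κ hκ
    obtain ⟨p, h1, rfl⟩ := Finset.mem_image.1 hκ
    exact (hg p h1).2
  · intro κ hκ
    obtain ⟨p, h1, rfl⟩ := Finset.mem_image.1 hκ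
    obtain ⟨κ, h2, h3, h4⟩ := key p h1
    obtain ⟨p1, p2, p3, p4⟩ := Finset.mem_filter.1 h1
    rw [h2]
    exact ⟨h3, p, g p, h2, (hg p p1).1, p2, h4⟩
  · have hO : (Pg.image fun p => (T.own col p false).getD 0).card = Pg.card := by
      apply Finset.card_image_of_injOn
      intro x hx y hy he
      obtain ⟨κ, h2, _⟩ := key x hx
      obtain ⟨κ', h2', _⟩ := key y hy
      simp only [h2, h2', Option.getD_some] at he
      subst he
      exact own_inj hp.mx.rb h2 h2'
    have ginj : Set.InjOn g P := Finset.card_image_iff.1 hgc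
    let P1 := P.filter fun p => g p ∉ E
    let P2 := P.filter fun p => g p ∈ Bd
    let P3 := P.filter fun p => col (cs tw) p ∈ Bd
    have s1 : P1.card ≤ (P.image g \ E).card := by
      apply Finset.card_le_card_of_injOn g
      · intro p hp'
        obtain ⟨h1, h2⟩ := Finset.mem_filter.1 hp'
        exact Finset.mem_sdiff.2 ⟨Finset.mem_image_of_mem _ h1, h2⟩
      · exact ginj.mono (fun p hp' => (Finset.mem_filter.1 hp').1)
    have s2 : P2.card ≤ Bd.card := by
      apply Finset.card_le_card_of_injOn g
      · intro p hp'; exact (Finset.mem_filter.1 hp').2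
      · exact ginj.mono (fun p hp' => (Finset.mem_filter.1 hp').1)
    have s3 : P3.card ≤ Bd.card := by
      apply Finset.card_le_card_of_injOn (fun p => col (cs tw) p)
      · intro p hp'; exact (Finset.mem_filter.1 hp').2
      · intro x hx y hy he
        exact hp.prop _ x y (mem_PP.1 (hP x (Finset.mem_filter.1 hx).1).1).1
          (mem_PP.1 (hP y (Finset.mem_filter.1 hy).1).1).1 he
    have hsub : P ⊆ Pg ∪ (P1 ∪ (P2 ∪ P3)) := by
      intro p hpP
      simp only [Finset.mem_union, Pg, P1, P2, P3, Finset.mem_filter, hpP, true_and]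
      tauto
    have c0 := Finset.card_le_card hsub
    have c1 := Finset.card_union_le Pg (P1 ∪ (P2 ∪ P3))
    have c2 := Finset.card_union_le P1 (P2 ∪ P3)
    have c3 := Finset.card_union_le P2 P3
    omega

theorem stage (hp : PM col h B Q T L rk) (hs : Sel col h T L tw tw c cs) (hF : Fam col h T L tw tw c cs R E)
    (htw : tw < h) (hM1 : h * (2 * Q + 3) + 64 * (4 * h + 1) ≤ T.starts.card)
    (hM2 : h * (3 * Q + 2) + h + 2 ≤ T.starts.card) :
    ∃ c' cs' R' E', Sel col h T L (tw + 1) (tw + 1) c' cs' ∧ Fam col h T L (tw + 1) (tw + 1) c' cs' R' E' ∧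
      17 * E.card ≤ 16 * E'.card ∧ 1 ≤ E'.card := by
  obtain ⟨x, hs1, hF1, hxR, Bd, hBc, hBd⟩ := pick hp hs hF hM1
  generalize hcs : Function.update cs tw x = cs1 at hs1 hF1 hBd
  have hx : x = cs1 tw := by rw [← hcs]; simp
  subst hx
  have m1 : (tw + 1) * (3 * Q + 2) ≤ h * (3 * Q + 2) := Nat.mul_le_mul_right _ htw
  have m2 : (tw + 1) * (3 * Q + 2) = tw * (3 * Q + 2) + (3 * Q + 2) := by ring
  obtain ⟨N, O, hN, hO, hNc, hOc⟩ := out_image hp hs1 hF1 hxR (by omega) hBd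
  have hR1 : insert (cs1 tw) R ⊆ R0 tw (tw + 1) c cs1 := by
    refine Finset.insert_subset (mem_R0.2 (Or.inr ⟨tw, by omega, rfl⟩)) hF1.RR
  have hF2 := hF1.add (Finset.subset_insert (cs1 tw) R) hR1 (N := N ∪ O) (by
    intro κ hκ
    rcases Finset.mem_union.1 hκ with h1 | h1
    · exact hN κ h1
    · exact Or.inr (hO κ h1).1)
  have hNE : N ⊆ E ∪ (N ∪ O) := fun κ hκ => Finset.mem_union_right _ (Finset.mem_union_left _ hκ)
  have hOE : O ⊆ E ∪ (N ∪ O) := fun κ hκ => Finset.mem_union_right _ (Finset.mem_union_right _ hκ)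
  have hEE : E ⊆ E ∪ (N ∪ O) := Finset.subset_union_left
  have hE1 := Finset.card_le_card hNE
  generalize hE2 : E ∪ (N ∪ O) = E1 at *
  generalize hR2 : insert (cs1 tw) R = R1 at *
  have hLt := hp.cfg.ok tw (Nat.zero_le _) htw
  by_cases hbig : 17 * E.card ≤ 16 * E1.card
  · obtain ⟨cc, hcc⟩ : (L tw).bases.Nonempty := by
      rw [← Finset.card_pos, hLt.bases_card]; omega
    exact ⟨_, _, _, _, hs1.addc htw (Or.inl hcc), hF2.addc hp htw (Or.inl hcc), hbig, by omega⟩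
  by_contra hcon
  have hNd : (N \ E).card + E.card ≤ E1.card := by
    rw [Finset.card_sdiff_add_card]
    exact Finset.card_le_card (Finset.union_subset hNE hEE)
  -- images for each label
  have hlab : ∀ cc, Lab col T (L tw) cc → O.card ≤ 4 * (O.filter fun κ => 
      ∀ z, T.a col z = some κ → col cc z ∈ E1 ∨ col cc z ∉ T.cols col).card := by
    intro cc hl
    have hs3 := hs1.addc htw hl
    have hF3 := hF2.addc hp htw hl
    have hcR : cc ∉ R1 := fun h1 => lab_R0 hp hs1 htw hl (hF2.RR h1)
    have hc0 : cc ∈ R0 (tw + 1) (tw + 1) (Function.update c tw cc) cs1 := by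
      rw [R0_addc]; exact Finset.mem_insert_self _ _
    obtain ⟨P, hP, hPc, g, hg, hgc⟩ := in_image hp hs3 hF3 hc0 hcR (by omega)
    have hF4 := hF3.add (Finset.subset_insert cc R1) (Finset.insert_subset hc0 hF3.RR) (N := P.image g) (by
      intro κ hκ
      obtain ⟨p, h1, rfl⟩ := Finset.mem_image.1 hκ
      exact (hg p h1).2)
    have hsm : ¬ 17 * E.card ≤ 16 * (E1 ∪ P.image g).card := by
      intro h1
      refine hcon ⟨_, _, _, _, hs3, hF4, h1, ?_⟩
      have := Finset.card_le_card (Finset.subset_union_left (s₁ := E1) (s₂ := P.image g))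
      omega
    have h1 : (O \ P.image g).card + (P.image g).card ≤ (E1 ∪ P.image g).card := by
      rw [Finset.card_sdiff_add_card]
      exact Finset.card_le_card (Finset.union_subset_union_left hOE)
    have h2 : (O ∩ P.image g).card ≤ (O.filter fun κ => 
      ∀ z, T.a col z = some κ → col cc z ∈ E1 ∨ col cc z ∉ T.cols col).card := by
      apply Finset.card_le_card
      intro κ hκ
      obtain ⟨k1, k2⟩ := Finset.mem_inter.1 hκ
      refine Finset.mem_filter.2 ⟨k1, ?_⟩
      intro z hz
      obtain ⟨p, k3, rfl⟩ := Finset.mem_image.1 k2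
      have := hp.mx.rb _ _ _ hz (hg p k3).1
      subst this
      exact (mem_PP.1 (hP _ k3).1).2
    have h3 := Finset.card_sdiff_add_card_inter O (P.image g)
    omega
  let Lb : Finset (Fin n) := Finset.univ.filter fun cc => Lab col T (L tw) cc
  have hLb : 2 + (L tw).Y.card ≤ Lb.card := by
    have hch : ∀ y, ∃ z, y ∈ (L tw).Y → T.a col z = some y := by
      intro y
      by_cases hy : y ∈ (L tw).Y
      · obtain ⟨z, hz⟩ := T.mem_cols.1 (hLt.Ysub hy)
        exact ⟨z, fun _ => hz⟩
      · exact ⟨cs1 tw, fun h => absurd h hy⟩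
    choose zz hzz using hch
    have h1 : ((L tw).Y.image zz).card = (L tw).Y.card := by
      apply Finset.card_image_of_injOn
      intro y hy y' hy' he
      have e1 := hzz y hy
      rw [he, hzz y' hy'] at e1
      cases e1; rfl
    have h2 : Disjoint (L tw).bases ((L tw).Y.image zz) := by
      rw [Finset.disjoint_left]
      intro b hb hb'
      obtain ⟨y, hy, rfl⟩ := Finset.mem_image.1 hb'
      have := hzz y hy
      rw [T.a_none.2 (hLt.bases_start _ hb)] at this; cases this
    rw [← h1, ← hLt.bases_card, ← Finset.card_union_of_disjoint h2]
    apply Finset.card_le_card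
    intro b hb
    refine Finset.mem_filter.2 ⟨Finset.mem_univ _, ?_⟩
    rcases Finset.mem_union.1 hb with h3 | h3
    · exact Or.inl h3
    · obtain ⟨y, hy, rfl⟩ := Finset.mem_image.1 h3
      exact Or.inr ⟨y, hy, hzz y hy⟩
  obtain ⟨κ, hκO, hκc⟩ := avg2 (O := O) (Lb := Lb) (fun cc κ => ∀ z, T.a col z = some κ → col cc z ∈ E1 ∨ col cc z ∉ T.cols col)
    (by rw [← Finset.card_pos]; omega) (fun cc hcc => by
      refine (hlab cc (Finset.mem_filter.1 hcc).2).trans (le_of_eq ?_)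
      congr)
  obtain ⟨_, p, κp, k1, k2, k3, J, C, m, hc, hz⟩ := hO κ hκO
  obtain ⟨z, hpz, hcz⟩ := T.own_false.1 k1
  have haz : T.a col z = some κ := T.a_eq.2 ⟨p, hpz, hcz⟩
  refine commitB hp hs1 htw hF2 (hc.mono (Finset.Subset.refl _) (Finset.insert_subset (hOE hκO) hEE)) haz (hz z haz) hpz
    (hEE k3) k2 (G := Lb.filter fun cc => ∀ z, T.a col z = some κ → col cc z ∈ E1 ∨ col cc z ∉ T.cols col) ?_ ?_ ?_
  · intro cc hcc
    exact (Finset.mem_filter.1 (Finset.mem_filter.1 hcc).1).2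
  · intro cc hcc
    exact (Finset.mem_filter.1 hcc).2 z haz
  · refine hLb.trans (hκc.trans (le_of_eq ?_))
    congr

theorem bound (hp : PM col h B Q T L rk) (h1 : 1 ≤ h) (hn : 2 * 16 ^ h * n < 17 ^ h) (hM1 : h * (2 * Q + 3) + 64 * (4 * h + 1) ≤ T.starts.card)
    (hM2 : h * (3 * Q + 2) + h + 2 ≤ T.starts.card) : False := by
  have hne : 0 < T.starts.card := by omega
  obtain ⟨x0, _⟩ := Finset.card_pos.1 hne
  have main : ∀ t, t ≤ h → ∃ c cs R E, Sel col h T L t t c cs ∧ Fam col h T L t t c cs R E ∧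
      (1 ≤ t → 17 ^ t ≤ 2 * 16 ^ t * E.card) := by
    intro t
    induction t with
    | zero =>
      intro _
      refine ⟨fun _ => x0, fun _ => x0, ∅, ∅, ?_, ?_, by omega⟩
      · constructor <;> simp
      · constructor <;> simp
    | succ t ih =>
      intro ht
      obtain ⟨c, cs, R, E, hs, hF, hE⟩ := ih (by omega)
      obtain ⟨c', cs', R', E', hs', hF', hE1, hE2⟩ := stage hp hs hF (by omega) hM1 hM2
      refine ⟨c', cs', R', E', hs', hF', fun _ => ?_⟩
      rcases Nat.eq_zero_or_pos t with h0 | h0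
      · subst h0; norm_num; omega
      · have := hE h0
        rw [pow_succ, pow_succ]
        have e : 17 ^ t * 17 ≤ 2 * 16 ^ t * (17 * E.card) := by nlinarith
        have e2 : 2 * 16 ^ t * (17 * E.card) ≤ 2 * 16 ^ t * (16 * E'.card) := Nat.mul_le_mul_left _ hE1
        nlinarith
  obtain ⟨c, cs, R, E, hs, hF, hE⟩ := main h le_rfl
  have g1 := hE h1
  have g2 := Finset.card_le_card hF.Ec
  have g3 := T.card_cols hp.mx.rb
  have g4 : 2 * 16 ^ h * E.card ≤ 2 * 16 ^ h * n := Nat.mul_le_mul_left _ (by omega)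
  omega

end
end HC

namespace HC
open scoped Classical
variable {n : ℕ}

theorem exists_Mx (col : Fin n → Fin n → ℕ) : ∃ T : DF n, Mx col T := by
  let P : ℕ → Prop := fun k => ∃ T : DF n, T.Rb col ∧ (T.cols col).card = k
  let T0 : DF n := ⟨fun _ => none, by simp, fun _ => 0, by simp⟩
  have hT0 : T0.Rb col := by
    intro x y κ hx
    rw [T0.a_none.2 rfl] at hx; cases hx
  have h0 : P (T0.cols col).card := ⟨T0, hT0, rfl⟩
  have hb : ∀ T : DF n, T.Rb col → (T.cols col).card ≤ n := by
    intro T hT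
    have := T.card_cols hT
    omega
  obtain ⟨T, hT, hk⟩ := Nat.findGreatest_spec (P := P) (n := n) (hb T0 hT0) h0
  refine ⟨T, hT, fun T' hT' => ?_⟩
  rw [hk]
  exact Nat.le_findGreatest (hb T' hT') ⟨T', hT', rfl⟩

theorem num_Q {l : ℕ} (hl : n < 2 ^ (l + 1)) (hn : 3 ≤ n) (q : ℕ) (hq : 2 * 5 ^ q ≤ 4 ^ q * (n + 2)) : q ≤ 4 * (l + 1) := by
  by_contra hcon
  obtain ⟨j, rfl⟩ : ∃ j, q = 4 * (l + 1) + j := ⟨q - 4 * (l + 1), by omega⟩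
  have h1 : (512 : ℕ) ^ (l + 1) ≤ 625 ^ (l + 1) := Nat.pow_le_pow_left (by norm_num) _
  have h2 : (4 : ℕ) ^ j ≤ 5 ^ j := Nat.pow_le_pow_left (by norm_num) _
  have e1 : (5 : ℕ) ^ (4 * (l + 1) + j) = 625 ^ (l + 1) * 5 ^ j := by
    rw [pow_add, pow_mul]; norm_num
  have e2 : (4 : ℕ) ^ (4 * (l + 1) + j) * 2 ^ (l + 1) = 512 ^ (l + 1) * 4 ^ j := by
    rw [pow_add, pow_mul, mul_right_comm, ← mul_pow]; norm_num
  have h3 := Nat.mul_le_mul h1 h2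
  rw [← e1, ← e2] at h3
  have h4 : 0 < (4 : ℕ) ^ (4 * (l + 1) + j) := by positivity
  have h5 : (4 : ℕ) ^ (4 * (l + 1) + j) * (n + 2) < 4 ^ (4 * (l + 1) + j) * (2 * 2 ^ (l + 1)) :=
    Nat.mul_lt_mul_of_pos_left (by omega) h4
  nlinarith

theorem num_h {l : ℕ} (hl : n < 2 ^ (l + 1)) : 2 * 16 ^ (12 * (l + 2)) * n < 17 ^ (12 * (l + 2)) := by
  have h1 : ((16 : ℕ) ^ 12 * 2) ^ (l + 2) ≤ (17 ^ 12) ^ (l + 2) := Nat.pow_le_pow_left (by norm_num) _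
  rw [← pow_mul, mul_pow, ← pow_mul] at h1
  have h4 : 0 < (16 : ℕ) ^ (12 * (l + 2)) := by positivity
  have h5 : (16 : ℕ) ^ (12 * (l + 2)) * (2 * n) < 16 ^ (12 * (l + 2)) * 2 ^ (l + 2) :=
    Nat.mul_lt_mul_of_pos_left (by rw [pow_succ 2 (l + 1)]; omega) h4
  have e : 2 * 16 ^ (12 * (l + 2)) * n = 16 ^ (12 * (l + 2)) * (2 * n) := by ring
  rw [e]; exact h5.trans_le h1

theorem deficit {col : Fin n → Fin n → ℕ} (hsym : ∀ u v, col u v = col v u)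
    (hprop : ∀ u x y, x ≠ u → y ≠ u → col u x = col u y → x = y) (hn : 3 ≤ n) {T : DF n} (hM : Mx col T) :
    T.starts.card ≤ 20000 * (Nat.log 2 n) ^ 2 := by
  have hl : n < 2 ^ (Nat.log 2 n + 1) := Nat.lt_pow_succ_log_self (by norm_num) n
  have hl1 : 1 ≤ Nat.log 2 n := Nat.log_pos (by norm_num) (by omega)
  generalize Nat.log 2 n = l at *
  by_contra hcon
  obtain ⟨Q, hQ⟩ : ∃ Q, Q = 4 * (l + 1) := ⟨_, rfl⟩
  obtain ⟨h, hh⟩ : ∃ h, h = 12 * (l + 2) := ⟨_, rfl⟩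
  have hD : h * (3 * Q + 260) + 66 ≤ T.starts.card := by
    have : h * (3 * Q + 260) + 66 ≤ 20000 * l ^ 2 := by subst hQ hh; nlinarith
    omega
  have e1 : h * (3 * Q + 260) = 3 * (h * Q) + 260 * h := by ring
  have e2 : h * (2 * Q + 3) = 2 * (h * Q) + 3 * h := by ring
  have e3 : h * (3 * Q + 2) = 3 * (h * Q) + 2 * h := by ring
  have e4 : h * (Q + 2) = h * Q + 2 * h := by ring
  obtain ⟨T', L, rk, hp⟩ := exists_PM (Q := Q) (h := h) (B := Q + 1) hsym hprop hM
    (by rw [hQ]; exact num_Q hl hn) (by omega) (by omega)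
  have hst : T'.starts.card = T.starts.card := by
    have h1 := hM.mx T' hp.mx.rb
    have h2 := hp.mx.mx T hM.rb
    have h3 := T.card_cols hM.rb
    have h4 := T'.card_cols hp.mx.rb
    omega
  exact bound hp (by omega) (by rw [hh]; exact num_h hl) (by omega) (by omega)

end HC

/-- There exists a constant `C` such that for every `n` (with `3 ≤ n`, so that Hamiltonian
cycles exist at all), every properly edge-colored complete graph on `n` vertices contains a
Hamiltonian cycle on whose edges at least `n - C * (log₂ n)²` distinct colors appear. -/
theorem hamiltonian_cycle_with_many_colors :
    ∃ C : ℝ, ∀ n : ℕ, 3 ≤ n → ∀ c : Sym2 (Fin n) → ℕ,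
      IsProperEdgeColoring (⊤ : SimpleGraph (Fin n)) c →
      ∃ (v : Fin n) (w : (⊤ : SimpleGraph (Fin n)).Walk v v),
        w.IsHamiltonianCycle ∧
        (n : ℝ) - C * (Real.logb 2 n) ^ 2 ≤ ((w.edges.map c).toFinset.card : ℝ) := by
  refine ⟨20000, fun n hn c hc => ?_⟩
  obtain ⟨T, hT⟩ := HC.exists_Mx (fun u v : Fin n => c s(u, v))
  have hd := HC.deficit (col := fun u v : Fin n => c s(u, v)) (fun u v => by rw [Sym2.eq_swap]) (by
    intro u x y hx hy he
    by_contra hxy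
    refine hc (e₁ := s(u, x)) (e₂ := s(u, y)) ?_ ?_ ?_ ⟨u, by simp, by simp⟩ he
    · simpa using hx.symm
    · simpa using hy.symm
    · rw [Ne, Sym2.congr_right]; exact hxy) hn hT
  obtain ⟨v, w, hw, hwe⟩ := HC.ham T hn
  refine ⟨v, w, hw, ?_⟩
  have h1 := T.card_cols hT.rb
  have h2 : (T.cols (fun u v : Fin n => c s(u, v))).card ≤ (w.edges.map c).toFinset.card := by
    apply Finset.card_le_card
    intro κ hκ
    obtain ⟨x, hx⟩ := T.mem_cols.1 hκ
    obtain ⟨p, hp, hpc⟩ := T.a_eq.1 hx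
    rw [List.mem_toFinset, List.mem_map]
    exact ⟨s(x, p), hwe x p hp, by rw [Sym2.eq_swap]; exact hpc⟩
  have h3 : n ≤ (w.edges.map c).toFinset.card + 20000 * (Nat.log 2 n) ^ 2 := by omega
  have h4 : (n : ℝ) ≤ ((w.edges.map c).toFinset.card : ℝ) + 20000 * ((Nat.log 2 n : ℕ) : ℝ) ^ 2 := by exact_mod_cast h3
  have h5 : ((Nat.log 2 n : ℕ) : ℝ) ≤ Real.logb 2 n := Real.natLog_le_logb n 2
  have h6 : ((Nat.log 2 n : ℕ) : ℝ) ^ 2 ≤ (Real.logb 2 n) ^ 2 := pow_le_pow_left₀ (by positivity) h5 2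
  linarith
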